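/- arXiv:math/0305062 — 2 statements merged into one kernel-verified Lean document; each statement's English description precedes it below -/
import Mathlib

section
/- Suppose g is simple. The centraliser of the Casimir algebra in the universal enveloping algebra, {x ∈ U(g) : xc = cx for all c ∈ C(g)}, equals the unital subalgebra of U(g) generated by h together with the centre Z(U(g)). -/
open LieAlgebra UniversalEnvelopingAlgebra

/-- `x` is a root vector for the functional `α` on the Cartan subalgebra `H`. -/
def IsRootVector {L : Type} [LieRing L] [LieAlgebra ℂ L] (H : LieSubalgebra ℂ L)
    (α : Module.Dual ℂ H) (x : L) : Prop :=
  ∀ t : H, ⁅(t : L), x⁆ = α t • x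

section CartanCentralizer

open Module

section LinearPolynomials

variable {K V : Type*} [Field K] [AddCommGroup V] [Module K V] [FiniteDimensional K V]

variable (K V) in
/-- The symmetric algebra of `V`, realised as polynomials in a basis of `V`. -/
abbrev PolyAlg : Type _ := MvPolynomial (Fin (finrank K V)) K

namespace PolyAlg

variable (K) in
/-- The inclusion of `V` into its symmetric algebra. -/
noncomputable def lin : V →ₗ[K] PolyAlg K V := (finBasis K V).constr K MvPolynomial.X

lemma lin_basis (i : Fin (finrank K V)) : lin K (finBasis K V i) = MvPolynomial.X i := by
  simp [lin]

/-- The derivation extending a linear map on generators. -/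
noncomputable def der (f : V →ₗ[K] PolyAlg K V) : Derivation K (PolyAlg K V) (PolyAlg K V) :=
  MvPolynomial.mkDerivation K (fun i ↦ f (finBasis K V i))

lemma der_lin (f : V →ₗ[K] PolyAlg K V) (v : V) : der f (lin K v) = f v := by
  have : (der f).toLinearMap ∘ₗ lin K = f := by
    apply (finBasis K V).ext
    intro i
    simp [lin_basis, der, MvPolynomial.mkDerivation_X]
  exact LinearMap.congr_fun this v

lemma derivation_ext {D₁ D₂ : Derivation K (PolyAlg K V) (PolyAlg K V)}
    (h : ∀ v, D₁ (lin K v) = D₂ (lin K v)) : D₁ = D₂ := by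
  apply MvPolynomial.derivation_ext
  intro i
  rw [← lin_basis]; exact h _

/-- The algebra homomorphism extending a linear map on generators. -/
noncomputable def hom {A : Type*} [CommRing A] [Algebra K A] (f : V →ₗ[K] A) :
    PolyAlg K V →ₐ[K] A :=
  MvPolynomial.aeval (fun i ↦ f (finBasis K V i))

lemma hom_lin {A : Type*} [CommRing A] [Algebra K A] (f : V →ₗ[K] A) (v : V) :
    hom f (lin K v) = f v := by
  have : (hom f).toLinearMap ∘ₗ lin K = f := by
    apply (finBasis K V).ext
    intro i
    simp [lin_basis, hom]
  exact LinearMap.congr_fun this v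

lemma algHom_ext {A : Type*} [CommRing A] [Algebra K A] {f g : PolyAlg K V →ₐ[K] A}
    (h : ∀ v, f (lin K v) = g (lin K v)) : f = g := by
  apply MvPolynomial.algHom_ext
  intro i
  rw [← lin_basis]; exact h _

lemma adjoin_range_lin : Algebra.adjoin K (Set.range (lin K : V → PolyAlg K V)) = ⊤ := by
  rw [eq_top_iff, ← MvPolynomial.adjoin_range_X]
  apply Algebra.adjoin_mono
  rintro _ ⟨i, rfl⟩
  exact ⟨_, lin_basis i⟩

lemma induction_lin {C : PolyAlg K V → Prop} (p : PolyAlg K V)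
    (h0 : ∀ r, C (algebraMap K _ r)) (h1 : ∀ v, C (lin K v))
    (hadd : ∀ a b, C a → C b → C (a + b)) (hmul : ∀ a b, C a → C b → C (a * b)) : C p := by
  have hp : p ∈ Algebra.adjoin K (Set.range (lin K : V → PolyAlg K V)) := by
    rw [adjoin_range_lin]; trivial
  induction hp using Algebra.adjoin_induction with
  | mem x hx => obtain ⟨v, rfl⟩ := hx; exact h1 v
  | algebraMap r => exact h0 r
  | add x y _ _ hx hy => exact hadd _ _ hx hy
  | mul x y _ _ hx hy => exact hmul _ _ hx hy

/-- Degree `n` part. -/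
noncomputable abbrev deg (K V : Type*) [Field K] [AddCommGroup V] [Module K V]
    [FiniteDimensional K V] (n : ℕ) : Submodule K (PolyAlg K V) :=
  MvPolynomial.homogeneousSubmodule (Fin (finrank K V)) K n

lemma range_lin : LinearMap.range (lin K : V →ₗ[K] PolyAlg K V) = deg K V 1 := by
  rw [deg, MvPolynomial.homogeneousSubmodule_one_eq_span_X, lin, Basis.constr_range]

lemma lin_mem (v : V) : lin K v ∈ deg K V 1 := by
  rw [← range_lin]; exact ⟨v, rfl⟩

lemma deg_mul {m n : ℕ} {p q : PolyAlg K V} (hp : p ∈ deg K V m) (hq : q ∈ deg K V n) :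
    p * q ∈ deg K V (m + n) :=
  MvPolynomial.IsHomogeneous.mul hp hq

lemma lin_injective : Function.Injective (lin K : V →ₗ[K] PolyAlg K V) := by
  rw [injective_iff_map_eq_zero]
  intro v hv
  rw [← Module.forall_dual_apply_eq_zero_iff K]
  intro φ
  rw [← hom_lin (φ : V →ₗ[K] K) v, hv, map_zero]

lemma lin_ne_zero {v : V} (hv : v ≠ 0) : lin K v ≠ 0 := by
  rwa [ne_eq, map_eq_zero_iff _ lin_injective]

lemma totalDegree_lin {v : V} (hv : v ≠ 0) : (lin K v).totalDegree = 1 :=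
  MvPolynomial.IsHomogeneous.totalDegree (lin_mem v) (lin_ne_zero hv)

lemma prime_lin {v : V} (hv : v ≠ 0) : Prime (lin K v) := by
  apply Irreducible.prime
  apply MvPolynomial.irreducible_of_totalDegree_eq_one (totalDegree_lin hv)
  intro x hx
  rw [isUnit_iff_ne_zero]
  rintro rfl
  apply lin_ne_zero (K := K) hv
  ext i
  simpa using hx i

lemma exists_eq_smul_of_lin_dvd_lin {v w : V} (hw : w ≠ 0) (h : lin K v ∣ lin K w) :
    ∃ r : K, w = r • v := by
  obtain ⟨a, ha⟩ := h
  have hv : v ≠ 0 := by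
    rintro rfl
    apply lin_ne_zero (K := K) hw
    simp [ha]
  have ha0 : a ≠ 0 := by
    rintro rfl
    apply lin_ne_zero (K := K) hw
    simp [ha]
  have h1 := MvPolynomial.totalDegree_mul_of_isDomain (lin_ne_zero (K := K) hv) ha0
  rw [← ha, totalDegree_lin hv, totalDegree_lin hw] at h1
  obtain ⟨r, rfl⟩ : ∃ r, a = MvPolynomial.C r :=
    ⟨_, MvPolynomial.totalDegree_eq_zero_iff_eq_C.mp (by omega)⟩
  refine ⟨r, lin_injective (K := K) ?_⟩
  rw [ha, map_smul, mul_comm, MvPolynomial.smul_eq_C_mul]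

lemma mem_deg_of_lin_mul_mem {v : V} (hv : v ≠ 0) {q : PolyAlg K V} {n : ℕ}
    (h : lin K v * q ∈ deg K V (n + 1)) : q ∈ deg K V n := by
  let _ : GradedAlgebra (deg K V) := MvPolynomial.gradedAlgebra
  have h1 := DirectSum.coe_decompose_mul_add_of_left_mem (deg K V) (j := n) (b := q) (lin_mem v)
  rw [add_comm 1 n, DirectSum.decompose_of_mem_same _ h] at h1
  rw [mul_left_cancel₀ (lin_ne_zero hv) h1]
  exact SetLike.coe_mem _

lemma eq_zero_of_lin_mul_mem {v : V} (hv : v ≠ 0) {q : PolyAlg K V}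
    (h : lin K v * q ∈ deg K V 0) : q = 0 := by
  by_contra hq
  have h1 := MvPolynomial.totalDegree_mul_of_isDomain (lin_ne_zero (K := K) hv) hq
  rw [Nat.le_zero.mp (MvPolynomial.IsHomogeneous.totalDegree_le h), totalDegree_lin hv] at h1
  omega

end PolyAlg

end LinearPolynomials

section Symbol

attribute [local instance] LieRing.ofAssociativeRing

variable {K L : Type*} [Field K] [LieRing L] [LieAlgebra K L] [FiniteDimensional K L]

/-- The adjoint action of `x` on the symmetric algebra of `L`, as a derivation. -/
noncomputable def polyAd (x : L) : Derivation K (PolyAlg K L) (PolyAlg K L) :=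
  PolyAlg.der (PolyAlg.lin K ∘ₗ (LieAlgebra.ad K L x : L →ₗ[K] L))

lemma polyAd_lin (x y : L) : polyAd x (PolyAlg.lin K y) = PolyAlg.lin K ⁅x, y⁆ := by
  simp [polyAd, PolyAlg.der_lin]

lemma derivation_mem_deg {V : Type*} [AddCommGroup V] [Module K V] [FiniteDimensional K V]
    (D : Derivation K (PolyAlg K V) (PolyAlg K V))
    (h : ∀ v, D (PolyAlg.lin K v) ∈ PolyAlg.deg K V 1) {n : ℕ} {p : PolyAlg K V}
    (hp : p ∈ PolyAlg.deg K V n) : D p ∈ PolyAlg.deg K V n := by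
  rw [PolyAlg.deg, ← MvPolynomial.homogeneousSubmodule_one_pow, ← PolyAlg.deg,
    ← PolyAlg.range_lin] at hp
  induction hp using Submodule.pow_induction_on_left' with
  | algebraMap r => simp
  | add x y i _ _ hx hy => rw [map_add]; exact add_mem hx hy
  | mem_mul m hm i x hx ih =>
    obtain ⟨v, rfl⟩ := hm
    rw [D.leibniz, smul_eq_mul, smul_eq_mul, Nat.succ_eq_add_one, add_comm i 1]
    have hx' : x ∈ PolyAlg.deg K V i := by
      rwa [PolyAlg.range_lin, MvPolynomial.homogeneousSubmodule_one_pow] at hx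
    refine add_mem (PolyAlg.deg_mul (PolyAlg.lin_mem v) ih) ?_
    rw [add_comm 1 i]
    exact PolyAlg.deg_mul hx' (h v)

lemma polyAd_mem_deg (x : L) {n : ℕ} {p : PolyAlg K L} (hp : p ∈ PolyAlg.deg K L n) :
    polyAd x p ∈ PolyAlg.deg K L n :=
  derivation_mem_deg _ (fun v ↦ by rw [polyAd_lin]; exact PolyAlg.lin_mem _) hp

/-- The left-invariant vector field on `End L` attached to `x`. -/
noncomputable def vecField (x : L) : Derivation K (PolyAlg K (Module.End K L × L))
    (PolyAlg K (Module.End K L × L)) :=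
  PolyAlg.der (PolyAlg.lin K ∘ₗ LinearMap.inl K _ _ ∘ₗ
    LinearMap.mulLeft K (LieAlgebra.ad K L x) ∘ₗ LinearMap.fst K _ _)

lemma vecField_lin (x : L) (M : Module.End K L) (l : L) :
    vecField x (PolyAlg.lin K (M, l)) = PolyAlg.lin K (LieAlgebra.ad K L x * M, (0 : L)) := by
  simp [vecField, PolyAlg.der_lin]

/-- The infinitesimal conjugation action of `x`. -/
noncomputable def conjField (x : L) : Derivation K (PolyAlg K (Module.End K L × L))
    (PolyAlg K (Module.End K L × L)) :=
  PolyAlg.der (PolyAlg.lin K ∘ₗ LinearMap.prodMap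
    (LieAlgebra.ad K (Module.End K L) (LieAlgebra.ad K L x)) (LieAlgebra.ad K L x))

lemma conjField_lin (x : L) (M : Module.End K L) (l : L) :
    conjField x (PolyAlg.lin K (M, l)) =
      PolyAlg.lin K (⁅LieAlgebra.ad K L x, M⁆, ⁅x, l⁆) := by
  simp [conjField, PolyAlg.der_lin]

lemma vecField_lie (x y : L) :
    vecField (K := K) ⁅x, y⁆ = ⁅vecField (K := K) x, vecField y⁆ := by
  apply PolyAlg.derivation_ext
  rintro ⟨M, l⟩
  rw [Derivation.commutator_apply]
  simp only [vecField_lin, ← map_sub, Prod.mk_sub_mk, sub_self, LieHom.map_lie,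
    LieRing.of_associative_ring_bracket, sub_mul, mul_assoc]

lemma conjField_vecField (x y : L) :
    ⁅conjField (K := K) x, vecField (K := K) y⁆ = vecField ⁅x, y⁆ := by
  apply PolyAlg.derivation_ext
  rintro ⟨M, l⟩
  rw [Derivation.commutator_apply]
  simp only [vecField_lin, conjField_lin, ← map_sub, Prod.mk_sub_mk, sub_self, LieHom.map_lie,
    LieRing.of_associative_ring_bracket, sub_mul, mul_sub, mul_assoc, lie_zero]
  congr 2
  abel

variable (K L) in
/-- Evaluation at the identity of `End L`. -/
noncomputable def evalOne : PolyAlg K (Module.End K L × L) →ₐ[K] PolyAlg K L :=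
  PolyAlg.hom ((Algebra.linearMap K (PolyAlg K L) ∘ₗ LinearMap.trace K L).coprod
    (PolyAlg.lin K))

lemma evalOne_lin (M : Module.End K L) (l : L) :
    evalOne K L (PolyAlg.lin K (M, l)) =
      algebraMap K _ (LinearMap.trace K L M) + PolyAlg.lin K l := by
  simp [evalOne, PolyAlg.hom_lin]

variable (K L) in
/-- The inclusion of constant functions. -/
noncomputable def constIncl : PolyAlg K L →ₐ[K] PolyAlg K (Module.End K L × L) :=
  PolyAlg.hom (PolyAlg.lin K ∘ₗ LinearMap.inr K _ _)

lemma constIncl_lin (l : L) :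
    constIncl K L (PolyAlg.lin K l) = PolyAlg.lin K ((0 : Module.End K L), l) := by
  simp [constIncl, PolyAlg.hom_lin]

lemma evalOne_constIncl (p : PolyAlg K L) : evalOne K L (constIncl K L p) = p := by
  have : (evalOne K L).comp (constIncl K L) = AlgHom.id K _ := by
    apply PolyAlg.algHom_ext
    intro v
    simp [constIncl_lin, evalOne_lin]
  exact DFunLike.congr_fun this p

lemma vecField_constIncl (x : L) (p : PolyAlg K L) : vecField x (constIncl K L p) = 0 := by
  induction p using PolyAlg.induction_lin with
  | h0 r => simp
  | h1 v => rw [constIncl_lin, vecField_lin, mul_zero]; exact map_zero _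
  | hadd a b ha hb => simp [ha, hb]
  | hmul a b ha hb => simp [Derivation.leibniz, ha, hb]

lemma evalOne_conjField (x : L) (a : PolyAlg K (Module.End K L × L)) :
    evalOne K L (conjField x a) = polyAd x (evalOne K L a) := by
  induction a using PolyAlg.induction_lin with
  | h0 r => simp
  | h1 v =>
    obtain ⟨M, l⟩ := v
    rw [conjField_lin, evalOne_lin, evalOne_lin, map_add, polyAd_lin, Derivation.map_algebraMap,
      LieRing.of_associative_ring_bracket, map_sub, LinearMap.trace_mul_comm, sub_self, map_zero]
  | hadd a b ha hb => simp [ha, hb]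
  | hmul a b ha hb => simp [Derivation.leibniz, ha, hb]

/-- The summand of `logCoord`. -/
noncomputable def logForm : L →ₗ[K] L →ₗ[K] PolyAlg K (Module.End K L × L) :=
  LinearMap.mk₂ K (fun y z ↦ (PolyAlg.lin K (LieAlgebra.ad K L y, (0 : L)) -
    algebraMap K _ (LinearMap.trace K L (LieAlgebra.ad K L y))) *
      PolyAlg.lin K ((0 : Module.End K L), z))
    (by
      intro y y' z
      have : ((LieAlgebra.ad K L (y + y'), (0 : L)) : Module.End K L × L) =
        (LieAlgebra.ad K L y, 0) + (LieAlgebra.ad K L y', 0) := by simp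
      rw [this]; simp only [map_add]; ring)
    (by
      intro c y z
      have : ((LieAlgebra.ad K L (c • y), (0 : L)) : Module.End K L × L) =
        c • (LieAlgebra.ad K L y, 0) := by simp
      rw [this, map_smul, map_smul, map_smul, smul_eq_mul, map_mul,
        Algebra.smul_def c (PolyAlg.lin K _), Algebra.smul_def]
      ring)
    (by
      intro y z z'
      have : (((0 : Module.End K L), z + z') : Module.End K L × L) =
        (0, z) + (0, z') := by simp
      rw [this]; simp only [map_add]; ring)
    (by
      intro c y z
      have : (((0 : Module.End K L), c • z) : Module.End K L × L) =
        c • (0, z) := by simp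
      rw [this]; simp only [map_smul, Algebra.smul_def]; ring)

lemma logForm_apply (y z : L) : logForm (K := K) y z =
    (PolyAlg.lin K (LieAlgebra.ad K L y, (0 : L)) -
      algebraMap K _ (LinearMap.trace K L (LieAlgebra.ad K L y))) *
        PolyAlg.lin K ((0 : Module.End K L), z) := rfl

section Casimir

variable [IsKilling K L]

variable (K L) in
/-- The basis of `L` dual to `finBasis K L` for the Killing form. -/
noncomputable def killingDual : Basis (Fin (finrank K L)) K L :=
  LinearMap.BilinForm.dualBasis (killingForm K L) (IsKilling.killingForm_nondegenerate K L)
    (finBasis K L)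

lemma sum_killingForm_smul_dual (x : L) :
    ∑ i, killingForm K L x (finBasis K L i) • killingDual K L i = x := by
  conv_rhs => rw [← (killingDual K L).sum_repr x]
  simp [killingDual, LinearMap.BilinForm.dualBasis_repr_apply]

lemma sum_killingForm_smul_basis (x : L) :
    ∑ i, killingForm K L x (killingDual K L i) • finBasis K L i = x := by
  conv_rhs => rw [← (finBasis K L).sum_repr x]
  refine Finset.sum_congr rfl fun i _ ↦ ?_
  congr 1
  conv_lhs => rw [← (finBasis K L).sum_repr x]
  simp only [map_sum, map_smul, LinearMap.sum_apply, LinearMap.smul_apply, killingDual]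
  simp [LieModule.traceForm_comm K L L (finBasis K L _),
    LinearMap.BilinForm.apply_dualBasis_left]

lemma casimir_invariant {M : Type*} [AddCommGroup M] [Module K M] (T : L →ₗ[K] L →ₗ[K] M)
    (x : L) : ∑ i, (T ⁅x, finBasis K L i⁆ (killingDual K L i) +
      T (finBasis K L i) ⁅x, killingDual K L i⁆) = 0 := by
  have h1 : ∀ i, T ⁅x, finBasis K L i⁆ (killingDual K L i) =
      ∑ j, killingForm K L ⁅x, finBasis K L i⁆ (killingDual K L j) •
        T (finBasis K L j) (killingDual K L i) := by
    intro i
    conv_lhs => rw [← sum_killingForm_smul_basis (K := K) ⁅x, finBasis K L i⁆]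
    simp
  have h2 : ∀ i, T (finBasis K L i) ⁅x, killingDual K L i⁆ =
      ∑ j, killingForm K L ⁅x, killingDual K L i⁆ (finBasis K L j) •
        T (finBasis K L i) (killingDual K L j) := by
    intro i
    conv_lhs => rw [← sum_killingForm_smul_dual (K := K) ⁅x, killingDual K L i⁆]
    simp
  rw [Finset.sum_add_distrib]
  simp only [h1, h2]
  rw [Finset.sum_comm, ← Finset.sum_add_distrib]
  refine Finset.sum_eq_zero fun i _ ↦ ?_
  rw [← Finset.sum_add_distrib]
  refine Finset.sum_eq_zero fun j _ ↦ ?_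
  rw [← add_smul]
  have : killingForm K L ⁅x, finBasis K L j⁆ (killingDual K L i) +
      killingForm K L ⁅x, killingDual K L i⁆ (finBasis K L j) = 0 := by
    rw [LieModule.traceForm_comm K L L ⁅x, killingDual K L i⁆, ← lie_skew, map_neg,
      LinearMap.neg_apply, LieModule.traceForm_apply_lie_apply]
    simp
  rw [this, zero_smul]

variable (K L) in
/-- The tautological linear coordinate, an `L`-equivariant first order coordinate at the identity
along `L` obtained from the trace pairing with `ad L`. -/
noncomputable def logCoord : PolyAlg K (Module.End K L × L) :=
  ∑ i, logForm (finBasis K L i) (killingDual K L i)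

lemma evalOne_logCoord : evalOne K L (logCoord K L) = 0 := by
  rw [logCoord, map_sum]
  refine Finset.sum_eq_zero fun i _ ↦ ?_
  rw [logForm_apply, map_mul, map_sub, evalOne_lin]
  simp

lemma evalOne_vecField_logCoord (x : L) :
    evalOne K L (vecField x (logCoord K L)) = PolyAlg.lin K x := by
  conv_rhs => rw [← sum_killingForm_smul_dual (K := K) x]
  rw [logCoord, map_sum, map_sum, map_sum]
  refine Finset.sum_congr rfl fun i _ ↦ ?_
  rw [logForm_apply, Derivation.leibniz, map_sub, vecField_lin, vecField_lin,
    Derivation.map_algebraMap]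
  simp only [mul_zero, Prod.mk_zero_zero, map_zero, smul_eq_mul, zero_add, sub_zero, map_mul,
    evalOne_lin, add_zero, map_smul]
  rw [mul_comm, ← Algebra.smul_def]
  rfl

lemma conjField_logCoord (x : L) : conjField x (logCoord K L) = 0 := by
  rw [logCoord, map_sum, ← casimir_invariant logForm x]
  refine Finset.sum_congr rfl fun i _ ↦ ?_
  simp only [logForm_apply]
  rw [Derivation.leibniz, map_sub, conjField_lin, conjField_lin, Derivation.map_algebraMap,
    LieHom.map_lie]
  have : LinearMap.trace K L ⁅LieAlgebra.ad K L x, LieAlgebra.ad K L (finBasis K L i)⁆ = 0 := by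
    rw [LieRing.of_associative_ring_bracket, map_sub, LinearMap.trace_mul_comm, sub_self]
  rw [this]
  simp
  ring

end Casimir

end Symbol

section Filtration

attribute [local instance] LieRing.ofAssociativeRing

variable {K L : Type*} [Field K] [LieRing L] [LieAlgebra K L]

lemma ι_lie (x y : L) : ι K ⁅x, y⁆ = ι K x * ι K y - ι K y * ι K x := by
  rw [LieHom.map_lie, LieRing.of_associative_ring_bracket]

variable (K L) in
/-- The standard filtration of the enveloping algebra. -/
noncomputable def envFilt (n : ℕ) : Submodule K (UniversalEnvelopingAlgebra K L) :=
  (1 ⊔ LinearMap.range (ι K : L →ₗ⁅K⁆ UniversalEnvelopingAlgebra K L).toLinearMap) ^ n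

lemma ι_mem_envFilt (x : L) : ι K x ∈ envFilt K L 1 := by
  rw [envFilt, pow_one]
  exact Submodule.mem_sup_right ⟨x, rfl⟩

lemma one_mem_envFilt (n : ℕ) : 1 ∈ envFilt K L n :=
  Submodule.one_le.mp (one_le_pow_of_one_le' le_sup_left n)

lemma envFilt_mul {m n : ℕ} {u v : UniversalEnvelopingAlgebra K L} (hu : u ∈ envFilt K L m)
    (hv : v ∈ envFilt K L n) : u * v ∈ envFilt K L (m + n) := by
  rw [envFilt, pow_add]
  exact Submodule.mul_mem_mul hu hv

lemma envFilt_mono {m n : ℕ} (h : m ≤ n) : envFilt K L m ≤ envFilt K L n :=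
  pow_le_pow_right' le_sup_left h

lemma ι_mul_mem_envFilt (x : L) {n : ℕ} {u : UniversalEnvelopingAlgebra K L}
    (hu : u ∈ envFilt K L n) : ι K x * u ∈ envFilt K L (n + 1) := by
  rw [add_comm]
  exact envFilt_mul (ι_mem_envFilt x) hu

lemma envFilt_induction {C : ∀ n u, u ∈ envFilt K L n → Prop}
    (h_one : C 0 1 (one_mem_envFilt 0))
    (h_add : ∀ n u v (hu : u ∈ envFilt K L n) (hv : v ∈ envFilt K L n), C n u hu → C n v hv →
      C n (u + v) (add_mem hu hv))
    (h_smul : ∀ n (r : K) u (hu : u ∈ envFilt K L n), C n u hu →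
      C n (r • u) (Submodule.smul_mem _ r hu))
    (h_succ : ∀ n u (hu : u ∈ envFilt K L n), C n u hu →
      C (n + 1) u (envFilt_mono (Nat.le_succ n) hu))
    (h_mul : ∀ n x u (hu : u ∈ envFilt K L n), C n u hu →
      C (n + 1) (ι K x * u) (ι_mul_mem_envFilt x hu))
    {n : ℕ} {u : UniversalEnvelopingAlgebra K L} (hu : u ∈ envFilt K L n) : C n u hu := by
  induction hu using Submodule.pow_induction_on_left' with
  | algebraMap r =>
    have := h_smul _ r _ (one_mem_envFilt 0) h_one
    simpa only [Algebra.algebraMap_eq_smul_one] using this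
  | add x y i hx hy ihx ihy => exact h_add _ _ _ hx hy ihx ihy
  | mem_mul m hm i x hx ih =>
    obtain ⟨a, ha, b, ⟨y, rfl⟩, rfl⟩ := Submodule.mem_sup.mp hm
    obtain ⟨r, rfl⟩ := Submodule.mem_one.mp ha
    have hx' : x ∈ envFilt K L (i + 1) := envFilt_mono (Nat.le_succ i) hx
    have := h_add _ _ _ (Submodule.smul_mem _ r hx') (ι_mul_mem_envFilt y hx)
      (h_smul _ r _ hx' (h_succ _ _ hx ih)) (h_mul _ y _ hx ih)
    simp only [Algebra.smul_def] at this
    simp only [add_mul]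
    exact this

lemma exists_mem_envFilt (u : UniversalEnvelopingAlgebra K L) : ∃ n, u ∈ envFilt K L n := by
  let S : Subalgebra K (UniversalEnvelopingAlgebra K L) :=
    { carrier := {u | ∃ n, u ∈ envFilt K L n}
      mul_mem' := fun ⟨m, hm⟩ ⟨n, hn⟩ ↦ ⟨m + n, envFilt_mul hm hn⟩
      add_mem' := fun ⟨m, hm⟩ ⟨n, hn⟩ ↦ ⟨max m n, add_mem (envFilt_mono (le_max_left m n) hm)
        (envFilt_mono (le_max_right m n) hn)⟩
      algebraMap_mem' := fun r ↦ ⟨0, by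
        rw [Algebra.algebraMap_eq_smul_one]
        exact Submodule.smul_mem _ _ (one_mem_envFilt 0)⟩ }
  let f : L →ₗ⁅K⁆ S :=
    { toFun := fun x ↦ ⟨ι K x, 1, ι_mem_envFilt x⟩
      map_add' := fun x y ↦ Subtype.ext (map_add _ _ _)
      map_smul' := fun r x ↦ Subtype.ext (map_smul _ _ _)
      map_lie' := fun {x y} ↦ Subtype.ext (ι_lie x y) }
  have h : S.val.comp (lift K f) = AlgHom.id K _ := by
    apply hom_ext
    ext x
    change ((lift K f (ι K x) : S) : UniversalEnvelopingAlgebra K L) = ι K x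
    rw [lift_ι_apply]
    rfl
  have := (lift K f u).2
  rwa [show ((lift K f u : S) : UniversalEnvelopingAlgebra K L) = u from
    DFunLike.congr_fun h u] at this

lemma ι_commutator_mem (x : L) {n : ℕ} {u : UniversalEnvelopingAlgebra K L}
    (hu : u ∈ envFilt K L n) : ι K x * u - u * ι K x ∈ envFilt K L n := by
  induction hu using envFilt_induction with
  | h_one => simp
  | h_add n u v _ _ hu hv =>
    convert add_mem hu hv using 1; noncomm_ring
  | h_smul n r u _ hu =>
    convert Submodule.smul_mem _ r hu using 1
    rw [smul_sub, mul_smul_comm, smul_mul_assoc]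
  | h_succ n u _ hu => exact envFilt_mono (Nat.le_succ n) hu
  | h_mul n y u hm hu =>
    have h : ι K x * (ι K y * u) - ι K y * u * ι K x =
        ι K ⁅x, y⁆ * u + ι K y * (ι K x * u - u * ι K x) := by
      rw [ι_lie]; noncomm_ring
    rw [h, add_comm n 1]
    exact add_mem (envFilt_mul (ι_mem_envFilt _) hm) (envFilt_mul (ι_mem_envFilt _) hu)

lemma eq_smul_one_of_mem_envFilt_zero {u : UniversalEnvelopingAlgebra K L}
    (hu : u ∈ envFilt K L 0) : ∃ r : K, u = r • 1 := by
  rw [envFilt, pow_zero] at hu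
  obtain ⟨r, rfl⟩ := Submodule.mem_one.mp hu
  exact ⟨r, Algebra.algebraMap_eq_smul_one r⟩

end Filtration

section SymbolMap

attribute [local instance] LieRing.ofAssociativeRing

variable {K L : Type*} [Field K] [LieRing L] [LieAlgebra K L] [FiniteDimensional K L]

variable (K L) in
/-- The action of the enveloping algebra by left-invariant differential operators. -/
noncomputable def diffOp : UniversalEnvelopingAlgebra K L →ₐ[K]
    Module.End K (PolyAlg K (Module.End K L × L)) :=
  lift K
    { toFun := fun x ↦ (vecField x).toLinearMap
      map_add' := fun x y ↦ by
        have : vecField (K := K) (x + y) = vecField x + vecField y := by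
          apply PolyAlg.derivation_ext
          rintro ⟨M, l⟩
          rw [Derivation.add_apply, vecField_lin, vecField_lin, vecField_lin, map_add (ad K L),
            add_mul, ← map_add, Prod.mk_add_mk, add_zero]
        rw [this]; rfl
      map_smul' := fun r x ↦ by
        have : vecField (K := K) (r • x) = r • vecField x := by
          apply PolyAlg.derivation_ext
          rintro ⟨M, l⟩
          rw [Derivation.smul_apply, vecField_lin, vecField_lin, map_smul (ad K L),
            smul_mul_assoc, ← map_smul, Prod.smul_mk, smul_zero]
        rw [this]; rfl
      map_lie' := fun {x y} ↦ by
        rw [vecField_lie]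
        ext a
        simp [LieRing.of_associative_ring_bracket] }

lemma diffOp_ι (x : L) (a : PolyAlg K (Module.End K L × L)) :
    diffOp K L (ι K x) a = vecField x a := by
  rw [diffOp, lift_ι_apply]; rfl

lemma diffOp_constIncl_mul (u : UniversalEnvelopingAlgebra K L) (p : PolyAlg K L)
    (a : PolyAlg K (Module.End K L × L)) :
    diffOp K L u (constIncl K L p * a) = constIncl K L p * diffOp K L u a := by
  obtain ⟨n, hn⟩ := exists_mem_envFilt u
  induction hn using envFilt_induction with
  | h_one => simp
  | h_add n u v _ _ hu hv => simp [hu, hv, mul_add]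
  | h_smul n r u _ hu => simp [hu]
  | h_succ n u _ hu => exact hu
  | h_mul n y u hm hu =>
    rw [map_mul (diffOp K L), Module.End.mul_apply, Module.End.mul_apply, hu, diffOp_ι, diffOp_ι,
      Derivation.leibniz, vecField_constIncl]
    simp

variable (K L) in
/-- The ideal of functions vanishing at the identity. -/
noncomputable def idealOne : Ideal (PolyAlg K (Module.End K L × L)) := RingHom.ker (evalOne K L)

lemma derivation_mem_pow {R A : Type*} [CommRing R] [CommRing A] [Algebra R A]
    (D : Derivation R A A) (I : Ideal A) (k : ℕ) {a : A} (ha : a ∈ I ^ (k + 1)) :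
    D a ∈ I ^ k := by
  induction k generalizing a with
  | zero => simp
  | succ k ih =>
    rw [pow_succ] at ha
    induction ha using Submodule.mul_induction_on' with
    | mem_mul_mem x hx y hy =>
      rw [D.leibniz, smul_eq_mul, smul_eq_mul]
      refine add_mem (Ideal.mul_mem_right _ _ hx) ?_
      rw [pow_succ, mul_comm y]
      exact Ideal.mul_mem_mul (ih hx) hy
    | add x _ y _ hx hy => rw [map_add]; exact add_mem hx hy

lemma diffOp_mem_pow {m : ℕ} {u : UniversalEnvelopingAlgebra K L} (hu : u ∈ envFilt K L m) :
    ∀ (k : ℕ) {a : PolyAlg K (Module.End K L × L)}, a ∈ idealOne K L ^ (k + m) →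
      diffOp K L u a ∈ idealOne K L ^ k := by
  induction hu using envFilt_induction with
  | h_one => intro k a ha; simpa using ha
  | h_add n u v _ _ hu hv =>
    intro k a ha
    rw [map_add]; exact add_mem (hu k ha) (hv k ha)
  | h_smul n r u _ hu =>
    intro k a ha
    rw [map_smul, LinearMap.smul_apply]
    exact Submodule.smul_of_tower_mem _ r (hu k ha)
  | h_succ n u _ hu =>
    intro k a ha
    exact hu k (Ideal.pow_le_pow_right (by omega) ha)
  | h_mul n y u hm hu =>
    intro k a ha
    rw [map_mul, Module.End.mul_apply, diffOp_ι]
    apply derivation_mem_pow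
    apply hu
    rwa [show k + 1 + n = k + (n + 1) by omega]

lemma diffOp_commutator (x : L) (u : UniversalEnvelopingAlgebra K L)
    (a : PolyAlg K (Module.End K L × L)) (ha : conjField x a = 0) :
    conjField x (diffOp K L u a) = diffOp K L (ι K x * u - u * ι K x) a := by
  obtain ⟨n, hn⟩ := exists_mem_envFilt u
  induction hn using envFilt_induction with
  | h_one => simp [ha]
  | h_add n u v _ _ hu hv =>
    rw [map_add, LinearMap.add_apply, map_add, hu, hv, ← LinearMap.add_apply, ← map_add]
    congr 2
    noncomm_ring
  | h_smul n r u _ hu =>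
    rw [map_smul, LinearMap.smul_apply, Derivation.map_smul, hu, ← LinearMap.smul_apply,
      ← map_smul, smul_sub, mul_smul_comm, smul_mul_assoc]
  | h_succ n u _ hu => exact hu
  | h_mul n y u hm hu =>
    have h : ι K x * (ι K y * u) - ι K y * u * ι K x =
        ι K ⁅x, y⁆ * u + ι K y * (ι K x * u - u * ι K x) := by
      rw [ι_lie]; noncomm_ring
    have h2 := congrArg (fun D ↦ D (diffOp K L u a)) (conjField_vecField (K := K) x y)
    simp only [Derivation.commutator_apply, hu] at h2
    rw [h, map_add, map_mul, map_mul, map_mul, LinearMap.add_apply, Module.End.mul_apply,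
      Module.End.mul_apply, Module.End.mul_apply, diffOp_ι, diffOp_ι, diffOp_ι, ← h2]
    abel

variable [IsKilling K L]

variable (K L) in
/-- Divided powers of the tautological coordinate. -/
noncomputable def logPow (n : ℕ) : PolyAlg K (Module.End K L × L) :=
  ((n.factorial : K)⁻¹) • logCoord K L ^ n

lemma logCoord_mem : logCoord K L ∈ idealOne K L := evalOne_logCoord

lemma logPow_mem (n : ℕ) : logPow K L n ∈ idealOne K L ^ n :=
  Submodule.smul_of_tower_mem _ _ (Ideal.pow_mem_pow logCoord_mem n)

lemma conjField_logPow (x : L) (n : ℕ) : conjField x (logPow K L n) = 0 := by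
  rw [logPow, Derivation.map_smul, Derivation.leibniz_pow, conjField_logCoord]
  simp

variable (K L) in
/-- The degree `n` symbol map. -/
noncomputable def symb (n : ℕ) : UniversalEnvelopingAlgebra K L →ₗ[K] PolyAlg K L :=
  (evalOne K L).toLinearMap ∘ₗ LinearMap.applyₗ (logPow K L n) ∘ₗ (diffOp K L).toLinearMap

lemma symb_apply (n : ℕ) (u : UniversalEnvelopingAlgebra K L) :
    symb K L n u = evalOne K L (diffOp K L u (logPow K L n)) := rfl

lemma symb_eq_zero {m n : ℕ} (h : m < n) {u : UniversalEnvelopingAlgebra K L}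
    (hu : u ∈ envFilt K L m) : symb K L n u = 0 := by
  have := diffOp_mem_pow hu (n - m) (a := logPow K L n)
    (by rw [Nat.sub_add_cancel h.le]; exact logPow_mem n)
  exact Ideal.pow_le_self (by omega) this

lemma symb_commutator (n : ℕ) (x : L) (u : UniversalEnvelopingAlgebra K L) :
    symb K L n (ι K x * u - u * ι K x) = polyAd x (symb K L n u) := by
  rw [symb_apply, symb_apply, ← evalOne_conjField, diffOp_commutator _ _ _ (conjField_logPow _ _)]

lemma symb_zero_one : symb K L 0 1 = 1 := by
  simp [symb_apply, logPow]

variable [CharZero K]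

lemma vecField_logPow (x : L) (n : ℕ) :
    vecField x (logPow K L (n + 1)) = logPow K L n * vecField x (logCoord K L) := by
  have h : ((n + 1).factorial : K)⁻¹ * (n + 1 : K) = (n.factorial : K)⁻¹ := by
    rw [Nat.factorial_succ]
    have := Nat.cast_add_one_ne_zero (R := K) n
    have := Nat.factorial_ne_zero n
    push_cast
    field_simp
  rw [logPow, logPow, Derivation.map_smul, Derivation.leibniz_pow, ← h, mul_smul,
    Nat.add_sub_cancel, smul_eq_mul, smul_mul_assoc, smul_mul_assoc]
  congr 1
  rw [← Nat.cast_smul_eq_nsmul K]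
  push_cast
  rfl

lemma exists_diffOp_sub_mem {m : ℕ} {u : UniversalEnvelopingAlgebra K L}
    (hu : u ∈ envFilt K L m) : ∃ p : PolyAlg K L, ∀ k,
      diffOp K L u (logPow K L (m + k)) - constIncl K L p * logPow K L k ∈
        idealOne K L ^ (k + 1) := by
  induction hu using envFilt_induction with
  | h_one => exact ⟨1, fun k ↦ by simp⟩
  | h_add n u v _ _ hu hv =>
    obtain ⟨p, hp⟩ := hu
    obtain ⟨q, hq⟩ := hv
    refine ⟨p + q, fun k ↦ ?_⟩
    convert add_mem (hp k) (hq k) using 1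
    simp only [map_add, LinearMap.add_apply]
    ring
  | h_smul n r u _ hu =>
    obtain ⟨p, hp⟩ := hu
    refine ⟨r • p, fun k ↦ ?_⟩
    convert Submodule.smul_of_tower_mem _ r (hp k) using 1
    simp [smul_sub]
  | h_succ n u hm hu =>
    refine ⟨0, fun k ↦ ?_⟩
    rw [map_zero, zero_mul, sub_zero]
    apply diffOp_mem_pow hm
    rw [show k + 1 + n = n + 1 + k by omega]
    exact logPow_mem _
  | h_mul n y u hm hu =>
    obtain ⟨p, hp⟩ := hu
    refine ⟨PolyAlg.lin K y * p, fun k ↦ ?_⟩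
    have h1 := derivation_mem_pow (vecField (K := K) y) _ _ (hp (k + 1))
    rw [map_sub, Derivation.leibniz, vecField_constIncl, smul_zero, add_zero, smul_eq_mul,
      vecField_logPow] at h1
    have h2 : logPow K L k * (vecField y (logCoord K L) - constIncl K L (PolyAlg.lin K y)) ∈
        idealOne K L ^ (k + 1) := by
      rw [pow_succ]
      refine Ideal.mul_mem_mul (logPow_mem k) ?_
      change evalOne K L _ = 0
      rw [map_sub, evalOne_vecField_logCoord, evalOne_constIncl, sub_self]
    convert add_mem h1 (Ideal.mul_mem_left _ (constIncl K L p) h2) using 1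
    rw [map_mul, Module.End.mul_apply, diffOp_ι, map_mul, add_right_comm n 1 k, ← add_assoc n k 1]
    ring

lemma diffOp_sub_symb_mem {m : ℕ} {u : UniversalEnvelopingAlgebra K L}
    (hu : u ∈ envFilt K L m) (k : ℕ) :
      diffOp K L u (logPow K L (m + k)) - constIncl K L (symb K L m u) * logPow K L k ∈
        idealOne K L ^ (k + 1) := by
  obtain ⟨p, hp⟩ := exists_diffOp_sub_mem hu
  have h0 := hp 0
  rw [zero_add, pow_one] at h0
  have h1 : evalOne K L _ = 0 := h0
  rw [map_sub, map_mul, evalOne_constIncl, add_zero, ← symb_apply] at h1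
  have h2 : logPow K L 0 = 1 := by simp [logPow]
  rw [h2, map_one, mul_one, sub_eq_zero] at h1
  rw [h1]
  exact hp k

lemma symb_mul {m n : ℕ} {u v : UniversalEnvelopingAlgebra K L}
    (hu : u ∈ envFilt K L m) (hv : v ∈ envFilt K L n) :
    symb K L (m + n) (u * v) = symb K L m u * symb K L n v := by
  have h1 := diffOp_mem_pow hu 1 (a := _) (by
    rw [add_comm 1 m]; exact diffOp_sub_symb_mem hv m)
  rw [pow_one] at h1
  have h2 : evalOne K L _ = 0 := h1
  rw [map_sub, diffOp_constIncl_mul, map_sub, map_mul, evalOne_constIncl, sub_eq_zero] at h2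
  rw [symb_apply, map_mul, Module.End.mul_apply, add_comm m n, h2, mul_comm, symb_apply m]

lemma symb_one_ι (x : L) : symb K L 1 (ι K x) = PolyAlg.lin K x := by
  rw [symb_apply, diffOp_ι, vecField_logPow, map_mul, evalOne_vecField_logCoord]
  simp [logPow]

lemma symb_ι_mul {n : ℕ} (x : L) {u : UniversalEnvelopingAlgebra K L} (hu : u ∈ envFilt K L n) :
    symb K L (n + 1) (ι K x * u) = PolyAlg.lin K x * symb K L n u := by
  rw [add_comm, symb_mul (ι_mem_envFilt x) hu, symb_one_ι]

lemma symb_mul_ι {n : ℕ} (x : L) {u : UniversalEnvelopingAlgebra K L} (hu : u ∈ envFilt K L n) :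
    symb K L (n + 1) (u * ι K x) = symb K L n u * PolyAlg.lin K x := by
  rw [symb_mul hu (ι_mem_envFilt x), symb_one_ι]

end SymbolMap

section Euler

variable {K V : Type*} [Field K] [AddCommGroup V] [Module K V] [FiniteDimensional K V]

namespace PolyAlg

variable (K V) in
/-- The Euler derivation. -/
noncomputable def euler : Derivation K (PolyAlg K V) (PolyAlg K V) := der (lin K)

lemma euler_lin (v : V) : euler K V (lin K v) = lin K v := der_lin _ _

lemma euler_of_mem_deg {n : ℕ} {p : PolyAlg K V} (hp : p ∈ deg K V n) :
    euler K V p = (n : K) • p := by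
  have h : (lin K : V →ₗ[K] PolyAlg K V).range ^ n = deg K V n := by
    rw [range_lin, deg, deg, MvPolynomial.homogeneousSubmodule_one_pow]
  rw [← h] at hp
  clear h
  induction hp using Submodule.pow_induction_on_left' with
  | algebraMap r => simp
  | add x y i hx hy ihx ihy => simp [ihx, ihy]
  | mem_mul m hm i x hx ih =>
    obtain ⟨v, rfl⟩ := hm
    rw [Derivation.leibniz, ih, euler_lin, Nat.succ_eq_add_one]
    push_cast
    rw [add_smul, one_smul, smul_eq_mul, smul_eq_mul, mul_smul_comm, mul_comm x]

lemma mem_deg_of_euler [CharZero K] {n : ℕ} {p : PolyAlg K V} (h : euler K V p = (n : K) • p) :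
    p ∈ deg K V n := by
  have hc : ∀ (q : PolyAlg K V) (d), MvPolynomial.coeff d (euler K V q) =
      (d.degree : K) * MvPolynomial.coeff d q := by
    intro q d
    induction q using MvPolynomial.induction_on' with
    | monomial u a =>
      rw [euler_of_mem_deg (MvPolynomial.isHomogeneous_monomial a rfl : _ ∈ deg K V u.degree)]
      rw [MvPolynomial.coeff_smul, MvPolynomial.coeff_monomial]
      split_ifs with hud
      · rw [hud]; rfl
      · simp
    | add p q hp hq => rw [map_add, MvPolynomial.coeff_add, MvPolynomial.coeff_add, hp, hq, mul_add]
  rw [MvPolynomial.mem_homogeneousSubmodule]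
  intro d hd
  have h1 := hc p d
  rw [h, MvPolynomial.coeff_smul, smul_eq_mul] at h1
  have h2 := mul_right_cancel₀ hd h1
  have h3 : n = d.degree := by exact_mod_cast h2
  rw [h3, Finsupp.degree_eq_weight_one (R := ℕ)]
  rfl

end PolyAlg

end Euler

section Homogeneity

variable {K L : Type*} [Field K] [LieRing L] [LieAlgebra K L] [FiniteDimensional K L]

variable (K L) in
/-- The Euler derivation in the constant directions. -/
noncomputable def constEuler : Derivation K (PolyAlg K (Module.End K L × L))
    (PolyAlg K (Module.End K L × L)) :=
  PolyAlg.der (PolyAlg.lin K ∘ₗ LinearMap.inr K _ _ ∘ₗ LinearMap.snd K _ _)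

lemma constEuler_lin (M : Module.End K L) (l : L) :
    constEuler K L (PolyAlg.lin K (M, l)) = PolyAlg.lin K ((0 : Module.End K L), l) := by
  simp [constEuler, PolyAlg.der_lin]

lemma constEuler_vecField (x : L) (a : PolyAlg K (Module.End K L × L)) :
    constEuler K L (vecField x a) = vecField x (constEuler K L a) := by
  have : ⁅constEuler K L, vecField (K := K) x⁆ = 0 := by
    apply PolyAlg.derivation_ext
    rintro ⟨M, l⟩
    rw [Derivation.commutator_apply, constEuler_lin, vecField_lin, vecField_lin, constEuler_lin]
    simp
  have h := DFunLike.congr_fun this a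
  rwa [Derivation.commutator_apply, Derivation.zero_apply, sub_eq_zero] at h

lemma evalOne_constEuler (a : PolyAlg K (Module.End K L × L)) :
    evalOne K L (constEuler K L a) = PolyAlg.euler K L (evalOne K L a) := by
  induction a using PolyAlg.induction_lin with
  | h0 r => simp
  | h1 v =>
    obtain ⟨M, l⟩ := v
    rw [constEuler_lin, evalOne_lin, evalOne_lin, map_add, PolyAlg.euler_lin,
      Derivation.map_algebraMap, map_zero, map_zero]
  | hadd a b ha hb => simp [ha, hb]
  | hmul a b ha hb => simp [Derivation.leibniz, ha, hb]

lemma constEuler_diffOp (u : UniversalEnvelopingAlgebra K L)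
    (a : PolyAlg K (Module.End K L × L)) :
    constEuler K L (diffOp K L u a) = diffOp K L u (constEuler K L a) := by
  obtain ⟨n, hn⟩ := exists_mem_envFilt u
  induction hn using envFilt_induction with
  | h_one => simp
  | h_add n u v _ _ hu hv => simp [hu, hv]
  | h_smul n r u _ hu => simp [hu]
  | h_succ n u _ hu => exact hu
  | h_mul n y u hm hu =>
    rw [map_mul (diffOp K L), Module.End.mul_apply, Module.End.mul_apply, diffOp_ι, diffOp_ι,
      constEuler_vecField, hu]

variable [IsKilling K L]

lemma constEuler_logCoord : constEuler K L (logCoord K L) = logCoord K L := by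
  rw [logCoord, map_sum]
  refine Finset.sum_congr rfl fun i _ ↦ ?_
  rw [logForm_apply, Derivation.leibniz, map_sub, Derivation.map_algebraMap, constEuler_lin,
    constEuler_lin]
  simp [show (((0 : Module.End K L), (0 : L)) : Module.End K L × L) = 0 from rfl]

lemma constEuler_logPow (n : ℕ) : constEuler K L (logPow K L n) = (n : K) • logPow K L n := by
  rw [logPow, Derivation.map_smul, Derivation.leibniz_pow, constEuler_logCoord, smul_comm]
  rw [← Nat.cast_smul_eq_nsmul K]
  cases n with
  | zero => simp
  | succ n => rw [Nat.add_sub_cancel, smul_eq_mul, pow_succ]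

variable [CharZero K]

lemma symb_mem_deg (n : ℕ) (u : UniversalEnvelopingAlgebra K L) :
    symb K L n u ∈ PolyAlg.deg K L n := by
  apply PolyAlg.mem_deg_of_euler
  rw [symb_apply, ← evalOne_constEuler, constEuler_diffOp, constEuler_logPow, map_smul, map_smul]

lemma exists_symb_eq {n : ℕ} {p : PolyAlg K L} (hp : p ∈ PolyAlg.deg K L n) :
    ∃ u ∈ envFilt K L n, symb K L n u = p := by
  have h : (PolyAlg.lin K : L →ₗ[K] PolyAlg K L).range ^ n = PolyAlg.deg K L n := by
    rw [PolyAlg.range_lin, PolyAlg.deg, PolyAlg.deg, MvPolynomial.homogeneousSubmodule_one_pow]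
  rw [← h] at hp
  clear h
  induction hp using Submodule.pow_induction_on_left' with
  | algebraMap r =>
    refine ⟨r • 1, Submodule.smul_mem _ _ (one_mem_envFilt 0), ?_⟩
    rw [map_smul, symb_zero_one, Algebra.algebraMap_eq_smul_one]
  | add x y i hx hy ihx ihy =>
    obtain ⟨u, hu, rfl⟩ := ihx
    obtain ⟨v, hv, rfl⟩ := ihy
    exact ⟨u + v, add_mem hu hv, map_add _ _ _⟩
  | mem_mul m hm i x hx ih =>
    obtain ⟨v, rfl⟩ := hm
    obtain ⟨u, hu, rfl⟩ := ih
    exact ⟨ι K v * u, ι_mul_mem_envFilt v hu, symb_ι_mul v hu⟩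

end Homogeneity

section SymbolInjective

variable {K L : Type*} [Field K] [LieRing L] [LieAlgebra K L]

lemma ι_mul_sub_mul_ι_mem (x y : L) {n : ℕ} {u : UniversalEnvelopingAlgebra K L}
    (hu : u ∈ envFilt K L n) : ι K x * (ι K y * u) - ι K y * (ι K x * u) ∈ envFilt K L (n + 1) := by
  have : ι K x * (ι K y * u) - ι K y * (ι K x * u) = ι K ⁅x, y⁆ * u := by
    rw [ι_lie]; noncomm_ring
  rw [this]
  exact ι_mul_mem_envFilt _ hu

lemma prod_ι_mem_envFilt (l : List L) : (l.map (ι K)).prod ∈ envFilt K L l.length := by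
  induction l with
  | nil => exact one_mem_envFilt 0
  | cons a l ih => exact ι_mul_mem_envFilt a ih

lemma prod_ι_sub_prod_ι_mem_of_perm {l l' : List L} (h : l.Perm l') :
    ∀ m, l.length ≤ m + 1 → (l.map (ι K)).prod - (l'.map (ι K)).prod ∈ envFilt K L m := by
  induction h with
  | nil => simp
  | @cons a l l' h ih =>
    intro m hm
    rw [List.map_cons, List.map_cons, List.prod_cons, List.prod_cons, ← mul_sub]
    rw [List.length_cons] at hm
    cases m with
    | zero =>
      obtain rfl : l = [] := List.eq_nil_of_length_eq_zero (by omega)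
      obtain rfl : l' = [] := List.nil_perm.mp h
      simp
    | succ m => exact ι_mul_mem_envFilt a (ih m (by omega))
  | swap x y l =>
    intro m hm
    rw [List.length_cons, List.length_cons] at hm
    simp only [List.map_cons, List.prod_cons]
    exact envFilt_mono (by omega) (ι_mul_sub_mul_ι_mem y x (prod_ι_mem_envFilt l))
  | trans h1 h2 ih1 ih2 =>
    intro m hm
    have := add_mem (ih1 m hm) (ih2 m (by rwa [← h1.length_eq]))
    rwa [sub_add_sub_cancel] at this

lemma mem_center_of_commute_ι {u : UniversalEnvelopingAlgebra K L}
    (h : ∀ x, ι K x * u = u * ι K x) : u ∈ Subalgebra.center K (UniversalEnvelopingAlgebra K L) := by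
  rw [Subalgebra.mem_center_iff]
  intro v
  obtain ⟨n, hn⟩ := exists_mem_envFilt v
  induction hn using envFilt_induction with
  | h_one => simp
  | h_add n u v _ _ hu hv => rw [add_mul, mul_add, hu, hv]
  | h_smul n r u _ hu => rw [smul_mul_assoc, mul_smul_comm, hu]
  | h_succ n u _ hu => exact hu
  | h_mul n y v _ hv => rw [mul_assoc, hv, ← mul_assoc, h, mul_assoc]

variable [FiniteDimensional K L]

variable (K L) in
/-- A linear lift of the symmetric algebra to the enveloping algebra by ordered monomials. -/
noncomputable def monomialLift : PolyAlg K L →ₗ[K] UniversalEnvelopingAlgebra K L :=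
  (MvPolynomial.basisMonomials _ K).constr K
    fun s ↦ ((s.toMultiset.toList.map (finBasis K L)).map (ι K)).prod

lemma monomialLift_monomial (s : Fin (finrank K L) →₀ ℕ) :
    monomialLift K L (MvPolynomial.monomial s 1) =
      ((s.toMultiset.toList.map (finBasis K L)).map (ι K)).prod := by
  have := (MvPolynomial.basisMonomials (Fin (finrank K L)) K).constr_basis K
    (fun s ↦ ((s.toMultiset.toList.map (finBasis K L)).map (ι K)).prod) s
  rwa [MvPolynomial.coe_basisMonomials] at this

lemma deg_eq_span (n : ℕ) : PolyAlg.deg K L n =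
    Submodule.span K ((fun s ↦ MvPolynomial.monomial s (1 : K)) '' {s | s.degree = n}) := by
  apply le_antisymm
  · intro p hp
    rw [← MvPolynomial.support_sum_monomial_coeff p]
    refine Submodule.sum_mem _ fun s hs ↦ ?_
    rw [← mul_one (p.coeff s), ← smul_eq_mul, ← MvPolynomial.smul_monomial]
    refine Submodule.smul_mem _ _ (Submodule.subset_span ⟨s, ?_, rfl⟩)
    have := hp (MvPolynomial.mem_support_iff.mp hs)
    rw [Set.mem_ofPred_eq, ← this, Finsupp.degree_eq_weight_one (R := ℕ)]
    rfl
  · rw [Submodule.span_le]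
    rintro _ ⟨s, rfl, rfl⟩
    exact MvPolynomial.isHomogeneous_monomial 1 rfl

lemma monomialLift_lin_mul (x : L) {n : ℕ} {p : PolyAlg K L} (hp : p ∈ PolyAlg.deg K L n) :
    ι K x * monomialLift K L p - monomialLift K L (PolyAlg.lin K x * p) ∈ envFilt K L n := by
  have hx : x ∈ Submodule.span K (Set.range (finBasis K L)) := by
    rw [Basis.span_eq]; trivial
  rw [deg_eq_span] at hp
  induction hp using Submodule.span_induction with
  | zero => simp
  | add p q _ _ hp hq =>
    convert add_mem hp hq using 1
    simp only [map_add, mul_add]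
    abel
  | smul r p _ hp =>
    convert Submodule.smul_mem _ r hp using 1
    rw [map_smul, mul_smul_comm, mul_smul_comm, map_smul, smul_sub]
  | mem p hp =>
    obtain ⟨s, rfl, rfl⟩ := hp
    induction hx using Submodule.span_induction with
    | zero => simp
    | add x y _ _ hx hy =>
      convert add_mem hx hy using 1
      simp only [map_add, add_mul]
      abel
    | smul r x _ hx =>
      convert Submodule.smul_mem _ r hx using 1
      rw [map_smul, map_smul, smul_mul_assoc, smul_mul_assoc, map_smul, smul_sub]
    | mem x hx =>
      obtain ⟨i, rfl⟩ := hx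
      have h1 : PolyAlg.lin K (finBasis K L i) * MvPolynomial.monomial s 1 =
          MvPolynomial.monomial (Finsupp.single i 1 + s) (1 : K) := by
        rw [PolyAlg.lin_basis, MvPolynomial.X, MvPolynomial.monomial_mul, one_mul]
      have h2 : (i :: s.toMultiset.toList).Perm
          (Finsupp.toMultiset (Finsupp.single i 1 + s)).toList := by
        rw [← Multiset.coe_eq_coe, Multiset.coe_toList, ← Multiset.cons_coe,
          Multiset.coe_toList, Finsupp.toMultiset_add, Finsupp.toMultiset_single, one_smul,
          Multiset.singleton_add]
      rw [h1]
      beta_reduce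
      rw [monomialLift_monomial, monomialLift_monomial]
      have h3 := prod_ι_sub_prod_ι_mem_of_perm (K := K) (h2.map (finBasis K L)) s.degree (by
        rw [List.length_map, List.length_cons, Multiset.length_toList, Finsupp.card_toMultiset]
        rfl)
      simpa using h3

variable [IsKilling K L] [CharZero K]

lemma sub_monomialLift_symb_mem {n : ℕ} {u : UniversalEnvelopingAlgebra K L}
    (hu : u ∈ envFilt K L n) :
    (n = 0 → u = monomialLift K L (symb K L n u)) ∧
      ∀ m, n = m + 1 → u - monomialLift K L (symb K L n u) ∈ envFilt K L m := by
  induction hu using envFilt_induction with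
  | h_one =>
    refine ⟨fun _ ↦ ?_, fun m hm ↦ by omega⟩
    rw [symb_zero_one, ← MvPolynomial.C_1, ← MvPolynomial.monomial_zero', monomialLift_monomial]
    simp
  | h_add n u v hu hv ihu ihv =>
    refine ⟨fun h ↦ ?_, fun m hm ↦ ?_⟩
    · rw [map_add, map_add, ← ihu.1 h, ← ihv.1 h]
    · convert add_mem (ihu.2 m hm) (ihv.2 m hm) using 1
      rw [map_add, map_add]; abel
  | h_smul n r u hu ih =>
    refine ⟨fun h ↦ ?_, fun m hm ↦ ?_⟩
    · rw [map_smul, map_smul, ← ih.1 h]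
    · convert Submodule.smul_mem _ r (ih.2 m hm) using 1
      rw [map_smul, map_smul, smul_sub]
  | h_succ n u hu ih =>
    refine ⟨fun h ↦ by omega, fun m hm ↦ ?_⟩
    obtain rfl : n = m := by omega
    rw [symb_eq_zero (Nat.lt_succ_self n) hu, map_zero, sub_zero]
    exact hu
  | h_mul n x u hu ih =>
    refine ⟨fun h ↦ by omega, fun m hm ↦ ?_⟩
    obtain rfl : n = m := by omega
    rw [symb_ι_mul x hu]
    have h1 := monomialLift_lin_mul x (symb_mem_deg n u)
    have h2 : ι K x * (u - monomialLift K L (symb K L n u)) ∈ envFilt K L n := by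
      cases n with
      | zero => rw [← ih.1 rfl]; simp
      | succ k => exact ι_mul_mem_envFilt x (ih.2 k rfl)
    convert add_mem h2 h1 using 1
    rw [mul_sub]; abel

lemma mem_envFilt_of_symb_eq_zero {n : ℕ} {u : UniversalEnvelopingAlgebra K L}
    (hu : u ∈ envFilt K L (n + 1)) (h : symb K L (n + 1) u = 0) : u ∈ envFilt K L n := by
  have := (sub_monomialLift_symb_mem hu).2 n rfl
  rwa [h, map_zero, sub_zero] at this

lemma eq_zero_of_symb_eq_zero {n : ℕ} {u : UniversalEnvelopingAlgebra K L}
    (hu : u ∈ envFilt K L n) (h : ∀ k ≤ n, symb K L k u = 0) : u = 0 := by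
  induction n with
  | zero =>
    rw [(sub_monomialLift_symb_mem hu).1 rfl, h 0 le_rfl, map_zero]
  | succ n ih =>
    exact ih (mem_envFilt_of_symb_eq_zero hu (h _ le_rfl)) fun k hk ↦ h k (by omega)

lemma exists_symb_eq_of_lt {n : ℕ} {p : PolyAlg K L} (hp : p ∈ PolyAlg.deg K L n) :
    ∃ u ∈ envFilt K L n, symb K L n u = p ∧ ∀ k < n, symb K L k u = 0 := by
  suffices ∀ j ≤ n, ∃ u ∈ envFilt K L n, symb K L n u = p ∧
      ∀ k < n, n - j ≤ k → symb K L k u = 0 by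
    obtain ⟨u, hu, h1, h2⟩ := this n le_rfl
    exact ⟨u, hu, h1, fun k hk ↦ h2 k hk (by omega)⟩
  intro j
  induction j with
  | zero =>
    intro _
    obtain ⟨u, hu, h⟩ := exists_symb_eq hp
    exact ⟨u, hu, h, fun k hk hk' ↦ by omega⟩
  | succ j ih =>
    intro hj
    obtain ⟨u, hu, h1, h2⟩ := ih (by omega)
    obtain ⟨v, hv, h3⟩ := exists_symb_eq (symb_mem_deg (n - (j + 1)) u)
    refine ⟨u - v, sub_mem hu (envFilt_mono (by omega) hv), ?_, fun k hk hk' ↦ ?_⟩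
    · rw [map_sub, h1, symb_eq_zero (by omega) hv, sub_zero]
    · rcases hk'.eq_or_lt with rfl | hlt
      · rw [map_sub, h3, sub_self]
      · rw [map_sub, h2 k hk (by omega), symb_eq_zero hlt hv, sub_zero]

lemma exists_center_symb_eq {n : ℕ} {p : PolyAlg K L} (hp : p ∈ PolyAlg.deg K L n)
    (h : ∀ x, polyAd x p = 0) :
    ∃ u ∈ envFilt K L n, u ∈ Subalgebra.center K (UniversalEnvelopingAlgebra K L) ∧
      symb K L n u = p := by
  obtain ⟨u, hu, h1, h2⟩ := exists_symb_eq_of_lt hp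
  refine ⟨u, hu, mem_center_of_commute_ι fun x ↦ ?_, h1⟩
  rw [← sub_eq_zero]
  refine eq_zero_of_symb_eq_zero (ι_commutator_mem x hu) fun k hk ↦ ?_
  rw [symb_commutator]
  rcases hk.eq_or_lt with rfl | hlt
  · rw [h1, h]
  · rw [h2 k hlt, map_zero]

end SymbolInjective

section RootFacts

variable {L : Type} [LieRing L] [LieAlgebra ℂ L]

/-- A choice of opposite root vectors `e α`, `f α` for the set `R` of roots of a
split semisimple Lie algebra. -/
structure RootSplitting (H : LieSubalgebra ℂ L) (R : Set (Dual ℂ H)) (e f : Dual ℂ H → L) :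
    Prop where
  wt_e : ∀ {α}, α ∈ R → IsRootVector H α (e α)
  e_ne : ∀ {α}, α ∈ R → e α ≠ 0
  wt_f : ∀ {α}, α ∈ R → IsRootVector H (-α) (f α)
  f_ne : ∀ {α}, α ∈ R → f α ≠ 0
  neg_mem : ∀ {α}, α ∈ R → -α ∈ R
  zero_notMem : 0 ∉ R
  mem_of_ne : ∀ {α x}, IsRootVector H α x → x ≠ 0 → α ≠ 0 → α ∈ R
  exists_smul : ∀ {α x}, α ∈ R → IsRootVector H α x → ∃ r : ℂ, x = r • e α
  lie_ne : ∀ {α β x y}, α ∈ R → β ∈ R → α + β ∈ R → IsRootVector H α x → IsRootVector H β y →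
    x ≠ 0 → y ≠ 0 → ⁅x, y⁆ ≠ 0
  finite : R.Finite
  wt_cartan : ∀ {x}, x ∈ H → IsRootVector H 0 x
  mem_cartan : ∀ {x}, IsRootVector H 0 x → x ∈ H
  span_eq_top : Submodule.span ℂ {x | ∃ α, IsRootVector H α x} = ⊤
  span_dual : Submodule.span ℂ R = ⊤
  exists_eq_ad : ∀ D : LieDerivation ℂ L L, ∃ x : L, ∀ y, D y = ⁅x, y⁆

variable [FiniteDimensional ℂ L]

lemma lie_ne_zero_of_rootSpace [IsKilling ℂ L] {H : LieSubalgebra ℂ L} [H.IsCartanSubalgebra]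
    {α β : LieModule.Weight ℂ H L} (hα : α.IsNonZero) (hβ : β.IsNonZero)
    (hαβ : rootSpace H (α + β : H → ℂ) ≠ ⊥) {x y : L} (hx : x ∈ rootSpace H α)
    (hy : y ∈ rootSpace H β) (hx0 : x ≠ 0) (hy0 : y ≠ 0) : ⁅x, y⁆ ≠ 0 := by
  have hp : 0 < LieModule.chainTopCoeff (α : H → ℂ) β := by
    have := ((IsKilling.rootSpace_zsmul_add_ne_bot_iff α β hα 1).mp (by rwa [one_smul])).1
    omega
  obtain ⟨v, hv, v_ne0⟩ := (LieModule.chainTop (α : H → ℂ) β).exists_ne_zero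
  obtain ⟨h, e, f, isSl2, he, hf⟩ := IsKilling.exists_isSl2Triple_of_weight_isNonZero hα
  obtain rfl := isSl2.h_eq_coroot hα he hf
  have prim : isSl2.HasPrimitiveVectorWith v (IsKilling.chainLength α β : ℂ) :=
    have := LieAlgebra.lie_mem_genWeightSpace_of_mem_genWeightSpace he hv
    ⟨v_ne0, (IsKilling.chainLength_smul _ _ hv).symm,
      by rwa [LieModule.genWeightSpace_add_chainTop _ _ hα] at this⟩
  have hle := IsKilling.chainTopCoeff_le_chainLength α β
  obtain ⟨p, hp'⟩ : ∃ p, LieModule.chainTopCoeff (α : H → ℂ) β = p + 1 :=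
    ⟨_, (Nat.succ_pred_eq_of_pos hp).symm⟩
  have hw : (LieModule.toEnd ℂ L L f ^ (p + 1)) v ∈ rootSpace H β := by
    convert LieAlgebra.toEnd_pow_apply_mem hf hv (p + 1)
    rw [LieModule.coe_chainTop', hp', smul_neg, neg_add_cancel_left]
  have hw0 : (LieModule.toEnd ℂ L L f ^ (p + 1)) v ≠ 0 :=
    prim.pow_toEnd_f_ne_zero_of_eq_nat rfl (by omega)
  obtain ⟨r, rfl⟩ : ∃ r : ℂ, r • (LieModule.toEnd ℂ L L f ^ (p + 1)) v = y := by
    have := (finrank_eq_one_iff_of_nonzero' (⟨_, hw⟩ : rootSpace H β) (by simpa using hw0)).mp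
      (IsKilling.finrank_rootSpace_eq_one _ hβ) ⟨_, hy⟩
    simpa using this
  obtain ⟨s, rfl⟩ : ∃ s : ℂ, s • e = x := by
    have := (finrank_eq_one_iff_of_nonzero' (⟨_, he⟩ : rootSpace H α)
      (by simpa using isSl2.e_ne_zero)).mp
      (IsKilling.finrank_rootSpace_eq_one _ hα) ⟨_, hx⟩
    simpa using this
  have hr : r ≠ 0 := fun h ↦ hy0 (by rw [h, zero_smul])
  have hs : s ≠ 0 := fun h ↦ hx0 (by rw [h, zero_smul])
  rw [lie_smul, smul_lie, prim.lie_e_pow_succ_toEnd_f]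
  refine smul_ne_zero hr (smul_ne_zero hs (smul_ne_zero (mul_ne_zero ?_ ?_)
    (prim.pow_toEnd_f_ne_zero_of_eq_nat rfl (by omega))))
  · exact_mod_cast Nat.succ_ne_zero p
  · rw [sub_ne_zero]
    exact_mod_cast (by omega : IsKilling.chainLength α β ≠ p)

lemma isRootVector_iff_mem_rootSpace [IsKilling ℂ L] {H : LieSubalgebra ℂ L}
    [H.IsCartanSubalgebra] {α : Dual ℂ H} {x : L} :
    IsRootVector H α x ↔ x ∈ rootSpace H α := by
  constructor
  · intro h
    apply LieModule.weightSpace_le_genWeightSpace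
    rw [LieModule.mem_weightSpace]
    exact h
  · intro h t
    exact IsKilling.lie_eq_smul_of_mem_rootSpace h t

lemma rootSplitting [IsKilling ℂ L] {H : LieSubalgebra ℂ L} [H.IsCartanSubalgebra]
    {R : Set (Dual ℂ H)} (hR : R = {α | α ≠ 0 ∧ ∃ x : L, x ≠ 0 ∧ IsRootVector H α x})
    {e f : Dual ℂ H → L}
    (he : ∀ α ∈ R, IsRootVector H α (e α) ∧ e α ≠ 0)
    (hf : ∀ α ∈ R, IsRootVector H (-α) (f α) ∧ f α ≠ 0) : RootSplitting H R e f := by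
  have hmem : ∀ {α x}, IsRootVector H α x → x ≠ 0 → α ≠ 0 → α ∈ R := by
    intro α x h1 h2 h3
    rw [hR]
    exact ⟨h3, x, h2, h1⟩
  have hw : ∀ {α}, α ∈ R → ∃ w : LieModule.Weight ℂ H L, (w : H → ℂ) = α ∧ w.IsNonZero := by
    intro α hα
    have h1 : rootSpace H α ≠ ⊥ := by
      intro h
      have := isRootVector_iff_mem_rootSpace.mp (he α hα).1
      rw [h, LieSubmodule.mem_bot] at this
      exact (he α hα).2 this
    refine ⟨⟨α, h1⟩, rfl, fun h ↦ ?_⟩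
    rw [hR] at hα
    exact hα.1 (LinearMap.ext fun t ↦ congrFun h t)
  have h0 : (0 : Dual ℂ H) ∉ R := by rw [hR]; exact fun h ↦ h.1 rfl
  have hzero : ∀ {x}, IsRootVector H 0 x ↔ x ∈ H := by
    intro x
    rw [isRootVector_iff_mem_rootSpace]
    change x ∈ rootSpace H (0 : H → ℂ) ↔ _
    rw [rootSpace_zero_eq]
    rfl
  refine
    { wt_e := fun h ↦ (he _ h).1
      e_ne := fun h ↦ (he _ h).2
      wt_f := fun h ↦ (hf _ h).1
      f_ne := fun h ↦ (hf _ h).2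
      neg_mem := fun {α} h ↦ hmem (hf α h).1 (hf α h).2 fun h' ↦ h0 (neg_eq_zero.mp h' ▸ h)
      zero_notMem := h0
      mem_of_ne := hmem
      exists_smul := ?_
      lie_ne := ?_
      finite := ?_
      wt_cartan := hzero.mpr
      mem_cartan := hzero.mp
      span_eq_top := ?_
      span_dual := ?_
      exists_eq_ad := ?_ }
  · intro α x hα hx
    obtain ⟨w, hwα, hw0⟩ := hw hα
    have h1 := isRootVector_iff_mem_rootSpace.mp (he α hα).1
    have h2 := isRootVector_iff_mem_rootSpace.mp hx
    rw [← hwα] at h1 h2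
    have := (finrank_eq_one_iff_of_nonzero' (⟨_, h1⟩ : rootSpace H w)
      (by simpa using (he α hα).2)).mp (IsKilling.finrank_rootSpace_eq_one _ hw0) ⟨_, h2⟩
    obtain ⟨r, hr⟩ := this
    exact ⟨r, (congrArg Subtype.val hr).symm⟩
  · intro α β x y hα hβ hαβ hx hy hx0 hy0
    obtain ⟨a, ha, ha0⟩ := hw hα
    obtain ⟨b, hb, hb0⟩ := hw hβ
    obtain ⟨c, hc, hc0⟩ := hw hαβ
    rw [isRootVector_iff_mem_rootSpace, ← ha] at hx
    rw [isRootVector_iff_mem_rootSpace, ← hb] at hy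
    refine lie_ne_zero_of_rootSpace ha0 hb0 ?_ hx hy hx0 hy0
    have : (a + b : H → ℂ) = c := by rw [ha, hb, hc]; rfl
    rw [this]
    exact c.genWeightSpace_ne_bot
  · refine (Set.finite_range (LieModule.Weight.toLinear ℂ H L)).subset fun α hα ↦ ?_
    obtain ⟨a, ha, ha0⟩ := hw hα
    exact ⟨a, LinearMap.ext fun t ↦ congrFun ha t⟩
  · rw [eq_top_iff]
    have h1 := LieModule.iSup_genWeightSpace_eq_top' ℂ H L
    rw [← LieSubmodule.toSubmodule_inj, LieSubmodule.iSup_toSubmodule,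
      LieSubmodule.top_toSubmodule] at h1
    rw [← h1, iSup_le_iff]
    intro w x hx
    exact Submodule.subset_span ⟨LieModule.Weight.toLinear ℂ H L w,
      isRootVector_iff_mem_rootSpace.mpr hx⟩
  · refine eq_top_iff.mpr ((IsKilling.span_weight_isNonZero_eq_top (K := ℂ) (L := L) (H := H)).ge.trans
      (Submodule.span_mono ?_))
    rintro _ ⟨w, hw0, rfl⟩
    obtain ⟨x, hx, hx0⟩ := w.exists_ne_zero
    refine hmem (isRootVector_iff_mem_rootSpace.mpr hx) hx0 fun h ↦ hw0 ?_
    ext t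
    exact LinearMap.congr_fun h t
  · intro D
    obtain ⟨x, hx⟩ := LieDerivation.IsKilling.exists_eq_ad D
    exact ⟨x, fun y ↦ by rw [← hx]; simp⟩

end RootFacts

section RootGradient

variable {L : Type} [LieRing L] [LieAlgebra ℂ L]

local notation "δ" => polyAd (K := ℂ)
local notation "lin" => PolyAlg.lin ℂ

variable {H : LieSubalgebra ℂ L}

lemma IsRootVector.smul {α : Dual ℂ H} {x : L} (r : ℂ) (hx : IsRootVector H α x) :
    IsRootVector H α (r • x) := fun t ↦ by
  rw [lie_smul, hx t, smul_comm]

lemma IsRootVector.lie {α β : Dual ℂ H} {x y : L} (hx : IsRootVector H α x)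
    (hy : IsRootVector H β y) : IsRootVector H (α + β) ⁅x, y⁆ := fun t ↦ by
  rw [leibniz_lie, hx t, hy t, smul_lie, lie_smul, LinearMap.add_apply, add_smul]

lemma IsRootVector.unique {α β : Dual ℂ H} {x : L} (hα : IsRootVector H α x)
    (hβ : IsRootVector H β x) (hx : x ≠ 0) : α = β := by
  ext t
  exact smul_left_injective ℂ hx ((hα t).symm.trans (hβ t))

lemma ne_neg_self {α : Dual ℂ H} (h : α ≠ 0) : α ≠ -α := fun h' ↦
  h ((smul_eq_zero.mp (show (2 : ℂ) • α = 0 by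
    rw [two_smul]; exact eq_neg_iff_add_eq_zero.mp h')).resolve_left two_ne_zero)

variable {R : Set (Dual ℂ H)} {e f : Dual ℂ H → L}

lemma RootSplitting.wt_zero_or (hS : RootSplitting H R e f) {α : Dual ℂ H} {x : L} (hx : IsRootVector H α x) (hα : α ∉ R) :
    α = 0 ∨ x = 0 := by
  by_contra! h
  exact hα (hS.mem_of_ne hx h.2 h.1)

lemma RootSplitting.ne_zero (hS : RootSplitting H R e f) {α : Dual ℂ H} (h : α ∈ R) : α ≠ 0 := fun h' ↦ hS.zero_notMem (h' ▸ h)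

variable [FiniteDimensional ℂ L]

lemma polyAd_add (x y : L) : δ (x + y) = δ x + δ y :=
  PolyAlg.derivation_ext fun v ↦ by simp [polyAd_lin, add_lie]

lemma polyAd_smul (r : ℂ) (x : L) : δ (r • x) = r • δ x :=
  PolyAlg.derivation_ext fun v ↦ by simp [polyAd_lin, smul_lie]

lemma polyAd_zero : δ (0 : L) = 0 :=
  PolyAlg.derivation_ext fun v ↦ by simp [polyAd_lin]

lemma polyAd_lie (x y : L) : δ ⁅x, y⁆ = ⁅δ x, δ y⁆ :=
  PolyAlg.derivation_ext fun v ↦ by simp [polyAd_lin, Derivation.commutator_apply]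

lemma polyAd_lie_apply (x y : L) (p : PolyAlg ℂ L) :
    δ ⁅x, y⁆ p = δ x (δ y p) - δ y (δ x p) := by
  rw [polyAd_lie, Derivation.commutator_apply]

lemma polyAd_mul (x : L) (p q : PolyAlg ℂ L) : δ x (p * q) = p * δ x q + q * δ x p := by
  simp

lemma IsRootVector.eq_of_dvd {α β : Dual ℂ H} {x y : L} (hx : IsRootVector H α x)
    (hy : IsRootVector H β y) (hy0 : y ≠ 0) (h : lin x ∣ lin y) : α = β := by
  obtain ⟨r, rfl⟩ := PolyAlg.exists_eq_smul_of_lin_dvd_lin hy0 h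
  exact (hx.smul r).unique hy hy0

/-- `q` is the gradient of `p` along the roots: `δ x p = x * q α` for root vectors `x`
of weight `α`. -/
structure IsGrad (H : LieSubalgebra ℂ L) (R : Set (Dual ℂ H)) (p : PolyAlg ℂ L)
    (q : Dual ℂ H → PolyAlg ℂ L) : Prop where
  eq : ∀ {α x}, IsRootVector H α x → δ x p = lin x * q α
  neg : ∀ α, q (-α) = -q α
  zero : ∀ {α}, α ∉ R → q α = 0

namespace RootSplitting

lemma exists_isGrad (hS : RootSplitting H R e f) {p : PolyAlg ℂ L} (h0 : ∀ x ∈ H, δ x p = 0)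
    (h : ∀ α ∈ R, lin (e α) * δ (f α) p + lin (f α) * δ (e α) p = 0) :
    ∃ q, IsGrad H R p q := by
  have h1 : ∀ α ∈ R, ∃ g, δ (e α) p = lin (e α) * g := by
    intro α hα
    have hd : lin (e α) ∣ lin (f α) * δ (e α) p :=
      ⟨-δ (f α) p, by linear_combination h α hα⟩
    rcases (PolyAlg.prime_lin (hS.e_ne hα)).dvd_or_dvd hd with hd | hd
    · exact (ne_neg_self (hS.ne_zero hα)
        ((hS.wt_e hα).eq_of_dvd (hS.wt_f hα) (hS.f_ne hα) hd)).elim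
    · exact hd
  classical
  choose! g hg using h1
  have hx : ∀ {α x}, α ∈ R → IsRootVector H α x → δ x p = lin x * g α := by
    intro α x hα hx
    obtain ⟨r, rfl⟩ := hS.exists_smul hα hx
    rw [polyAd_smul, Derivation.smul_apply, hg α hα, map_smul, smul_mul_assoc]
  have hneg : ∀ α ∈ R, g (-α) = -g α := by
    intro α hα
    have h2 := h α hα
    rw [hg α hα, hx (hS.neg_mem hα) (hS.wt_f hα)] at h2
    have h3 : lin (e α) * lin (f α) * (g (-α) + g α) = 0 := by linear_combination h2
    have h4 := (mul_eq_zero.mp h3).resolve_left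
      (mul_ne_zero (PolyAlg.lin_ne_zero (hS.e_ne hα)) (PolyAlg.lin_ne_zero (hS.f_ne hα)))
    exact eq_neg_of_add_eq_zero_left h4
  refine ⟨fun α ↦ if α ∈ R then g α else 0, ?_, ?_, fun hα ↦ by simp [hα]⟩
  · intro α x hxα
    by_cases hα : α ∈ R
    · simp only [hα, if_true]
      exact hx hα hxα
    · simp only [hα, if_false, mul_zero]
      rcases hS.wt_zero_or hxα hα with rfl | rfl
      · exact h0 x (hS.mem_cartan hxα)
      · rw [polyAd_zero]; rfl
  · intro α
    by_cases hα : α ∈ R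
    · simp only [hα, hS.neg_mem hα, if_true]
      exact hneg α hα
    · have : -α ∉ R := fun h ↦ hα (by simpa using hS.neg_mem h)
      simp [hα, this]

end RootSplitting

namespace IsGrad

variable {p : PolyAlg ℂ L} {q : Dual ℂ H → PolyAlg ℂ L}

/-- The defect of additivity of the gradient. -/
lemma lie_mul (hq : IsGrad H R p q) {α β : Dual ℂ H} {x y : L} (hx : IsRootVector H α x)
    (hy : IsRootVector H β y) :
    lin ⁅x, y⁆ * (q (α + β) - q α - q β) = lin y * δ x (q β) - lin x * δ y (q α) := by
  have h := polyAd_lie_apply x y p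
  rw [hq.eq (hx.lie hy), hq.eq hx, hq.eq hy, polyAd_mul, polyAd_mul, polyAd_lin, polyAd_lin,
    ← lie_skew x y, map_neg] at h
  rw [← lie_skew x y, map_neg]
  linear_combination h

lemma map_zero (hq : IsGrad H R p q) (hS : RootSplitting H R e f) : q 0 = 0 :=
  hq.zero hS.zero_notMem

lemma add_eq_of_string (hq : IsGrad H R p q) (hS : RootSplitting H R e f) {α β : Dual ℂ H}
    (hα : α ∈ R) (hβ : β ∈ R) (hαβ : α + β ∈ R)
    (h : α - β ∈ R → q (α - β) = q α - q β) : q (α + β) = q α + q β := by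
  have hne : α + β ≠ 0 := hS.ne_zero hαβ
  have he := hS.wt_e hα
  have hf := hS.wt_f hα
  have he' := hS.wt_e hβ
  have hf' := hS.wt_f hβ
  have h1 := hq.lie_mul he he'
  have h2 := hq.lie_mul hf hf'
  have h3 := hq.lie_mul he hf'
  have h4 := hq.lie_mul hf he'
  have hs : lin ⁅e α, f β⁆ * (q (α + -β) - q α - q (-β)) = 0 ∧
      lin ⁅f α, e β⁆ * (q (-α + β) - q (-α) - q β) = 0 := by
    by_cases hs : q (α - β) = q α - q β
    · rw [show -α + β = -(α - β) by abel, hq.neg, hq.neg, hq.neg, ← sub_eq_add_neg, hs]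
      constructor <;> ring
    · have hm : α - β ∉ R := fun hm ↦ hs (h hm)
      have hne' : α - β ≠ 0 := by
        intro h0
        apply hs
        rw [h0, hq.map_zero hS, sub_eq_zero.mp h0, sub_self]
      have hm' : -α + β ∉ R := fun h' ↦ hm (by
        have := hS.neg_mem h'
        rwa [show -(-α + β) = α - β by abel] at this)
      have e1 := (hS.wt_zero_or (he.lie hf') (by rwa [← sub_eq_add_neg])).resolve_left
        (by rwa [← sub_eq_add_neg])
      have e2 := (hS.wt_zero_or (hf.lie he') hm').resolve_left
        (fun h0 ↦ hne' (by rw [← neg_eq_zero, ← h0]; abel))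
      rw [e1, e2, _root_.map_zero, zero_mul, zero_mul]
      exact ⟨rfl, rfl⟩
  rw [hs.1] at h3
  rw [hs.2] at h4
  rw [show -α + -β = -(α + β) by abel, hq.neg, hq.neg, hq.neg] at h2
  rw [hq.neg] at h3 h4
  simp only [map_neg] at h2 h3 h4
  have key : (lin (f α) * lin (f β) * lin ⁅e α, e β⁆ - lin (e α) * lin (e β) * lin ⁅f α, f β⁆) *
      (q (α + β) - q α - q β) = 0 := by
    linear_combination lin (f α) * lin (f β) * h1 + lin (e α) * lin (e β) * h2 +
      lin (f α) * lin (e β) * h3 + lin (e α) * lin (f β) * h4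
  rcases mul_eq_zero.mp key with h0 | h0
  · exfalso
    have hd : lin (e α) ∣ lin (f α) * lin (f β) * lin ⁅e α, e β⁆ :=
      ⟨lin (e β) * lin ⁅f α, f β⁆, by linear_combination h0⟩
    have hp := PolyAlg.prime_lin (K := ℂ) (hS.e_ne hα)
    rcases hp.dvd_or_dvd hd with hd | hd
    · rcases hp.dvd_or_dvd hd with hd | hd
      · exact ne_neg_self (hS.ne_zero hα) (he.eq_of_dvd hf (hS.f_ne hα) hd)
      · have := he.eq_of_dvd hf' (hS.f_ne hβ) hd
        exact hne (by rw [this]; abel)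
    · have := he.eq_of_dvd (he.lie he')
        (hS.lie_ne hα hβ hαβ he he' (hS.e_ne hα) (hS.e_ne hβ)) hd
      exact hS.ne_zero hβ (by simpa using this)
  · linear_combination h0

lemma add_eq (hq : IsGrad H R p q) (hS : RootSplitting H R e f) {α β : Dual ℂ H}
    (hα : α ∈ R) (hβ : β ∈ R) (hαβ : α + β ∈ R) : q (α + β) = q α + q β := by
  have main : ∀ n : ℕ, ∀ α ∈ R, α + β ∈ R → α - ((n : ℂ) + 1) • β ∉ R →
      q (α + β) = q α + q β := by
    intro n
    induction n with
    | zero =>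
      intro α hα hαβ hn
      refine hq.add_eq_of_string hS hα hβ hαβ fun h ↦ (hn ?_).elim
      simpa using h
    | succ n ih =>
      intro α hα hαβ hn
      refine hq.add_eq_of_string hS hα hβ hαβ fun h ↦ ?_
      have := ih (α - β) h (by simpa using hα) (fun h' ↦ hn ?_)
      · rw [sub_add_cancel] at this
        linear_combination -this
      · convert h' using 1
        push_cast
        module
  obtain ⟨n, hn⟩ : ∃ n : ℕ, α - ((n : ℂ) + 1) • β ∉ R := by
    by_contra! h
    refine Set.infinite_of_injective_forall_mem (f := fun n : ℕ ↦ α - ((n : ℂ) + 1) • β) ?_ h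
      hS.finite
    intro m n hmn
    have h1 := smul_left_injective ℂ (hS.ne_zero hβ) (sub_right_injective hmn)
    exact_mod_cast add_right_cancel h1
  exact main n α hα hαβ hn

lemma add_eq_of_lie_ne (hq : IsGrad H R p q) (hS : RootSplitting H R e f) {α β : Dual ℂ H}
    {x y : L} (hx : IsRootVector H α x) (hy : IsRootVector H β y) (h : ⁅x, y⁆ ≠ 0) :
    q (α + β) = q α + q β := by
  by_cases hα : α = 0
  · rw [hα, zero_add, hq.map_zero hS, zero_add]
  by_cases hβ : β = 0
  · rw [hβ, add_zero, hq.map_zero hS, add_zero]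
  by_cases hαβ : α + β = 0
  · rw [hαβ, hq.map_zero hS, eq_neg_of_add_eq_zero_left hαβ, hq.neg, neg_add_cancel]
  have hx0 : x ≠ 0 := fun h0 ↦ h (by rw [h0, zero_lie])
  have hy0 : y ≠ 0 := fun h0 ↦ h (by rw [h0, lie_zero])
  exact hq.add_eq hS (hS.mem_of_ne hx hx0 hα) (hS.mem_of_ne hy hy0 hβ)
    (hS.mem_of_ne (hx.lie hy) h hαβ)

lemma cross (hq : IsGrad H R p q) (hS : RootSplitting H R e f) {α β : Dual ℂ H}
    {x y : L} (hx : IsRootVector H α x) (hy : IsRootVector H β y) :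
    lin y * δ x (q β) = lin x * δ y (q α) := by
  have h := hq.lie_mul hx hy
  by_cases h0 : ⁅x, y⁆ = 0
  · rw [h0, _root_.map_zero, zero_mul] at h
    linear_combination -h
  · rw [hq.add_eq_of_lie_ne hS hx hy h0] at h
    linear_combination -h

lemma exists_isGrad (hq : IsGrad H R p q) (hS : RootSplitting H R e f) (β : Dual ℂ H) :
    ∃ q', IsGrad H R (q β) q' := by
  by_cases hβ : β ∈ R
  · have he := PolyAlg.lin_ne_zero (K := ℂ) (hS.e_ne hβ)
    refine hS.exists_isGrad (fun x hx ↦ ?_) fun α hα ↦ ?_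
    · have := hq.cross hS (hS.wt_cartan hx) (hS.wt_e hβ)
      rw [hq.map_zero hS, _root_.map_zero, mul_zero] at this
      exact (mul_eq_zero.mp this).resolve_left he
    · have h1 := hq.cross hS (hS.wt_e hα) (hS.wt_e hβ)
      have h2 := hq.cross hS (hS.wt_f hα) (hS.wt_e hβ)
      rw [hq.neg, map_neg] at h2
      refine (mul_eq_zero.mp ?_).resolve_left he
      linear_combination lin (e α) * h2 + lin (f α) * h1
  · rw [hq.zero hβ]
    exact ⟨0, by simp, by simp, by simp⟩

lemma unique {q' : Dual ℂ H → PolyAlg ℂ L} (hq : IsGrad H R p q) (hq' : IsGrad H R p q')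
    (hS : RootSplitting H R e f) : q = q' := by
  ext1 α
  by_cases hα : α ∈ R
  · have h := (hq.eq (hS.wt_e hα)).symm.trans (hq'.eq (hS.wt_e hα))
    exact mul_left_cancel₀ (PolyAlg.lin_ne_zero (hS.e_ne hα)) h
  · rw [hq.zero hα, hq'.zero hα]

lemma mul {p' : PolyAlg ℂ L} {q' : Dual ℂ H → PolyAlg ℂ L} (hq : IsGrad H R p q)
    (hq' : IsGrad H R p' q') : IsGrad H R (p * p') fun α ↦ p * q' α + p' * q α where
  eq hx := by rw [polyAd_mul, hq.eq hx, hq'.eq hx]; ring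
  neg α := by rw [hq.neg, hq'.neg]; ring
  zero hα := by rw [hq.zero hα, hq'.zero hα]; ring

lemma sub {p' : PolyAlg ℂ L} {q' : Dual ℂ H → PolyAlg ℂ L} (hq : IsGrad H R p q)
    (hq' : IsGrad H R p' q') : IsGrad H R (p - p') fun α ↦ q α - q' α where
  eq hx := by rw [map_sub, hq.eq hx, hq'.eq hx]; ring
  neg α := by rw [hq.neg, hq'.neg]; ring
  zero hα := by rw [hq.zero hα, hq'.zero hα]; ring

lemma neg' (hq : IsGrad H R p q) : IsGrad H R (-p) fun α ↦ -q α where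
  eq hx := by rw [map_neg, hq.eq hx]; ring
  neg α := by rw [hq.neg]
  zero hα := by rw [hq.zero hα]; ring

lemma smul (r : ℂ) (hq : IsGrad H R p q) : IsGrad H R (r • p) fun α ↦ r • q α where
  eq hx := by rw [Derivation.map_smul, hq.eq hx, mul_smul_comm]
  neg α := by rw [hq.neg, smul_neg]
  zero hα := by rw [hq.zero hα, smul_zero]

lemma sum {ι : Type*} (s : Finset ι) {p : ι → PolyAlg ℂ L} {q : ι → Dual ℂ H → PolyAlg ℂ L}
    (h : ∀ i ∈ s, IsGrad H R (p i) (q i)) :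
    IsGrad H R (∑ i ∈ s, p i) fun α ↦ ∑ i ∈ s, q i α where
  eq hx := by
    rw [map_sum, Finset.mul_sum]
    exact Finset.sum_congr rfl fun i hi ↦ (h i hi).eq hx
  neg α := by
    rw [← Finset.sum_neg_distrib]
    exact Finset.sum_congr rfl fun i hi ↦ (h i hi).neg α
  zero hα := Finset.sum_eq_zero fun i hi ↦ (h i hi).zero hα

open Classical in
lemma lin_cartan (hS : RootSplitting H R e f) (t : H) :
    IsGrad H R (lin (t : L)) fun α ↦ if α ∈ R then -algebraMap ℂ _ (α t) else 0 where
  eq {α x} hx := by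
    by_cases hα : α ∈ R
    · rw [if_pos hα, polyAd_lin, ← lie_skew, hx t, map_neg, map_smul, Algebra.smul_def]
      ring
    · rw [if_neg hα, mul_zero]
      rcases hS.wt_zero_or hx hα with rfl | rfl
      · rw [polyAd_lin, ← lie_skew, hx t, LinearMap.zero_apply, zero_smul, neg_zero,
          _root_.map_zero]
      · rw [polyAd_zero]; rfl
  neg α := by
    by_cases hα : α ∈ R
    · simp [hα, hS.neg_mem hα]
    · have : -α ∉ R := fun h ↦ hα (by simpa using hS.neg_mem h)
      simp [hα, this]
  zero hα := if_neg hα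

lemma mem_deg (hq : IsGrad H R p q) (hS : RootSplitting H R e f) {n : ℕ}
    (hp : p ∈ PolyAlg.deg ℂ L (n + 1)) (α : Dual ℂ H) : q α ∈ PolyAlg.deg ℂ L n := by
  by_cases hα : α ∈ R
  · refine PolyAlg.mem_deg_of_lin_mul_mem (hS.e_ne hα) ?_
    rw [← hq.eq (hS.wt_e hα)]
    exact polyAd_mem_deg _ hp
  · rw [hq.zero hα]
    exact zero_mem _

lemma eq_zero_of_mem_deg_zero (hq : IsGrad H R p q) (hS : RootSplitting H R e f)
    (hp : p ∈ PolyAlg.deg ℂ L 0) (α : Dual ℂ H) : q α = 0 := by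
  by_cases hα : α ∈ R
  · refine PolyAlg.eq_zero_of_lin_mul_mem (hS.e_ne hα) ?_
    rw [← hq.eq (hS.wt_e hα)]
    exact polyAd_mem_deg _ hp
  · exact hq.zero hα

lemma invariant (hq : IsGrad H R p q) (hS : RootSplitting H R e f) (h : ∀ α, q α = 0) (x : L) :
    δ x p = 0 := by
  have hx : x ∈ Submodule.span ℂ {x | ∃ α, IsRootVector H α x} := by
    rw [hS.span_eq_top]; trivial
  induction hx using Submodule.span_induction with
  | mem x hx => obtain ⟨α, hx⟩ := hx; rw [hq.eq hx, h, mul_zero]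
  | zero => rw [polyAd_zero]; rfl
  | add x y _ _ hx hy => rw [polyAd_add, Derivation.add_apply, hx, hy, add_zero]
  | smul r x _ hx => rw [polyAd_smul, Derivation.smul_apply, hx, smul_zero]

end IsGrad

end RootGradient

section GradientLinear

variable {L : Type} [LieRing L] [LieAlgebra ℂ L]
  {H : LieSubalgebra ℂ L} {R : Set (Dual ℂ H)} {e f : Dual ℂ H → L}

local notation "δ" => polyAd (K := ℂ)
local notation "lin" => PolyAlg.lin ℂ

/-- A function on weights extends to an endomorphism acting by it on root vectors. -/
lemma RootSplitting.exists_endomorphism (hS : RootSplitting H R e f) (c : Dual ℂ H → ℂ) :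
    ∃ D : L →ₗ[ℂ] L, ∀ α x, IsRootVector H α x → D x = c α • x := by
  let b := Basis.ofSpan hS.span_eq_top.ge
  have hb : ∀ i, ∃ α, IsRootVector H α (b i) := fun i ↦
    Basis.ofSpan_subset hS.span_eq_top.ge ⟨i, rfl⟩
  choose w hw using hb
  refine ⟨b.constr ℂ fun i ↦ c (w i) • b i, fun α x hx ↦ ?_⟩
  have hrep : ∀ i, b.repr x i ≠ 0 → w i = α := by
    intro i hi
    ext t
    have h1 : b.repr ⁅(t : L), x⁆ i = w i t * b.repr x i := by
      have h2 : ∀ y : L, b.coord i ⁅(t : L), y⁆ = w i t * b.coord i y := by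
        intro y
        have : (b.coord i ∘ₗ (LieAlgebra.ad ℂ L t : L →ₗ[ℂ] L)) = w i t • b.coord i := by
          refine b.ext fun j ↦ ?_
          rw [LinearMap.comp_apply, LieAlgebra.ad_apply, hw j t, map_smul, LinearMap.smul_apply]
          by_cases hij : j = i
          · rw [hij]
          · simp [hij]
        exact LinearMap.congr_fun this y
      exact h2 x
    rw [hx t, map_smul, Finsupp.smul_apply, smul_eq_mul] at h1
    exact (mul_right_cancel₀ hi h1).symm
  conv_rhs => rw [← b.linearCombination_repr x]
  rw [Basis.constr_apply, Finsupp.linearCombination_apply, Finsupp.smul_sum]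
  refine Finsupp.sum_congr fun i hi ↦ ?_
  rw [hrep i (Finsupp.mem_support_iff.mp hi), smul_comm]

variable [FiniteDimensional ℂ L]

lemma IsGrad.exists_mem_cartan {p : PolyAlg ℂ L} {q : Dual ℂ H → PolyAlg ℂ L}
    (hq : IsGrad H R p q) (hS : RootSplitting H R e f) (φ : PolyAlg ℂ L →ₗ[ℂ] ℂ) :
    ∃ y : H, ∀ α ∈ R, φ (q α) = α y := by
  obtain ⟨D, hD⟩ := hS.exists_endomorphism fun α ↦ φ (q α)
  have hlie : ∀ x y : L, D ⁅x, y⁆ = ⁅x, D y⁆ - ⁅y, D x⁆ := by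
    intro x y
    have hx : x ∈ Submodule.span ℂ {x | ∃ α, IsRootVector H α x} := by
      rw [hS.span_eq_top]; trivial
    have hy : y ∈ Submodule.span ℂ {x | ∃ α, IsRootVector H α x} := by
      rw [hS.span_eq_top]; trivial
    induction hx, hy using Submodule.span_induction₂ with
    | mem_mem x y hx hy =>
      obtain ⟨α, hx⟩ := hx
      obtain ⟨β, hy⟩ := hy
      rw [hD _ _ (hx.lie hy), hD _ _ hx, hD _ _ hy, lie_smul, lie_smul, ← lie_skew x y]
      by_cases h : ⁅x, y⁆ = 0
      · have h' : ⁅y, x⁆ = 0 := by rw [← lie_skew, h, neg_zero]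
        rw [h']; simp
      · rw [hq.add_eq_of_lie_ne hS hx hy h, map_add]
        module
    | zero_left => simp
    | zero_right => simp
    | add_left x y z _ _ _ h1 h2 => simp only [add_lie, map_add, lie_add, h1, h2]; abel
    | add_right x y z _ _ _ h1 h2 => simp only [add_lie, map_add, lie_add, h1, h2]; abel
    | smul_left r x y _ _ h => simp only [smul_lie, map_smul, lie_smul, h, smul_sub]
    | smul_right r x y _ _ h => simp only [smul_lie, map_smul, lie_smul, h, smul_sub]
  obtain ⟨y, hy⟩ := hS.exists_eq_ad ⟨D, hlie⟩
  replace hy : ∀ x, D x = ⁅y, x⁆ := hy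
  have hyH : y ∈ H := by
    refine hS.mem_cartan fun t ↦ ?_
    have := hy t
    rw [hD _ _ (hS.wt_cartan t.2), hq.map_zero hS, _root_.map_zero, zero_smul] at this
    rw [← lie_skew, ← this, LinearMap.zero_apply, zero_smul, neg_zero]
  refine ⟨⟨y, hyH⟩, fun α hα ↦ ?_⟩
  have h := hy (e α)
  rw [hD _ _ (hS.wt_e hα), hS.wt_e hα ⟨y, hyH⟩] at h
  exact smul_left_injective ℂ (hS.e_ne hα) h

lemma RootSplitting.exists_dual_basis (hS : RootSplitting H R e f) :
    ∃ (n : ℕ) (β : Fin n → Dual ℂ H) (t : Fin n → H), (∀ i, β i ∈ R) ∧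
      ∀ α : Dual ℂ H, α = ∑ i, α (t i) • β i := by
  have := Module.Finite.finite_basis (Basis.ofSpan hS.span_dual.ge)
  let u := Finite.equivFin ((linearIndepOn_empty ℂ (id : Dual ℂ H → Dual ℂ H)).extend
    (Set.empty_subset R))
  let b := (Basis.ofSpan hS.span_dual.ge).reindex u
  refine ⟨_, b, fun i ↦ (Module.evalEquiv ℂ H).symm (b.coord i), fun i ↦ ?_, fun α ↦ ?_⟩
  · rw [Basis.reindex_apply]
    exact Basis.ofSpan_subset hS.span_dual.ge ⟨_, rfl⟩
  · simp only [Module.apply_evalEquiv_symm_apply, Basis.coord_apply]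
    exact (b.sum_repr α).symm

/-- The gradient depends linearly on the root. -/
lemma IsGrad.eq_sum {p : PolyAlg ℂ L} {q : Dual ℂ H → PolyAlg ℂ L}
    (hq : IsGrad H R p q) (hS : RootSplitting H R e f) {n : ℕ} {β : Fin n → Dual ℂ H}
    {t : Fin n → H} (hβ : ∀ i, β i ∈ R) (ht : ∀ α : Dual ℂ H, α = ∑ i, α (t i) • β i)
    {α : Dual ℂ H} (hα : α ∈ R) : q α = ∑ i, α (t i) • q (β i) := by
  rw [← sub_eq_zero, ← Module.forall_dual_apply_eq_zero_iff ℂ]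
  intro φ
  obtain ⟨y, hy⟩ := hq.exists_mem_cartan hS φ
  rw [map_sub, map_sum, hy α hα]
  have := LinearMap.congr_fun (ht α) y
  simp only [LinearMap.sum_apply, LinearMap.smul_apply] at this
  simp [hy _ (hβ _), this]

open Classical in
/-- The gradient of `p` along the roots, or zero if there is none. -/
noncomputable def grad (H : LieSubalgebra ℂ L) (R : Set (Dual ℂ H)) (p : PolyAlg ℂ L) :
    Dual ℂ H → PolyAlg ℂ L :=
  if h : ∃ q, IsGrad H R p q then h.choose else 0

lemma isGrad_grad {p : PolyAlg ℂ L} (h : ∃ q, IsGrad H R p q) : IsGrad H R p (grad H R p) := by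
  rw [grad, dif_pos h]
  exact h.choose_spec

lemma IsGrad.grad_eq {p : PolyAlg ℂ L} {q : Dual ℂ H → PolyAlg ℂ L} (hq : IsGrad H R p q)
    (hS : RootSplitting H R e f) : grad H R p = q :=
  (isGrad_grad ⟨q, hq⟩).unique hq hS

lemma grad_zero (hS : RootSplitting H R e f) : grad H R (0 : PolyAlg ℂ L) = 0 :=
  IsGrad.grad_eq ⟨by simp, by simp, by simp⟩ hS

/-- Second derivatives along the roots commute. -/
lemma IsGrad.grad_comm {p : PolyAlg ℂ L} {q : Dual ℂ H → PolyAlg ℂ L} (hq : IsGrad H R p q)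
    (hS : RootSplitting H R e f) (α β : Dual ℂ H) : grad H R (q β) α = grad H R (q α) β := by
  have hα' := isGrad_grad (hq.exists_isGrad hS α)
  have hβ' := isGrad_grad (hq.exists_isGrad hS β)
  by_cases hα : α ∈ R
  · by_cases hβ : β ∈ R
    · have h := hq.cross hS (hS.wt_e hα) (hS.wt_e hβ)
      rw [hβ'.eq (hS.wt_e hα), hα'.eq (hS.wt_e hβ)] at h
      refine mul_left_cancel₀ (mul_ne_zero (PolyAlg.lin_ne_zero (K := ℂ) (hS.e_ne hα))
        (PolyAlg.lin_ne_zero (hS.e_ne hβ))) ?_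
      linear_combination h
    · rw [hα'.zero hβ, hq.zero hβ, grad_zero hS, Pi.zero_apply]
  · rw [hβ'.zero hα, hq.zero hα, grad_zero hS, Pi.zero_apply]

/-- The Euler operator in the Cartan directions. -/
noncomputable def euler (H : LieSubalgebra ℂ L) (R : Set (Dual ℂ H)) {n : ℕ}
    (β : Fin n → Dual ℂ H) (t : Fin n → H) (p : PolyAlg ℂ L) : PolyAlg ℂ L :=
  -∑ i, lin (t i : L) * grad H R p (β i)

lemma isGrad_euler (hS : RootSplitting H R e f) {n : ℕ} {β : Fin n → Dual ℂ H}
    {t : Fin n → H} (hβ : ∀ i, β i ∈ R) (ht : ∀ α : Dual ℂ H, α = ∑ i, α (t i) • β i)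
    {p : PolyAlg ℂ L} (hp : ∃ q, IsGrad H R p q) :
    IsGrad H R (euler H R β t p) fun α ↦ grad H R p α + euler H R β t (grad H R p α) := by
  have hq := isGrad_grad hp
  have h1 := (IsGrad.sum Finset.univ fun i _ ↦ (IsGrad.lin_cartan hS (t i)).mul
    (isGrad_grad (hq.exists_isGrad hS (β i)))).neg'
  convert (show IsGrad H R (euler H R β t p) _ from h1) using 1
  funext α
  by_cases hα : α ∈ R
  · simp only [if_pos hα, euler, hq.grad_comm hS α]
    rw [Finset.sum_add_distrib, neg_add, add_comm]
    congr 1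
    conv_lhs => rw [hq.eq_sum hS hβ ht hα]
    rw [← Finset.sum_neg_distrib]
    refine Finset.sum_congr rfl fun i _ ↦ ?_
    rw [Algebra.smul_def]
    ring
  · have h2 : ∀ i, grad H R (grad H R p (β i)) α = 0 := fun i ↦
      (isGrad_grad (hq.exists_isGrad hS (β i))).zero hα
    simp [hα, euler, hq.zero hα, grad_zero hS, h2]

lemma euler_mem_deg (hS : RootSplitting H R e f) {m n : ℕ} (β : Fin n → Dual ℂ H)
    (t : Fin n → H) {p : PolyAlg ℂ L} (hp : ∃ q, IsGrad H R p q)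
    (h : p ∈ PolyAlg.deg ℂ L (m + 1)) : euler H R β t p ∈ PolyAlg.deg ℂ L (m + 1) := by
  refine neg_mem (sum_mem fun i _ ↦ ?_)
  rw [add_comm m 1]
  exact PolyAlg.deg_mul (PolyAlg.lin_mem _) ((isGrad_grad hp).mem_deg hS h _)

/-- All `d`-fold iterated gradients of `p` vanish. -/
def GradNilpotent (H : LieSubalgebra ℂ L) (R : Set (Dual ℂ H)) : ℕ → PolyAlg ℂ L → Prop
  | 0, p => p = 0
  | d + 1, p => ∀ α, GradNilpotent H R d (grad H R p α)

lemma gradNilpotent_of_mem_deg (hS : RootSplitting H R e f) {n : ℕ} {p : PolyAlg ℂ L}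
    (hp : ∃ q, IsGrad H R p q) (h : p ∈ PolyAlg.deg ℂ L n) : GradNilpotent H R (n + 1) p := by
  induction n generalizing p with
  | zero => exact fun α ↦ (isGrad_grad hp).eq_zero_of_mem_deg_zero hS h α
  | succ n ih =>
    exact fun α ↦ ih ((isGrad_grad hp).exists_isGrad hS α) ((isGrad_grad hp).mem_deg hS h α)

lemma gradNilpotent_euler_sub (hS : RootSplitting H R e f) {n : ℕ} {β : Fin n → Dual ℂ H}
    {t : Fin n → H} (hβ : ∀ i, β i ∈ R) (ht : ∀ α : Dual ℂ H, α = ∑ i, α (t i) • β i)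
    {d : ℕ} {p : PolyAlg ℂ L} (hp : ∃ q, IsGrad H R p q) (h : GradNilpotent H R (d + 1) p) :
    GradNilpotent H R d (euler H R β t p - (d : ℂ) • p) := by
  induction d generalizing p with
  | zero =>
    have h0 : ∀ α, grad H R p α = 0 := h
    simp [GradNilpotent, euler, h0]
  | succ d ih =>
    intro α
    have h1 := ih ((isGrad_grad hp).exists_isGrad hS α) (h α)
    rw [((isGrad_euler hS hβ ht hp).sub ((isGrad_grad hp).smul _)).grad_eq hS]
    convert h1 using 1
    push_cast
    module

/-- A polynomial with a gradient is generated by invariants and Cartan elements. -/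
lemma IsGrad.mem_of_invariant_of_cartan (hS : RootSplitting H R e f)
    {S : ℕ → Submodule ℂ (PolyAlg ℂ L)}
    (hinv : ∀ n, ∀ p ∈ PolyAlg.deg ℂ L n, (∀ x, δ x p = 0) → p ∈ S n)
    (hmul : ∀ n, ∀ t ∈ H, ∀ s ∈ S n, lin t * s ∈ S (n + 1))
    {n : ℕ} {p : PolyAlg ℂ L} (hp : ∃ q, IsGrad H R p q) (h : p ∈ PolyAlg.deg ℂ L n) :
    p ∈ S n := by
  obtain ⟨k, β, t, hβ, ht⟩ := hS.exists_dual_basis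
  have main : ∀ d n (p : PolyAlg ℂ L), (∃ q, IsGrad H R p q) → p ∈ PolyAlg.deg ℂ L n →
      GradNilpotent H R d p → p ∈ S n := by
    intro d
    induction d with
    | zero => rintro n _ - - rfl; exact zero_mem _
    | succ d ih =>
      intro n p hp h hd
      have hq := isGrad_grad hp
      rcases Nat.eq_zero_or_pos d with rfl | hd0
      · exact hinv n p h fun x ↦ hq.invariant hS hd x
      cases n with
      | zero => exact hinv 0 p h fun x ↦ hq.invariant hS (hq.eq_zero_of_mem_deg_zero hS h) x
      | succ m =>
        have hE : euler H R β t p ∈ S (m + 1) := neg_mem (sum_mem fun i _ ↦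
          hmul m _ (t i).2 _ (ih m _ (hq.exists_isGrad hS _) (hq.mem_deg hS h _) (hd _)))
        have h1 := ih (m + 1) _ ⟨_, (isGrad_euler hS hβ ht hp).sub (hq.smul _)⟩
          (sub_mem (euler_mem_deg hS β t hp h) (Submodule.smul_mem _ _ h))
          (gradNilpotent_euler_sub hS hβ ht hp hd)
        have h2 : (d : ℂ) • p ∈ S (m + 1) := by
          have := sub_mem hE h1
          rwa [sub_sub_cancel] at this
        exact (Submodule.smul_mem_iff _ (by exact_mod_cast hd0.ne')).mp h2
  exact main (n + 1) n p hp h (gradNilpotent_of_mem_deg hS hp h)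

end GradientLinear

section Commutant

variable {L : Type} [LieRing L] [LieAlgebra ℂ L]

lemma ι_mul_comm_of_mem_cartan {t x y : L} {a : ℂ} (hx : ⁅t, x⁆ = a • x)
    (hy : ⁅t, y⁆ = -a • y) : ι ℂ t * (ι ℂ x * ι ℂ y) = ι ℂ x * ι ℂ y * ι ℂ t := by
  have h1 := ι_lie (K := ℂ) t x
  have h2 := ι_lie (K := ℂ) t y
  rw [hx, map_smul] at h1
  rw [hy, map_smul] at h2
  calc ι ℂ t * (ι ℂ x * ι ℂ y)
      = (ι ℂ t * ι ℂ x - ι ℂ x * ι ℂ t) * ι ℂ y + ι ℂ x * (ι ℂ t * ι ℂ y - ι ℂ y * ι ℂ t)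
        + ι ℂ x * ι ℂ y * ι ℂ t := by noncomm_ring
    _ = _ := by
      rw [← h1, ← h2, smul_mul_assoc, mul_smul_comm, neg_smul, add_neg_cancel, zero_add]

variable {H : LieSubalgebra ℂ L} {R : Set (Dual ℂ H)} {e f : Dual ℂ H → L}

variable (H) in
/-- The subalgebra of the enveloping algebra generated by `H` and the centre. -/
noncomputable abbrev cartanCenter : Subalgebra ℂ (UniversalEnvelopingAlgebra ℂ L) :=
  Algebra.adjoin ℂ ((ι ℂ '' (H : Set L)) ∪
    (Subalgebra.center ℂ (UniversalEnvelopingAlgebra ℂ L) :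
      Set (UniversalEnvelopingAlgebra ℂ L)))

lemma cartanCenter_le_centralizer (hS : RootSplitting H R e f) :
    cartanCenter H ≤ Subalgebra.centralizer ℂ ((ι ℂ '' (H : Set L)) ∪
      ((fun α ↦ ι ℂ (e α) * ι ℂ (f α) + ι ℂ (f α) * ι ℂ (e α)) '' R)) := by
  refine Algebra.adjoin_le ?_
  rintro x (⟨t, ht, rfl⟩ | hx)
  · rw [SetLike.mem_coe, Subalgebra.mem_centralizer_iff]
    rintro _ (⟨y, hy, rfl⟩ | ⟨α, hα, rfl⟩)
    · rw [← sub_eq_zero, ← ι_lie, hS.wt_cartan ht ⟨y, hy⟩, LinearMap.zero_apply, zero_smul,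
        map_zero]
    · have h1 := hS.wt_e hα ⟨t, ht⟩
      have h2 := hS.wt_f hα ⟨t, ht⟩
      rw [LinearMap.neg_apply] at h2
      have h3 := ι_mul_comm_of_mem_cartan h1 h2
      have h4 := ι_mul_comm_of_mem_cartan h2 (by rwa [neg_neg])
      simp only [add_mul, mul_add, h3, h4]
  · rw [SetLike.mem_coe, Subalgebra.mem_center_iff] at hx
    rw [SetLike.mem_coe, Subalgebra.mem_centralizer_iff]
    exact fun g _ ↦ hx g

variable [FiniteDimensional ℂ L] [IsKilling ℂ L]

lemma apply_dual_ne_zero [H.IsCartanSubalgebra] {α : Dual ℂ H} (hα : α ≠ 0)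
    {x : L} (hx0 : x ≠ 0) (hx : IsRootVector H α x) {c : ℂ} {t : H}
    (ht : ∀ y : H, c * killingForm ℂ L t y = α y) : α t ≠ 0 := by
  have h1 : rootSpace H α ≠ ⊥ := by
    intro h
    have := isRootVector_iff_mem_rootSpace.mp hx
    rw [h, LieSubmodule.mem_bot] at this
    exact hx0 this
  let w : LieModule.Weight ℂ H L := ⟨α, h1⟩
  have hw : LieModule.Weight.toLinear ℂ H L w = α := rfl
  have hw0 : w.IsNonZero := fun h ↦ hα (LinearMap.ext fun t ↦ congrFun h t)
  have h2 : (IsKilling.cartanEquivDual H).symm (LieModule.Weight.toLinear ℂ H L w) = c • t := by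
    rw [LinearEquiv.symm_apply_eq, hw]
    ext y
    rw [map_smul, ← ht y]
    rfl
  have h3 := IsKilling.root_apply_cartanEquivDual_symm_ne_zero hw0
  rw [h2] at h3
  replace h3 : α (c • t) ≠ 0 := h3
  rw [map_smul] at h3
  exact right_ne_zero_of_smul h3

/-- The symbol of an element commuting with the Cartan subalgebra and the truncated Casimirs
has a gradient along the roots. -/
lemma exists_isGrad_symb (hS : RootSplitting H R e f) {n : ℕ}
    {x : UniversalEnvelopingAlgebra ℂ L} (hx : x ∈ envFilt ℂ L n)
    (hH : ∀ t ∈ H, ι ℂ t * x = x * ι ℂ t)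
    (hR : ∀ α ∈ R, (ι ℂ (e α) * ι ℂ (f α) + ι ℂ (f α) * ι ℂ (e α)) * x =
      x * (ι ℂ (e α) * ι ℂ (f α) + ι ℂ (f α) * ι ℂ (e α))) :
    ∃ q, IsGrad H R (symb ℂ L n x) q := by
  refine hS.exists_isGrad (fun t ht ↦ ?_) fun α hα ↦ ?_
  · rw [← symb_commutator, hH t ht, sub_self, map_zero]
  · have he := ι_commutator_mem (e α) hx
    have hf := ι_commutator_mem (f α) hx
    have h1 : ι ℂ (e α) * (ι ℂ (f α) * x - x * ι ℂ (f α)) +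
        (ι ℂ (e α) * x - x * ι ℂ (e α)) * ι ℂ (f α) +
        (ι ℂ (f α) * (ι ℂ (e α) * x - x * ι ℂ (e α)) +
        (ι ℂ (f α) * x - x * ι ℂ (f α)) * ι ℂ (e α)) = 0 := by
      rw [← sub_eq_zero.mpr (hR α hα)]
      noncomm_ring
    have h2 := congrArg (symb ℂ L (n + 1)) h1
    rw [map_add, map_add, map_add, symb_ι_mul _ hf, symb_ι_mul _ he, symb_mul_ι _ hf,
      symb_mul_ι _ he, symb_commutator, symb_commutator, map_zero] at h2
    refine (smul_eq_zero.mp (show (2 : ℂ) • (_ : PolyAlg ℂ L) = 0 from ?_)).resolve_left two_ne_zero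
    rw [two_smul]
    linear_combination h2

/-- A symbol with a gradient along the roots comes from the subalgebra generated by `H` and
the centre. -/
lemma exists_cartanCenter_symb_eq (hS : RootSplitting H R e f) {n : ℕ} {p : PolyAlg ℂ L}
    (hp : ∃ q, IsGrad H R p q) (h : p ∈ PolyAlg.deg ℂ L n) :
    ∃ u ∈ envFilt ℂ L n, u ∈ cartanCenter H ∧ symb ℂ L n u = p := by
  let S : ℕ → Submodule ℂ (PolyAlg ℂ L) := fun k ↦
    (envFilt ℂ L k ⊓ Subalgebra.toSubmodule (cartanCenter H)).map (symb ℂ L k)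
  have hpS : p ∈ S n := by
    refine IsGrad.mem_of_invariant_of_cartan hS (fun m q hq hinv ↦ ?_) (fun m t ht s hs ↦ ?_) hp h
    · obtain ⟨u, hu, huc, rfl⟩ := exists_center_symb_eq hq hinv
      exact ⟨u, ⟨hu, Algebra.subset_adjoin (Or.inr huc)⟩, rfl⟩
    · obtain ⟨u, ⟨hu, huA⟩, rfl⟩ := hs
      exact ⟨ι ℂ t * u, ⟨ι_mul_mem_envFilt t hu,
        Subalgebra.mul_mem _ (Algebra.subset_adjoin (Or.inl ⟨t, ht, rfl⟩)) huA⟩, symb_ι_mul t hu⟩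
  obtain ⟨u, ⟨hu, huA⟩, rfl⟩ := hpS
  exact ⟨u, hu, huA, rfl⟩

lemma centralizer_eq_cartanCenter (hS : RootSplitting H R e f) :
    Subalgebra.centralizer ℂ ((ι ℂ '' (H : Set L)) ∪
      ((fun α ↦ ι ℂ (e α) * ι ℂ (f α) + ι ℂ (f α) * ι ℂ (e α)) '' R)) = cartanCenter H := by
  refine le_antisymm (fun x hx ↦ ?_) (cartanCenter_le_centralizer hS)
  obtain ⟨n, hn⟩ := exists_mem_envFilt x
  induction n generalizing x with
  | zero =>
    obtain ⟨r, rfl⟩ := eq_smul_one_of_mem_envFilt_zero hn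
    exact Subalgebra.smul_mem _ (one_mem _) r
  | succ n ih =>
    have hx' := (Subalgebra.mem_centralizer_iff ℂ).mp hx
    obtain ⟨u, hu, huA, hux⟩ := exists_cartanCenter_symb_eq hS
      (exists_isGrad_symb hS hn (fun t ht ↦ hx' _ (Or.inl ⟨t, ht, rfl⟩))
        fun α hα ↦ hx' _ (Or.inr ⟨α, hα, rfl⟩)) (symb_mem_deg (n + 1) x)
    have h := ih (x - u) (sub_mem hx (cartanCenter_le_centralizer hS huA))
      (mem_envFilt_of_symb_eq_zero (sub_mem hn hu) (by rw [map_sub, hux, sub_self]))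
    simpa using add_mem h huA

end Commutant

end CartanCentralizer

/-- Etingof: for `g` simple, the centraliser of the Casimir algebra `C(g)` in
`U(g)` is generated by the Cartan subalgebra `h` together with the centre of `U(g)`. -/
theorem centralizer_of_casimir_algebra
    {L : Type} [LieRing L] [LieAlgebra ℂ L] [FiniteDimensional ℂ L]
    [LieAlgebra.IsSimple ℂ L]
    (H : LieSubalgebra ℂ L) [H.IsCartanSubalgebra]
    (c : ℂ) (hc : c ≠ 0)
    (B : LinearMap.BilinForm ℂ L) (hB : B = c • killingForm ℂ L)
    (R : Set (Module.Dual ℂ H))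
    (hR : R = {α | α ≠ 0 ∧ ∃ x : L, x ≠ 0 ∧ IsRootVector H α x})
    (t : Module.Dual ℂ H → H)
    (ht : ∀ α ∈ R, ∀ x : H, B (t α) x = α x)
    (e f : Module.Dual ℂ H → L) (hcoroot : Module.Dual ℂ H → H)
    (he : ∀ α ∈ R, IsRootVector H α (e α) ∧ e α ≠ 0)
    (hf : ∀ α ∈ R, IsRootVector H (-α) (f α) ∧ f α ≠ 0)
    (hef : ∀ α ∈ R, ⁅e α, f α⁆ = (hcoroot α : L))
    (hcoroot2 : ∀ α ∈ R, α (hcoroot α) = 2)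
    (κ : Module.Dual ℂ H → UniversalEnvelopingAlgebra ℂ L)
    (hκ : ∀ α ∈ R, κ α = (B (t α) (t α) / 2) •
      (ι ℂ (e α) * ι ℂ (f α) + ι ℂ (f α) * ι ℂ (e α))) :
    Subalgebra.centralizer ℂ
        ((Algebra.adjoin ℂ ((ι ℂ '' (H : Set L)) ∪ (κ '' R)) :
          Subalgebra ℂ (UniversalEnvelopingAlgebra ℂ L)) :
            Set (UniversalEnvelopingAlgebra ℂ L)) =
      Algebra.adjoin ℂ
        ((ι ℂ '' (H : Set L)) ∪
          (Subalgebra.center ℂ (UniversalEnvelopingAlgebra ℂ L) :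
            Set (UniversalEnvelopingAlgebra ℂ L))) := by
  have : IsKilling ℂ L := inferInstance
  refine Eq.trans ?_ (centralizer_eq_cartanCenter (rootSplitting hR he hf))
  have hcoef : ∀ α ∈ R, B (t α) (t α) / 2 ≠ 0 := by
    intro α hα
    refine div_ne_zero ?_ two_ne_zero
    rw [ht α hα]
    have h0 : α ≠ 0 := by rw [hR] at hα; exact hα.1
    refine apply_dual_ne_zero h0 (he α hα).2 (he α hα).1 (c := c) fun y ↦ ?_
    rw [← ht α hα y, hB]
    rfl
  apply le_antisymm
  · intro x hx
    rw [Subalgebra.mem_centralizer_iff] at hx ⊢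
    rintro _ (⟨y, hy, rfl⟩ | ⟨α, hα, rfl⟩)
    · exact hx _ (Algebra.subset_adjoin (Or.inl ⟨y, hy, rfl⟩))
    · have h := hx _ (Algebra.subset_adjoin (Or.inr ⟨α, hα, rfl⟩))
      rw [hκ α hα, smul_mul_assoc, mul_smul_comm] at h
      exact smul_right_injective _ (hcoef α hα) h
  · intro x hx
    rw [Subalgebra.mem_centralizer_iff] at hx ⊢
    have hle : Algebra.adjoin ℂ ((ι ℂ '' (H : Set L)) ∪ (κ '' R)) ≤
        Subalgebra.centralizer ℂ {x} := by
      refine Algebra.adjoin_le ?_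
      rintro _ (⟨y, hy, rfl⟩ | ⟨α, hα, rfl⟩) <;>
        rw [SetLike.mem_coe, Subalgebra.mem_centralizer_iff] <;> rintro _ rfl
      · exact (hx _ (Or.inl ⟨y, hy, rfl⟩)).symm
      · rw [hκ α hα, smul_mul_assoc, mul_smul_comm]
        exact congrArg _ (hx _ (Or.inr ⟨α, hα, rfl⟩)).symm
    exact fun g hg ↦ ((Subalgebra.mem_centralizer_iff ℂ).mp (hle hg) x rfl).symm
end

section
/- Suppose g is simple. The centre of the algebra U(g)^h = {x ∈ U(g) : xt = tx for all t ∈ h} equals the unital subalgebra of U(g) generated by the centre Z(U(g)) together with h; moreover, the multiplication map Z(U(g)) ⊗_ℂ U(h) → U(g) is an injective algebra homomorphism whose image is this centre, so that the centre of U(g)^h is isomorphic to Z(U(g)) ⊗ U(h). -/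
set_option synthInstance.maxHeartbeats 1000000
set_option maxHeartbeats 1000000

open LieAlgebra UniversalEnvelopingAlgebra TensorProduct

section DerivationPairing

variable {k R J : Type*} [Field k] [CommRing R] [Algebra k R]

theorem Derivation.apply_mem_pow_pred (D : Derivation k R R) (I : Ideal R) {n : ℕ} {f : R}
    (hf : f ∈ I ^ n) : D f ∈ I ^ (n - 1) := by
  induction n generalizing f with
  | zero => simp
  | succ n ih =>
    rw [pow_succ] at hf
    refine Submodule.mul_induction_on hf (fun a ha c hc ↦ ?_) (fun a c ha hc ↦ ?_)
    · rw [D.leibniz, Nat.add_sub_cancel]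
      refine add_mem (Ideal.mul_mem_right _ _ ha) ?_
      rcases n with _ | n
      · simp
      · rw [smul_eq_mul, mul_comm, pow_succ]
        exact Ideal.mul_mem_mul (ih ha) hc
    · rw [map_add]
      exact add_mem ha hc

theorem Derivation.list_prod_apply_mem_pow (D : J → Derivation k R R) (I : Ideal R) (l : List J)
    {n : ℕ} {f : R} (hf : f ∈ I ^ n) :
    (l.map fun i ↦ (D i : Module.End k R)).prod f ∈ I ^ (n - l.length) := by
  induction l with
  | nil => simpa using hf
  | cons i l ih =>
    have := (D i).apply_mem_pow_pred I ih
    simpa [Nat.sub_sub] using this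

variable (D : J → Derivation k R R) (ε : R →ₐ[k] k) (y : J → R)

theorem multiset_prod_mem_ker_pow (hy : ∀ j, ε (y j) = 0) (m : Multiset J) :
    (m.map y).prod ∈ RingHom.ker ε ^ m.card := by
  induction m using Multiset.induction_on with
  | empty => simp
  | cons j m ih =>
    rw [Multiset.map_cons, Multiset.prod_cons, Multiset.card_cons, pow_succ']
    exact Ideal.mul_mem_mul (hy j) ih

theorem derivation_multiset_prod_sub_mem [DecidableEq J] (hy : ∀ j, ε (y j) = 0)
    (hDy : ∀ i j, ε (D i (y j)) = if i = j then 1 else 0) (i : J) (m : Multiset J) :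
    D i (m.map y).prod - m.count i • ((m.erase i).map y).prod ∈ RingHom.ker ε ^ m.card := by
  induction m using Multiset.induction_on with
  | empty => simp
  | cons j m ih =>
    have h1 : y j * (D i (m.map y).prod - m.count i • ((m.erase i).map y).prod) ∈
        RingHom.ker ε ^ (j ::ₘ m).card := by
      rw [Multiset.card_cons, pow_succ']
      exact Ideal.mul_mem_mul (hy j) ih
    have h2 : (m.map y).prod * (D i (y j) - if i = j then 1 else 0) ∈
        RingHom.ker ε ^ (j ::ₘ m).card := by
      rw [Multiset.card_cons, pow_succ]
      refine Ideal.mul_mem_mul (multiset_prod_mem_ker_pow ε y hy m) ?_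
      rw [RingHom.mem_ker, map_sub, hDy]
      split_ifs <;> simp
    convert add_mem h1 h2 using 1
    rw [Multiset.map_cons, Multiset.prod_cons, Derivation.leibniz]
    rcases eq_or_ne i j with rfl | hij
    · have h3 : m.count i • (y i * ((m.erase i).map y).prod) = m.count i • (m.map y).prod := by
        by_cases hi : i ∈ m
        · rw [← Multiset.prod_cons, ← Multiset.map_cons, Multiset.cons_erase hi]
        · simp [Multiset.count_eq_zero_of_notMem hi]
      simp only [smul_eq_mul, Multiset.count_cons_self, Multiset.erase_cons_head, if_true,
        add_smul, one_smul, mul_sub, mul_smul_comm, h3]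
      ring
    · simp only [smul_eq_mul, Multiset.count_cons_of_ne hij, if_neg hij,
        Multiset.erase_cons_tail _ hij.symm, Multiset.map_cons, Multiset.prod_cons, mul_sub,
        mul_smul_comm]
      ring

theorem pairing_list_prod_ne_zero_iff [DecidableEq J] [CharZero k] (hy : ∀ j, ε (y j) = 0)
    (hDy : ∀ i j, ε (D i (y j)) = if i = j then 1 else 0) (l : List J) (m : Multiset J)
    (hlm : l.length = m.card) :
    ε ((l.map fun i ↦ (D i : Module.End k R)).prod (m.map y).prod) ≠ 0 ↔ (l : Multiset J) = m := by
  induction l using List.reverseRecOn generalizing m with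
  | nil =>
    obtain rfl : m = 0 := by simpa using hlm.symm
    simp
  | append_singleton l i ih =>
    have hcard : m.card = l.length + 1 := by simpa using hlm.symm
    have key : ε (((l ++ [i]).map fun i ↦ (D i : Module.End k R)).prod (m.map y).prod) =
        m.count i * ε ((l.map fun i ↦ (D i : Module.End k R)).prod
          ((m.erase i).map y).prod) := by
      have h := Derivation.list_prod_apply_mem_pow D _ l
        (derivation_multiset_prod_sub_mem D ε y hy hDy i m)
      rw [hcard, Nat.add_sub_cancel_left, pow_one, RingHom.mem_ker, map_sub, map_sub,
        sub_eq_zero, map_nsmul, map_nsmul, nsmul_eq_mul] at h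
      rw [← h]
      simp
    rw [key, mul_ne_zero_iff, Nat.cast_ne_zero, Multiset.count_ne_zero]
    have hl : ((l ++ [i] : List J) : Multiset J) = i ::ₘ (l : Multiset J) := by
      rw [← Multiset.coe_add, add_comm]; rfl
    rw [hl]
    constructor
    · rintro ⟨hi, h⟩
      rw [ih _ (by rw [Multiset.card_erase_of_mem hi, hcard]; rfl)] at h
      rw [h, Multiset.cons_erase hi]
    · rintro rfl
      refine ⟨by simp, ?_⟩
      rw [ih _ (by simp)]
      simp

theorem linearIndependent_pairing_sort [LinearOrder J] [CharZero k] (hy : ∀ j, ε (y j) = 0)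
    (hDy : ∀ i j, ε (D i (y j)) = if i = j then 1 else 0) :
    LinearIndependent k fun s : Multiset J ↦
      ((s.sort (· ≤ ·)).map fun i ↦ (D i : Module.End k R)).prod := by
  rw [linearIndependent_iff']
  intro S c hc
  by_contra! hne
  obtain ⟨s₀, hs₀⟩ := hne
  classical
  obtain ⟨s, hs, hmax⟩ := (S.filter (c · ≠ 0)).exists_max_image Multiset.card
    ⟨s₀, by simpa using hs₀⟩
  rw [Finset.mem_filter] at hs
  have h := congrArg (fun T : Module.End k R ↦ ε (T (s.map y).prod)) hc
  simp only [LinearMap.sum_apply, map_sum, LinearMap.smul_apply, map_smul, LinearMap.zero_apply,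
    map_zero] at h
  rw [Finset.sum_eq_single_of_mem s hs.1] at h
  · refine smul_ne_zero hs.2 ?_ h
    rw [pairing_list_prod_ne_zero_iff D ε y hy hDy _ _ (by simp)]
    simp
  · intro t ht hts
    by_cases hct : c t = 0
    · simp [hct]
    have hle := hmax t (by simp [ht, hct])
    rcases hle.lt_or_eq with hlt | heq
    · have := Derivation.list_prod_apply_mem_pow D _ (t.sort (· ≤ ·))
        (multiset_prod_mem_ker_pow ε y hy s)
      have h0 := Ideal.pow_le_self (Nat.sub_ne_zero_of_lt (by simpa using hlt)) this
      rw [RingHom.mem_ker] at h0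
      rw [h0, smul_zero]
    · have := (pairing_list_prod_ne_zero_iff D ε y hy hDy (t.sort (· ≤ ·)) s
        (by simpa using heq)).not.mpr (by simpa using hts)
      rw [not_not.mp this, smul_zero]

end DerivationPairing

section PoincareBirkhoffWitt

attribute [local instance] LieRing.ofAssociativeRing

variable {k L J : Type*} [Field k] [LieRing L] [LieAlgebra k L]

/-- The linear form on matrices sending `v` to `∑ j, (coordinate j of v) • X (i, j)`. -/
noncomputable def genericRow (b : Module.Basis J k L) (i : J) : L →ₗ[k] MvPolynomial (J × J) k :=
  b.constr k fun j ↦ MvPolynomial.X (i, j)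

/-- The vector field on matrices attached to an element of `L` through the adjoint
representation. -/
noncomputable def adjointVectorField (b : Module.Basis J k L) (x : L) :
    Derivation k (MvPolynomial (J × J) k) (MvPolynomial (J × J) k) :=
  MvPolynomial.mkDerivation k fun p ↦ genericRow b p.1 ⁅x, b p.2⁆

theorem adjointVectorField_genericRow (b : Module.Basis J k L) (x v : L) (i : J) :
    adjointVectorField b x (genericRow b i v) = genericRow b i ⁅x, v⁆ := by
  have h : (adjointVectorField b x : Module.End k _) ∘ₗ genericRow b i =
      genericRow b i ∘ₗ (LieAlgebra.ad k L x : L →ₗ[k] L) := by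
    refine b.ext fun j ↦ ?_
    simp only [LinearMap.comp_apply, LieAlgebra.ad_apply]
    conv_lhs => rw [genericRow, Module.Basis.constr_basis]
    simp [adjointVectorField, MvPolynomial.mkDerivation_X]
  exact LinearMap.congr_fun h v

/-- The action of a Lie algebra on functions on matrices by vector fields. -/
noncomputable def vectorFieldHom (b : Module.Basis J k L) :
    L →ₗ⁅k⁆ Module.End k (MvPolynomial (J × J) k) where
  toFun x := adjointVectorField b x
  map_add' x y := by
    rw [← Derivation.coe_add_linearMap]
    congr 1
    refine MvPolynomial.derivation_ext fun p ↦ ?_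
    simp [adjointVectorField, MvPolynomial.mkDerivation_X]
  map_smul' c x := by
    rw [RingHom.id_apply, ← Derivation.coe_smul_linearMap]
    congr 1
    refine MvPolynomial.derivation_ext fun p ↦ ?_
    simp [adjointVectorField, MvPolynomial.mkDerivation_X]
  map_lie' {x y} := by
    rw [← Derivation.commutator_coe_linear_map]
    congr 1
    refine MvPolynomial.derivation_ext fun p ↦ ?_
    have h (z : L) : adjointVectorField b z (MvPolynomial.X p) = genericRow b p.1 ⁅z, b p.2⁆ := by
      simp [adjointVectorField, MvPolynomial.mkDerivation_X]
    rw [Derivation.commutator_apply, h, h, h, adjointVectorField_genericRow,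
      adjointVectorField_genericRow, ← map_sub, lie_lie]

/-- The ordered monomials of the Poincaré–Birkhoff–Witt theorem. -/
noncomputable def pbwMonomial [LinearOrder J] (b : Module.Basis J k L) (s : Multiset J) :
    UniversalEnvelopingAlgebra k L :=
  ((s.sort (· ≤ ·)).map fun j ↦ ι k (b j)).prod

theorem exists_dual_coordinates [Fintype J] (b : Module.Basis J k L)
    (had : Function.Injective (LieAlgebra.ad k L)) :
    ∃ (ε : MvPolynomial (J × J) k →ₐ[k] k) (y : J → MvPolynomial (J × J) k),
      (∀ j, ε (y j) = 0) ∧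
      ∀ i j, ε (adjointVectorField b (b i) (y j)) = (Finsupp.single i 1 : J →₀ k) j := by
  classical
  let ε : MvPolynomial (J × J) k →ₐ[k] k := MvPolynomial.aeval fun p ↦ (b.repr (b p.2)) p.1
  have hε (i : J) (v : L) : ε (genericRow b i v) = b.repr v i := by
    have : ε.toLinearMap ∘ₗ genericRow b i = b.coord i := by
      refine b.ext fun j ↦ ?_
      simp [ε, genericRow]
    exact LinearMap.congr_fun this v
  let T : L →ₗ[k] Matrix J J k :=
    (LinearMap.toMatrix b b).toLinearMap ∘ₗ (LieAlgebra.ad k L : L →ₗ[k] Module.End k L)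
  have hT : LinearMap.ker T = ⊥ := by
    rw [LinearMap.ker_eq_bot]
    exact (LinearMap.toMatrix b b).injective.comp had
  obtain ⟨G, hG⟩ := T.exists_leftInverse_of_injective hT
  let a (l i j : J) : k := b.repr (G (Matrix.single i j 1)) l
  refine ⟨ε, fun l ↦ ∑ i, ∑ j, a l i j • (MvPolynomial.X (i, j) -
    algebraMap k _ (b.repr (b j) i)), fun l ↦ ?_, fun m l ↦ ?_⟩
  · simp [ε]
  · have h1 : G (T (b m)) = b m := LinearMap.congr_fun hG (b m)
    have h2 : b.repr (G (T (b m))) l = ∑ i, ∑ j, T (b m) i j * a l i j := by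
      conv_lhs => rw [Matrix.matrix_eq_sum_single (T (b m))]
      have (i j : J) : Matrix.single i j (T (b m) i j) = T (b m) i j • Matrix.single i j 1 := by
        simp
      simp only [map_sum, this, map_smul, Finsupp.coe_finsetSum, Finset.sum_apply,
        Finsupp.smul_apply, smul_eq_mul, a]
    rw [h1, Module.Basis.repr_self] at h2
    rw [h2]
    simp only [map_sum, Derivation.map_smul, map_smul, map_sub, Derivation.map_algebraMap,
      sub_zero, smul_eq_mul]
    refine Finset.sum_congr rfl fun i _ ↦ Finset.sum_congr rfl fun j _ ↦ ?_
    rw [mul_comm]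
    congr 1
    simp [adjointVectorField, MvPolynomial.mkDerivation_X, hε, T, LinearMap.toMatrix_apply]

theorem linearIndependent_pbwMonomial [Fintype J] [CharZero k] [LinearOrder J]
    (b : Module.Basis J k L)
    (had : Function.Injective (LieAlgebra.ad k L)) :
    LinearIndependent k (pbwMonomial b) := by
  obtain ⟨ε, y, hy, hDy⟩ := exists_dual_coordinates b had
  refine LinearIndependent.of_comp
    (UniversalEnvelopingAlgebra.lift k (vectorFieldHom b)).toLinearMap ?_
  convert linearIndependent_pairing_sort (fun i ↦ adjointVectorField b (b i)) ε y hy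
    (fun i j ↦ by rw [hDy, Finsupp.single_apply]) using 1
  · funext s
    simp only [Function.comp_apply, pbwMonomial, AlgHom.toLinearMap_apply, map_list_prod,
      List.map_map]
    congr 2
    funext j
    simp only [Function.comp_apply, lift_ι_apply]
    rfl
  · rfl
  · rfl

variable (k L) in
theorem adjoin_range_ι :
    Algebra.adjoin k (Set.range (ι k : L → UniversalEnvelopingAlgebra k L)) = ⊤ := by
  set S := Algebra.adjoin k (Set.range (ι k : L → UniversalEnvelopingAlgebra k L))
  have hS (x : L) : ι k x ∈ S := Algebra.subset_adjoin ⟨x, rfl⟩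
  let f : L →ₗ⁅k⁆ S :=
    { toFun := fun x ↦ ⟨ι k x, hS x⟩
      map_add' := fun x y ↦ Subtype.ext (map_add (ι k) x y)
      map_smul' := fun c x ↦ Subtype.ext (map_smul (ι k) c x)
      map_lie' := fun {x y} ↦ Subtype.ext (LieHom.map_lie (ι k) x y) }
  have h : S.val.comp (lift k f) = AlgHom.id k _ := by
    apply UniversalEnvelopingAlgebra.hom_ext
    ext x
    change S.val (lift k f (ι k x)) = ι k x
    rw [lift_ι_apply]
    rfl
  rw [eq_top_iff]
  rintro u -
  have := DFunLike.congr_fun h u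
  rw [AlgHom.id_apply] at this
  exact this ▸ (lift k f u).2

theorem span_pbwMonomial [LinearOrder J] (b : Module.Basis J k L) :
    Submodule.span k (Set.range (pbwMonomial b)) = ⊤ := by
  let w (l : List J) : UniversalEnvelopingAlgebra k L := (l.map fun j ↦ ι k (b j)).prod
  let W (n : ℕ) : Submodule k (UniversalEnvelopingAlgebra k L) :=
    Submodule.span k (w '' {l | l.length < n})
  have hWmono {m n : ℕ} (h : m ≤ n) : W m ≤ W n :=
    Submodule.span_mono <| Set.image_mono fun l (hl : l.length < m) ↦ hl.trans_le h
  have hWmul (x : L) {n : ℕ} {u : UniversalEnvelopingAlgebra k L} (hu : u ∈ W n) :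
      ι k x * u ∈ W (n + 1) := by
    induction hu using Submodule.span_induction with
    | zero => simp
    | add u v _ _ hu hv => rw [mul_add]; exact add_mem hu hv
    | smul c u _ hu => rw [mul_smul_comm]; exact Submodule.smul_mem _ _ hu
    | mem u hu =>
      obtain ⟨l, hl, rfl⟩ := hu
      induction b.mem_span x using Submodule.span_induction with
      | mem x hx =>
        obtain ⟨j, rfl⟩ := hx
        exact Submodule.subset_span ⟨j :: l, by simpa using hl, by simp [w]⟩
      | zero => simp
      | add x y _ _ hx hy => rw [map_add, add_mul]; exact add_mem hx hy
      | smul c x _ hx => rw [map_smul, smul_mul_assoc]; exact Submodule.smul_mem _ _ hx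
  have hperm {l l' : List J} (h : l.Perm l') : w l - w l' ∈ W l.length := by
    induction h with
    | nil => simp
    | cons j h ih =>
      have := hWmul (b j) ih
      simpa [w, mul_sub] using this
    | swap i j l =>
      have : w (j :: i :: l) - w (i :: j :: l) = ι k ⁅b j, b i⁆ * w l := by
        rw [LieHom.map_lie, LieRing.of_associative_ring_bracket]
        simp only [w, List.map_cons, List.prod_cons]
        noncomm_ring
      rw [this]
      exact hWmul _ (Submodule.subset_span ⟨l, by simp, rfl⟩)
    | trans h₁ _ ih₁ ih₂ =>
      rw [← h₁.length_eq] at ih₂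
      simpa using add_mem ih₁ ih₂
  have hWspan (n : ℕ) : W n ≤ Submodule.span k (Set.range (pbwMonomial b)) := by
    induction n with
    | zero => simp [W]
    | succ n ih =>
      refine Submodule.span_le.mpr ?_
      rintro _ ⟨l, hl, rfl⟩
      have h := hperm (l := l) (l' := (l : Multiset J).sort (· ≤ ·))
        (Multiset.coe_eq_coe.mp (Multiset.sort_eq _ _).symm)
      have h' := add_mem (ih (hWmono (Nat.lt_succ_iff.mp hl) h))
        (Submodule.subset_span ⟨(l : Multiset J), rfl⟩)
      rwa [pbwMonomial, sub_add_cancel] at h'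
  rw [eq_top_iff]
  rintro u -
  suffices ∃ n, u ∈ W n by
    obtain ⟨n, hn⟩ := this
    exact hWspan n hn
  have hadj : u ∈ Algebra.adjoin k (Set.range (ι k : L → UniversalEnvelopingAlgebra k L)) := by
    simp [adjoin_range_ι]
  rw [← Subalgebra.mem_toSubmodule, Algebra.adjoin_eq_span] at hadj
  induction hadj using Submodule.span_induction with
  | zero => exact ⟨0, zero_mem _⟩
  | add u v _ _ hu hv =>
    obtain ⟨m, hm⟩ := hu
    obtain ⟨n, hn⟩ := hv
    exact ⟨max m n, add_mem (hWmono (le_max_left _ _) hm) (hWmono (le_max_right _ _) hn)⟩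
  | smul c u _ hu => exact hu.imp fun n hn ↦ Submodule.smul_mem _ c hn
  | mem u hu =>
    induction hu using Submonoid.closure_induction_left with
    | one => exact ⟨1, Submodule.subset_span ⟨[], by simp, by simp [w]⟩⟩
    | mul_left x hx u _ ih =>
      obtain ⟨x, rfl⟩ := hx
      exact ih.elim fun n hn ↦ ⟨n + 1, hWmul x hn⟩

theorem exists_linearOrder_extremes [Finite J] {p q : J} (hpq : p ≠ q) :
    ∃ _ : LinearOrder J, (∀ j, p ≤ j) ∧ ∀ j, j ≤ q := by
  classical
  have := Fintype.ofFinite J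
  let N := Fintype.card J
  let f (j : J) : ℕ := if j = p then 0 else if j = q then N + 1 else Fintype.equivFin J j + 1
  have hf (j : J) : (Fintype.equivFin J j : ℕ) < N := (Fintype.equivFin J j).isLt
  have hinj : Function.Injective f := by
    intro i j hij
    have hi := hf i
    have hj := hf j
    simp only [f] at hij
    split_ifs at hij <;> first
      | omega
      | (subst_vars; rfl)
      | exact (Fintype.equivFin J).injective (Fin.ext (by omega))
  refine ⟨LinearOrder.lift' f hinj, fun j ↦ ?_, fun j ↦ ?_⟩
  · change f p ≤ f j
    simp [f]
  · change f j ≤ f q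
    have := hf j
    simp only [f, if_neg hpq.symm, if_true]
    split_ifs <;> omega

theorem pbw_extremes [Fintype J] [CharZero k] [LinearOrder J] (b : Module.Basis J k L)
    (had : Function.Injective (LieAlgebra.ad k L)) {p q : J} (hp : ∀ j, p ≤ j) (hq : ∀ j, j ≤ q)
    (hpq : p ≠ q) :
    IsLeftRegular (ι k (b p)) ∧ IsRightRegular (ι k (b q)) ∧
      ∀ a c, a * ι k (b q) = ι k (b p) * c → ∃ d, a = ι k (b p) * d := by
  let B : Module.Basis (Multiset J) k (UniversalEnvelopingAlgebra k L) :=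
    .mk (linearIndependent_pbwMonomial b had) (span_pbwMonomial b).ge
  have hB (s : Multiset J) : B s = pbwMonomial b s := by simp [B]
  have hleft (s : Multiset J) : ι k (b p) * B s = B (p ::ₘ s) := by
    rw [hB, hB, pbwMonomial, pbwMonomial, Multiset.sort_cons _ _ _ fun j _ ↦ hp j]
    simp
  have hright (s : Multiset J) : B s * ι k (b q) = B (q ::ₘ s) := by
    have hs : (q ::ₘ s).sort (· ≤ ·) = s.sort (· ≤ ·) ++ [q] := by
      refine List.Perm.eq_of_pairwise' (r := (· ≤ ·)) (Multiset.pairwise_sort _ _) ?_ ?_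
      · rw [List.pairwise_append]
        exact ⟨Multiset.pairwise_sort _ _, by simp, by simpa using fun j _ ↦ hq j⟩
      · rw [← Multiset.coe_eq_coe, Multiset.sort_eq, ← Multiset.coe_add, Multiset.sort_eq,
          add_comm]
        rfl
    rw [hB, hB, pbwMonomial, pbwMonomial, hs]
    simp
  have hl (a : UniversalEnvelopingAlgebra k L) :
      B.repr (ι k (b p) * a) = (B.repr a).mapDomain (p ::ₘ ·) := by
    have : B.repr.toLinearMap ∘ₗ LinearMap.mulLeft k (ι k (b p)) =
        Finsupp.lmapDomain k k (p ::ₘ ·) ∘ₗ B.repr.toLinearMap := by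
      refine B.ext fun s ↦ ?_
      change B.repr (ι k (b p) * B s) = (B.repr (B s)).mapDomain _
      rw [hleft, B.repr_self, B.repr_self, Finsupp.mapDomain_single]
    exact LinearMap.congr_fun this a
  have hr (a : UniversalEnvelopingAlgebra k L) :
      B.repr (a * ι k (b q)) = (B.repr a).mapDomain (q ::ₘ ·) := by
    have : B.repr.toLinearMap ∘ₗ LinearMap.mulRight k (ι k (b q)) =
        Finsupp.lmapDomain k k (q ::ₘ ·) ∘ₗ B.repr.toLinearMap := by
      refine B.ext fun s ↦ ?_
      change B.repr (B s * ι k (b q)) = (B.repr (B s)).mapDomain _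
      rw [hright, B.repr_self, B.repr_self, Finsupp.mapDomain_single]
    exact LinearMap.congr_fun this a
  have hinj (j : J) : Function.Injective fun s : Multiset J ↦ j ::ₘ s :=
    fun s t h ↦ by simpa using h
  refine ⟨fun a c h ↦ B.repr.injective (Finsupp.mapDomain_injective (hinj p) ?_),
    fun a c h ↦ B.repr.injective (Finsupp.mapDomain_injective (hinj q) ?_), fun a c h ↦ ?_⟩
  · rw [← hl, ← hl]; exact congrArg B.repr h
  · rw [← hr, ← hr]; exact congrArg B.repr h
  · suffices a ∈ LinearMap.range (LinearMap.mulLeft k (ι k (b p))) by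
      obtain ⟨d, rfl⟩ := this
      exact ⟨d, rfl⟩
    rw [← B.linearCombination_repr a, Finsupp.linearCombination_apply]
    refine Submodule.sum_mem _ fun s hs ↦ Submodule.smul_mem _ _ ?_
    have hps : p ∈ s := by
      by_contra hps
      have h1 := DFunLike.congr_fun (congrArg B.repr h) (q ::ₘ s)
      rw [hr, hl, Finsupp.mapDomain_apply (hinj q), Finsupp.mapDomain_of_notMem_range] at h1
      · exact Finsupp.mem_support_iff.mp hs h1
      · rintro ⟨t, ht⟩
        have : p ∈ q ::ₘ s := ht ▸ Multiset.mem_cons_self p t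
        simp [hpq, hps] at this
    obtain ⟨t, rfl⟩ := Multiset.exists_cons_of_mem hps
    exact ⟨B t, hleft t⟩

theorem pbw_pair [CharZero k] [FiniteDimensional k L]
    (had : Function.Injective (LieAlgebra.ad k L)) {x y : L}
    (hxy : LinearIndependent k ![x, y]) :
    IsLeftRegular (ι k x) ∧ IsRightRegular (ι k y) ∧
      ∀ a c, a * ι k y = ι k x * c → ∃ d, a = ι k x * d := by
  have hli : LinearIndepOn k id ({x, y} : Set L) := by
    have h := hxy.linearIndepOn_id
    rwa [Matrix.range_cons_cons_empty] at h
  have hne : x ≠ y := fun h ↦ by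
    simpa using hxy.injective (show ![x, y] 0 = ![x, y] 1 by simpa using h)
  have hsub := hli.subset_extend (Set.subset_univ _)
  let b := Module.Basis.extend hli
  have := Module.Finite.finite_basis b
  have := Fintype.ofFinite (hli.extend (Set.subset_univ _))
  obtain ⟨_, hp, hq⟩ := exists_linearOrder_extremes
    (p := (⟨x, hsub (by simp)⟩ : hli.extend (Set.subset_univ _))) (q := ⟨y, hsub (by simp)⟩)
    (by simpa using hne)
  have h := pbw_extremes b had hp hq (by simpa using hne)
  simpa only [b, Module.Basis.extend_apply_self] using h

end PoincareBirkhoffWitt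

section UnipotentShifts

variable {k C I : Type*} [Field k] [CommRing C] [Algebra k C]

theorem MvPolynomial.eq_zero_of_eval_natCast_eq_zero [CharZero k] (q : MvPolynomial I C)
    (hq : ∀ n : I → ℕ, MvPolynomial.eval (fun i ↦ (n i : C)) q = 0) : q = 0 := by
  ext m
  rw [MvPolynomial.coeff_zero, ← Module.forall_dual_apply_eq_zero_iff k]
  intro φ
  classical
  let q' : MvPolynomial I k := ∑ l ∈ q.support, MvPolynomial.monomial l (φ (q.coeff l))
  have hq' (n : I → ℕ) : MvPolynomial.eval (fun i ↦ (n i : k)) q' = 0 := by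
    have h := congrArg φ (hq n)
    rw [map_zero] at h
    rw [← h, MvPolynomial.eval_eq (fun i ↦ (n i : C)) q, map_sum, map_sum]
    refine Finset.sum_congr rfl fun l _ ↦ ?_
    rw [MvPolynomial.eval_monomial, mul_comm (q.coeff l), Finsupp.prod]
    have : (∏ i ∈ l.support, (n i : C) ^ l i) * q.coeff l =
        (∏ i ∈ l.support, n i ^ l i) • q.coeff l := by
      simp [nsmul_eq_mul]
    rw [this, map_nsmul, nsmul_eq_mul, mul_comm]
    simp
  have h0 : q' = 0 := MvPolynomial.funext_set (fun _ ↦ Set.range ((↑) : ℕ → k))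
    (fun _ ↦ Set.infinite_range_of_injective Nat.cast_injective) fun x hx ↦ by
      choose n hn using fun i ↦ hx i trivial
      obtain rfl : (fun i ↦ (n i : k)) = x := _root_.funext hn
      simpa using hq' n
  have hm := congrArg (MvPolynomial.coeff m) h0
  simp only [q', MvPolynomial.coeff_sum, MvPolynomial.coeff_monomial, Finset.sum_ite_eq',
    MvPolynomial.coeff_zero] at hm
  by_cases hms : m ∈ q.support
  · simpa [hms] using hm
  · rw [MvPolynomial.notMem_support_iff.mp hms, map_zero]

variable [DecidableEq I] (τ : I → C →ₐ[k] C) (h : I → C)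

theorem MvPolynomial.eq_zero_of_eval₂_eq_zero_of_shift [CharZero k] [Finite I]
    {Z : Type*} [CommRing Z] (φ : Z →+* C)
    (hφ : Function.Injective φ) (hτφ : ∀ i z, τ i (φ z) = φ z)
    (hτh : ∀ i j, τ i (h j) = h j + if i = j then 1 else 0)
    (p : MvPolynomial I Z) (hp : MvPolynomial.eval₂ φ h p = 0) : p = 0 := by
  have key (s : Multiset I) : MvPolynomial.eval₂ φ (fun i ↦ h i + s.count i) p = 0 := by
    induction s using Multiset.induction_on with
    | empty => simpa using hp
    | cons j s ih =>
      have h1 := congrArg (τ j : C →+* C) ih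
      rw [MvPolynomial.eval₂_comp_left, map_zero] at h1
      rw [← h1]
      congr 1
      · ext z
        simp [hτφ]
      · funext i
        by_cases hij : i = j
        · subst hij
          simp [hτh]
          ring
        · simp [hτh, hij, Ne.symm hij]
  let q : MvPolynomial I C := MvPolynomial.map φ p
  let q' : MvPolynomial I C :=
    MvPolynomial.aeval (fun i ↦ MvPolynomial.C (h i) + MvPolynomial.X i) q
  have hq' : q' = 0 := by
    refine MvPolynomial.eq_zero_of_eval_natCast_eq_zero (k := k) _ fun n ↦ ?_
    have h1 := key (Finsupp.toMultiset (Finsupp.equivFunOnFinite.symm n))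
    have h2 : ((MvPolynomial.eval fun i ↦ (n i : C)).comp ((MvPolynomial.aeval
        (fun i ↦ MvPolynomial.C (h i) + MvPolynomial.X i) :
          MvPolynomial I C →ₐ[C] MvPolynomial I C) : _ →+* _)).comp (MvPolynomial.map φ) =
        MvPolynomial.eval₂Hom φ fun i ↦ h i + n i := by
      ext <;> simp
    refine (RingHom.congr_fun h2 p).trans ?_
    simpa [Finsupp.count_toMultiset] using h1
  have hq : MvPolynomial.aeval (fun i ↦ MvPolynomial.X i - MvPolynomial.C (h i)) q' = q := by
    have h2 : (MvPolynomial.aeval (fun i ↦ MvPolynomial.X i - MvPolynomial.C (h i)) :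
        MvPolynomial I C →ₐ[C] MvPolynomial I C).comp
        (MvPolynomial.aeval fun i ↦ MvPolynomial.C (h i) + MvPolynomial.X i) =
        AlgHom.id C _ := by
      ext
      simp [← MvPolynomial.algebraMap_eq]
    exact DFunLike.congr_fun h2 q
  have : q = 0 := by rw [← hq, hq', map_zero]
  exact MvPolynomial.map_injective φ hφ (by simpa [q] using this)

theorem productMap_injective_of_shift [CharZero k] [Finite I] {Z U : Type*} [CommRing Z]
    [Algebra k Z] [Ring U] [Algebra k U] (φ : Z →ₐ[k] C) (ψ : U →ₐ[k] C)
    (hφ : Function.Injective φ) (hψ : Function.Injective ψ)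
    (hτφ : ∀ i z, τ i (φ z) = φ z) (hψh : ψ.range = Algebra.adjoin k (Set.range h))
    (hτh : ∀ i j, τ i (h j) = h j + if i = j then 1 else 0) :
    Function.Injective (Algebra.TensorProduct.lift φ ψ fun _ _ ↦ Commute.all _ _) := by
  have hmem (i : I) : h i ∈ ψ.range := hψh ▸ Algebra.subset_adjoin ⟨i, rfl⟩
  choose u hu using hmem
  let _ : CommRing U :=
    { ‹Ring U› with mul_comm := fun a b ↦ hψ (by rw [map_mul, map_mul, mul_comm]) }
  let θ : MvPolynomial I k →ₐ[k] U := MvPolynomial.aeval u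
  have hψθ : ψ.comp θ = MvPolynomial.aeval h := by
    ext i
    simpa [θ] using hu i
  have hθ : Function.Surjective θ := fun a ↦ by
    have ha : ψ a ∈ (MvPolynomial.aeval h : MvPolynomial I k →ₐ[k] C).range := by
      rw [← Algebra.adjoin_range_eq_range_aeval, ← hψh]
      exact ⟨a, rfl⟩
    obtain ⟨p, hp⟩ := ha
    exact ⟨p, hψ ((DFunLike.congr_fun hψθ p).trans hp)⟩
  let G : Z ⊗[k] MvPolynomial I k →ₐ[k] Z ⊗[k] U :=
    Algebra.TensorProduct.map (AlgHom.id k Z) θ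
  have hG : Function.Surjective G := TensorProduct.map_surjective Function.surjective_id hθ
  have hFG (x : Z ⊗[k] MvPolynomial I k) :
      Algebra.TensorProduct.lift φ ψ (fun _ _ ↦ Commute.all _ _) (G x) =
        MvPolynomial.eval₂ φ h (MvPolynomial.algebraTensorAlgEquiv k Z x) := by
    induction x using TensorProduct.induction_on with
    | zero => simp
    | tmul z p =>
      have hp := DFunLike.congr_fun hψθ p
      rw [AlgHom.comp_apply] at hp
      simp only [G, Algebra.TensorProduct.map_tmul, Algebra.TensorProduct.lift_tmul, hp,
        MvPolynomial.algebraTensorAlgEquiv_tmul, MvPolynomial.smul_eq_C_mul,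
        MvPolynomial.eval₂_mul, MvPolynomial.eval₂_C, MvPolynomial.eval₂_map]
      simp [MvPolynomial.aeval_def]
    | add x y hx hy => simp only [map_add, hx, hy, MvPolynomial.eval₂_add]
  rw [injective_iff_map_eq_zero]
  intro y hy
  obtain ⟨x, rfl⟩ := hG y
  rw [hFG] at hy
  have h0 := MvPolynomial.eq_zero_of_eval₂_eq_zero_of_shift τ h (φ : Z →+* C) hφ hτφ hτh _ hy
  rw [(map_eq_zero_iff _ (MvPolynomial.algebraTensorAlgEquiv k Z).injective).mp h0, map_zero]

theorem mem_adjoin_fixed_of_shift [CharZero k] [Finite I]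
    (hcomm : ∀ i j c, τ i (τ j c) = τ j (τ i c))
    (hτh : ∀ i j, τ i (h j) = h j + if i = j then 1 else 0)
    (hnil : ∀ i c, ∃ n, (fun x ↦ τ i x - x)^[n] c = 0) (c : C) :
    c ∈ Algebra.adjoin k ({x | ∀ i, τ i x = x} ∪ Set.range h) := by
  have := Fintype.ofFinite I
  suffices H : ∀ s : Finset I, ∀ c,
      c ∈ Algebra.adjoin k ({x | ∀ i ∈ s, τ i x = x} ∪ Set.range h) by
    simpa using H Finset.univ c
  intro s
  induction s using Finset.induction_on with
  | empty => exact fun c ↦ Algebra.subset_adjoin (Or.inl (by simp))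
  | insert i s his ih =>
    set S := Algebra.adjoin k ({x | ∀ j ∈ insert i s, τ j x = x} ∪ Set.range h) with hS
    have hhS (j : I) : h j ∈ S := Algebra.subset_adjoin (Or.inr ⟨j, rfl⟩)
    suffices H : ∀ n, ∀ x, (∀ j ∈ s, τ j x = x) → (fun x ↦ τ i x - x)^[n] x = 0 → x ∈ S by
      intro c
      refine Algebra.adjoin_le (Set.union_subset (fun x hx ↦ ?_) ?_) (ih c)
      · obtain ⟨n, hn⟩ := hnil i x
        exact H n x hx hn
      · rintro _ ⟨j, rfl⟩
        exact hhS j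
    let β (n : ℕ) : C := Nat.rec 1 (fun n b ↦ (h i - n) * b) n
    have hβsucc (n : ℕ) : β (n + 1) = (h i - n) * β n := rfl
    have hβS (n : ℕ) : β n ∈ S := by
      induction n with
      | zero => exact one_mem S
      | succ n ihn => exact mul_mem (sub_mem (hhS i) (natCast_mem S n)) ihn
    have hβfix (n : ℕ) (j : I) (hj : j ∈ s) : τ j (β n) = β n := by
      have hji : j ≠ i := fun hji ↦ his (hji ▸ hj)
      induction n with
      | zero => exact map_one _
      | succ n ihn => simp [hβsucc, ihn, hτh, hji]
    have hβ (n : ℕ) : τ i (β (n + 1)) = β (n + 1) + (n + 1) * β n := by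
      induction n with
      | zero => simp [hτh, β]
      | succ n ihn =>
        rw [hβsucc (n + 1), map_mul, ihn, map_sub, map_natCast, hτh, if_pos rfl, hβsucc n]
        push_cast
        ring
    have hiter (n : ℕ) (y : C) (hy : τ i y = y) :
        (fun x ↦ τ i x - x)^[n] (β n * y) = n.factorial * y := by
      induction n generalizing y with
      | zero => simp [β]
      | succ n ihn =>
        have h1 : τ i (β (n + 1) * y) - β (n + 1) * y = β n * ((n + 1) * y) := by
          rw [map_mul, hy, hβ]
          ring
        rw [Function.iterate_succ_apply, h1, ihn _ (by simp [hy]), Nat.factorial_succ]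
        push_cast
        ring
    have hsub (n : ℕ) (x y : C) : (fun x ↦ τ i x - x)^[n] (x - y) =
        (fun x ↦ τ i x - x)^[n] x - (fun x ↦ τ i x - x)^[n] y := by
      induction n generalizing x y with
      | zero => rfl
      | succ n ihn =>
        simp only [Function.iterate_succ_apply, ← ihn, map_sub]
        congr 1
        ring
    intro n
    induction n with
    | zero =>
      intro x _ hx
      rw [show x = 0 from hx]
      exact zero_mem S
    | succ n ihn =>
      intro x hxs hx
      set y := (fun x ↦ τ i x - x)^[n] x with hy
      have hyi : τ i y = y := by
        rw [Function.iterate_succ_apply', ← hy] at hx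
        exact sub_eq_zero.mp hx
      have hys (j : I) (hj : j ∈ s) : τ j y = y := by
        have hgen (m : ℕ) : τ j ((fun x ↦ τ i x - x)^[m] x) = (fun x ↦ τ i x - x)^[m] x := by
          induction m with
          | zero => exact hxs j hj
          | succ m ihm => rw [Function.iterate_succ_apply', map_sub, hcomm, ihm]
        exact hgen n
      have hyS : y ∈ S := Algebra.subset_adjoin (Or.inl fun j hj ↦ by
        rcases Finset.mem_insert.mp hj with rfl | hj
        exacts [hyi, hys j hj])
      have hn : (n.factorial : k) ≠ 0 := Nat.cast_ne_zero.mpr n.factorial_ne_zero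
      set y' := (n.factorial : k)⁻¹ • y with hy'
      have hy'y : (n.factorial : C) * y' = y := by
        rw [hy', ← nsmul_eq_mul, ← Nat.cast_smul_eq_nsmul k, smul_inv_smul₀ hn]
      have hxy : x - β n * y' ∈ S := ihn _
        (fun j hj ↦ by rw [map_sub, map_mul, hxs j hj, hβfix n j hj, hy', map_smul, hys j hj])
        (by rw [hsub, hiter n y' (by rw [hy', map_smul, hyi]), hy'y, ← hy, sub_self])
      have hy'S : y' ∈ S := S.smul_mem hyS _
      simpa using add_mem hxy (mul_mem (hβS n) hy'S)

end UnipotentShifts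

section WeightVectors

variable {k A V : Type*} [Field k] [Ring A] [Algebra k A] [AddCommGroup V] [Module k V]

/-- `a` is a vector of weight `γ` for the commutator action of `V` on `A` through `j`. -/
def IsCommutatorWeightVector (j : V →ₗ[k] A) (γ : Module.Dual k V) (a : A) : Prop :=
  ∀ t, j t * a = a * j t + γ t • a

/-- The centre of the centraliser of the range of `j`. -/
def centerOfCentralizer (j : V →ₗ[k] A) : Subalgebra k A :=
  Subalgebra.centralizer k (Set.range j) ⊓
    Subalgebra.centralizer k (Subalgebra.centralizer k (Set.range j) : Set A)

variable {j : V →ₗ[k] A} {γ δ : Module.Dual k V} {a b c d e f : A}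

theorem isCommutatorWeightVector_zero_iff :
    IsCommutatorWeightVector j 0 a ↔ a ∈ Subalgebra.centralizer k (Set.range j) := by
  simp [IsCommutatorWeightVector, Subalgebra.mem_centralizer_iff]

theorem mem_centerOfCentralizer_iff :
    c ∈ centerOfCentralizer j ↔ IsCommutatorWeightVector j 0 c ∧
      ∀ a, IsCommutatorWeightVector j 0 a → a * c = c * a := by
  simp only [isCommutatorWeightVector_zero_iff, centerOfCentralizer, Algebra.mem_inf,
    Subalgebra.mem_centralizer_iff k (s := (Subalgebra.centralizer k (Set.range j) : Set A)),
    SetLike.mem_coe]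

theorem IsCommutatorWeightVector.mul (ha : IsCommutatorWeightVector j γ a)
    (hb : IsCommutatorWeightVector j δ b) : IsCommutatorWeightVector j (γ + δ) (a * b) :=
  fun t ↦ by
    rw [← mul_assoc, ha t, add_mul, mul_assoc, hb t, mul_add, LinearMap.add_apply, add_smul,
      smul_mul_assoc, mul_smul_comm, mul_assoc]
    abel

theorem IsCommutatorWeightVector.one : IsCommutatorWeightVector j 0 1 :=
  isCommutatorWeightVector_zero_iff.mpr (one_mem _)

theorem IsCommutatorWeightVector.mul_neg (ha : IsCommutatorWeightVector j γ a)
    (hb : IsCommutatorWeightVector j (-γ) b) : IsCommutatorWeightVector j 0 (a * b) := by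
  simpa using ha.mul hb

theorem IsCommutatorWeightVector.neg_mul (ha : IsCommutatorWeightVector j (-γ) a)
    (hb : IsCommutatorWeightVector j γ b) : IsCommutatorWeightVector j 0 (a * b) := by
  simpa using ha.mul hb

instance : CommRing (centerOfCentralizer j) :=
  { (centerOfCentralizer j).toRing with
    mul_comm := fun c d ↦ Subtype.ext <| (mem_centerOfCentralizer_iff.mp d.2).2 _
      (mem_centerOfCentralizer_iff.mp c.2).1 }

theorem center_le_centerOfCentralizer : Subalgebra.center k A ≤ centerOfCentralizer j :=
  fun _ hz ↦ mem_centerOfCentralizer_iff.mpr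
    ⟨isCommutatorWeightVector_zero_iff.mpr
      (Subalgebra.center_le_centralizer k _ hz), fun a _ ↦ Subalgebra.mem_center_iff.mp hz a⟩

theorem apply_mem_centerOfCentralizer (hj : ∀ s t, j s * j t = j t * j s) (t : V) :
    j t ∈ centerOfCentralizer j :=
  mem_centerOfCentralizer_iff.mpr ⟨fun s ↦ by simp [hj s t], fun a ha ↦ by simpa using (ha t).symm⟩

theorem mul_eq_mul_of_weight
    (hf : IsCommutatorWeightVector j (-γ) f) (her : IsRightRegular e) (hfr : IsRightRegular f)
    (hc : c ∈ centerOfCentralizer j) (hd : c * e = e * d) (hdfe : d * (f * e) = (f * e) * d)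
    {x : A} (hx : IsCommutatorWeightVector j γ x) : c * x = x * d :=
  hfr <| her <| by
    obtain ⟨_, hc1⟩ := mem_centerOfCentralizer_iff.mp hc
    calc c * x * f * e = c * (x * f) * e := by simp only [mul_assoc]
      _ = x * f * (c * e) := by rw [← hc1 _ (hx.mul_neg hf), mul_assoc]
      _ = x * ((f * e) * d) := by rw [hd]; simp only [mul_assoc]
      _ = x * d * f * e := by rw [← hdfe]; simp only [mul_assoc]

theorem exists_mem_centerOfCentralizer_mul_eq (he : IsCommutatorWeightVector j γ e)
    (hf : IsCommutatorWeightVector j (-γ) f) (hel : IsLeftRegular e) (her : IsRightRegular e)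
    (hfr : IsRightRegular f) (hdiv : ∀ a c, a * f = e * c → ∃ d, a = e * d)
    (hc : c ∈ centerOfCentralizer j) :
    ∃ d ∈ centerOfCentralizer j, c * e = e * d := by
  obtain ⟨hc0, hc1⟩ := mem_centerOfCentralizer_iff.mp hc
  obtain ⟨d, hd⟩ := hdiv (c * e) (f * c) (by
    rw [mul_assoc, ← hc1 _ (he.mul_neg hf), mul_assoc])
  have hd0 : IsCommutatorWeightVector j 0 d := fun t ↦ hel <| by
    have h1 := (hc0.mul he) t
    rw [hd, zero_add, ← mul_assoc, he t, add_mul, mul_assoc, mul_assoc, smul_mul_assoc,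
      add_left_inj] at h1
    simpa using h1
  have hdfe : e * (d * (f * e)) = e * ((f * e) * d) := by
    calc e * (d * (f * e)) = c * (e * f) * e := by simp only [← mul_assoc, hd]
      _ = e * f * (c * e) := by rw [← hc1 _ (he.mul_neg hf), mul_assoc]
      _ = e * ((f * e) * d) := by rw [hd]; simp only [mul_assoc]
  refine ⟨d, mem_centerOfCentralizer_iff.mpr ⟨hd0, fun a ha ↦ hel ?_⟩, hd⟩
  change e * (a * d) = e * (d * a)
  rw [← mul_assoc, ← mul_eq_mul_of_weight hf her hfr hc hd (hel hdfe)
    (by simpa using he.mul ha), ← mul_assoc, ← mul_assoc, hd]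

theorem exists_shift (he : IsCommutatorWeightVector j γ e)
    (hf : IsCommutatorWeightVector j (-γ) f) (hel : IsLeftRegular e) (her : IsRightRegular e)
    (hfr : IsRightRegular f) (hdiv : ∀ a c, a * f = e * c → ∃ d, a = e * d) :
    ∃ τ : centerOfCentralizer j →ₐ[k] centerOfCentralizer j, ∀ c : centerOfCentralizer j,
      (c : A) * e = e * τ c := by
  have h (c : centerOfCentralizer j) : ∃ d : centerOfCentralizer j, (c : A) * e = e * d := by
    obtain ⟨d, hd, hcd⟩ := exists_mem_centerOfCentralizer_mul_eq he hf hel her hfr hdiv c.2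
    exact ⟨⟨d, hd⟩, hcd⟩
  choose τ hτ using h
  refine ⟨AlgHom.ofLinearMap ⟨⟨τ, fun c d ↦ ?_⟩, fun r c ↦ ?_⟩ ?_ fun c d ↦ ?_, hτ⟩
  · refine Subtype.ext (hel ?_)
    change e * (τ (c + d) : A) = e * ((τ c : A) + τ d)
    rw [mul_add, ← hτ, ← hτ, ← hτ, ← add_mul, Subalgebra.coe_add]
  · refine Subtype.ext (hel ?_)
    change e * (τ (r • c) : A) = e * (r • (τ c : A))
    rw [mul_smul_comm, ← hτ, ← hτ, ← smul_mul_assoc, Subalgebra.coe_smul]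
  · refine Subtype.ext (hel ?_)
    change e * (τ 1 : A) = e * 1
    rw [← hτ, Subalgebra.coe_one, one_mul, mul_one]
  · refine Subtype.ext (hel ?_)
    change e * (τ (c * d) : A) = e * ((τ c : A) * τ d)
    rw [← mul_assoc, ← hτ, ← hτ, Subalgebra.coe_mul, mul_assoc, mul_assoc, ← hτ]

theorem commute_of_weight (he : IsCommutatorWeightVector j γ e)
    (hf : IsCommutatorWeightVector j (-γ) f) (her : IsRightRegular e)
    (hfr : IsRightRegular f) (hc : c ∈ centerOfCentralizer j) (hce : c * e = e * c) {x : A}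
    (hx : IsCommutatorWeightVector j γ x) : c * x = x * c :=
  mul_eq_mul_of_weight hf her hfr hc hce
    ((mem_centerOfCentralizer_iff.mp hc).2 _ (hf.neg_mul he)).symm hx

variable {I : Type*} (γ : I → Module.Dual k V) (e f : I → A)

theorem commute_of_mem_closure (he : ∀ i, IsCommutatorWeightVector j (γ i) (e i))
    (hf : ∀ i, IsCommutatorWeightVector j (-γ i) (f i))
    (hel : ∀ i, IsLeftRegular (e i)) (her : ∀ i, IsRightRegular (e i))
    (hfl : ∀ i, IsLeftRegular (f i)) (hfr : ∀ i, IsRightRegular (f i))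
    (hc : c ∈ centerOfCentralizer j) (hce : ∀ i, c * e i = e i * c) {β : Module.Dual k V}
    (hβ : β ∈ AddSubmonoid.closure (Set.range γ)) :
    (∀ x, IsCommutatorWeightVector j β x → c * x = x * c) ∧
      ∀ x, IsCommutatorWeightVector j (-β) x → c * x = x * c := by
  suffices h : ∃ a b, IsCommutatorWeightVector j β a ∧ IsCommutatorWeightVector j (-β) b ∧
      IsLeftRegular a ∧ IsRightRegular a ∧ IsLeftRegular b ∧ IsRightRegular b ∧
      c * a = a * c ∧ c * b = b * c by
    obtain ⟨a, b, ha, hb, hal, har, hbl, hbr, hca, hcb⟩ := h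
    exact ⟨fun x hx ↦ commute_of_weight ha hb har hbr hc hca hx, fun x hx ↦
      commute_of_weight hb (by simpa using ha) hbr har hc hcb hx⟩
  induction hβ using AddSubmonoid.closure_induction with
  | zero =>
    exact ⟨1, 1, .one, by simpa using .one, isRegular_one.left, isRegular_one.right,
      isRegular_one.left, isRegular_one.right, by simp, by simp⟩
  | mem β hβ =>
    obtain ⟨i, rfl⟩ := hβ
    refine ⟨e i, f i, he i, hf i, hel i, her i, hfl i, hfr i, hce i, hel i ?_⟩
    change e i * (c * f i) = e i * (f i * c)
    rw [← mul_assoc, ← mul_assoc, ← hce, mul_assoc,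
      (mem_centerOfCentralizer_iff.mp hc).2 _ ((he i).mul_neg (hf i))]
  | add β β' _ _ hβ hβ' =>
    obtain ⟨a, b, ha, hb, hal, har, hbl, hbr, hca, hcb⟩ := hβ
    obtain ⟨a', b', ha', hb', hal', har', hbl', hbr', hca', hcb'⟩ := hβ'
    refine ⟨a * a', b * b', ha.mul ha', by simpa [add_comm] using hb.mul hb', hal.mul hal',
      har.mul har', hbl.mul hbl', hbr.mul hbr', ?_, ?_⟩
    · rw [← mul_assoc, hca, mul_assoc, hca', mul_assoc]
    · rw [← mul_assoc, hcb, mul_assoc, hcb', mul_assoc]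

theorem shift_comm (he : ∀ i, IsCommutatorWeightVector j (γ i) (e i))
    (hf : ∀ i, IsCommutatorWeightVector j (-γ i) (f i))
    (hel : ∀ i, IsLeftRegular (e i)) (her : ∀ i, IsRightRegular (e i))
    (hfr : ∀ i, IsRightRegular (f i))
    (τ : I → centerOfCentralizer j →ₐ[k] centerOfCentralizer j)
    (hτ : ∀ i (c : centerOfCentralizer j), (c : A) * e i = e i * τ i c)
    (i i' : I) (c : centerOfCentralizer j) : τ i (τ i' c) = τ i' (τ i c) := by
  have hw : IsCommutatorWeightVector j (γ i + γ i') (e i' * e i) := by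
    simpa [add_comm] using (he i').mul (he i)
  have hw' : IsCommutatorWeightVector j (-(γ i + γ i')) (f i * f i') := by
    simpa [add_comm] using (hf i).mul (hf i')
  have h1 : (c : A) * (e i' * e i) = (e i' * e i) * (τ i (τ i' c) : A) := by
    rw [← mul_assoc, hτ, mul_assoc, hτ, mul_assoc]
  have h2 : (c : A) * (e i * e i') = (e i * e i') * (τ i' (τ i c) : A) := by
    rw [← mul_assoc, hτ, mul_assoc, hτ, mul_assoc]
  have h3 := mul_eq_mul_of_weight hw' ((her i').mul (her i)) ((hfr i).mul (hfr i')) c.2 h1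
    ((mem_centerOfCentralizer_iff.mp (τ i (τ i' c)).2).2 _ (hw'.neg_mul hw)).symm
    ((he i).mul (he i'))
  exact Subtype.ext (((hel i).mul (hel i')) (h3.symm.trans h2))

theorem iterate_shift_sub (i : I)
    (τ : I → centerOfCentralizer j →ₐ[k] centerOfCentralizer j)
    (hτ : ∀ i (c : centerOfCentralizer j), (c : A) * e i = e i * τ i c)
    (hel : IsLeftRegular (e i)) (hnil : ∀ a, ∃ n, (fun a ↦ a * e i - e i * a)^[n] a = 0)
    (c : centerOfCentralizer j) : ∃ n, (fun x ↦ τ i x - x)^[n] c = 0 := by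
  obtain ⟨n, hn⟩ := hnil c
  refine ⟨n, Subtype.ext ((hel.pow n) ?_)⟩
  have key (n m : ℕ) (c : centerOfCentralizer j) :
      (fun a ↦ a * e i - e i * a)^[n] (e i ^ m * c) =
        e i ^ (m + n) * ((fun x ↦ τ i x - x)^[n] c : centerOfCentralizer j) := by
    induction n generalizing m c with
    | zero => rfl
    | succ n ih =>
      have h1 : e i ^ m * (c : A) * e i - e i * (e i ^ m * c) =
          e i ^ (m + 1) * ((τ i c - c : centerOfCentralizer j) : A) := by
        rw [mul_assoc, hτ, ← mul_assoc, ← mul_assoc, ← pow_succ, ← pow_succ', ← mul_sub,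
          Subalgebra.coe_sub]
      rw [Function.iterate_succ_apply, h1, ih, Function.iterate_succ_apply, add_assoc,
        add_comm 1]
  have h0 := key n 0 c
  rw [pow_zero, one_mul, hn, zero_add] at h0
  simpa using h0.symm

theorem shift_apply [DecidableEq I] (hj : ∀ s t, j s * j t = j t * j s)
    (he : ∀ i, IsCommutatorWeightVector j (γ i) (e i)) (hel : ∀ i, IsLeftRegular (e i))
    (τ : I → centerOfCentralizer j →ₐ[k] centerOfCentralizer j)
    (hτ : ∀ i (c : centerOfCentralizer j), (c : A) * e i = e i * τ i c)
    (t : I → V) (ht : ∀ i i', γ i (t i') = if i = i' then 1 else 0) (i i' : I) :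
    τ i ⟨j (t i'), apply_mem_centerOfCentralizer hj _⟩ =
      ⟨j (t i'), apply_mem_centerOfCentralizer hj _⟩ + if i = i' then 1 else 0 := by
  refine Subtype.ext (hel i ?_)
  change e i * (τ i _ : A) = _
  rw [← hτ]
  change j (t i') * e i = _
  rw [he i, ht]
  split_ifs <;> simp [mul_add]

theorem center_of_centralizer_of_weights [CharZero k] [Finite I]
    (hj : ∀ s t, j s * j t = j t * j s)
    (he : ∀ i, IsCommutatorWeightVector j (γ i) (e i))
    (hf : ∀ i, IsCommutatorWeightVector j (-γ i) (f i))
    (hel : ∀ i, IsLeftRegular (e i)) (her : ∀ i, IsRightRegular (e i))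
    (hfl : ∀ i, IsLeftRegular (f i)) (hfr : ∀ i, IsRightRegular (f i))
    (hdiv : ∀ i a c, a * f i = e i * c → ∃ d, a = e i * d)
    (hnil : ∀ i a, ∃ n, (fun a ↦ a * e i - e i * a)^[n] a = 0)
    (t : I → V) (ht : ∀ i i' [Decidable (i = i')], γ i (t i') = if i = i' then 1 else 0)
    (hspan : Submodule.span k (Set.range t) = ⊤)
    (S : Set A) (hS : Algebra.adjoin k (Set.range j ∪ S) = ⊤)
    (hSw : ∀ x ∈ S, ∃ β ∈ AddSubmonoid.closure (Set.range γ),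
      IsCommutatorWeightVector j β x ∨ IsCommutatorWeightVector j (-β) x)
    (U : Subalgebra k A) (hU : U = Algebra.adjoin k (Set.range j)) :
    centerOfCentralizer j = Algebra.adjoin k ((Subalgebra.center k A : Set A) ∪ Set.range j) ∧
      ∃ F : (Subalgebra.center k A) ⊗[k] U →ₐ[k] A,
        (∀ (z : Subalgebra.center k A) (u : U), F (z ⊗ₜ[k] u) = (z : A) * u) ∧
        Function.Injective F ∧ F.range = centerOfCentralizer j := by
  classical
  choose τ hτ using fun i ↦ exists_shift (he i) (hf i) (hel i) (her i) (hfr i) (hdiv i)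
  let h (i : I) : centerOfCentralizer j := ⟨j (t i), apply_mem_centerOfCentralizer hj _⟩
  have hτh (i i') : τ i (h i') = h i' + if i = i' then 1 else 0 :=
    shift_apply γ e hj he hel τ hτ t (fun i i' ↦ ht i i') i i'
  have hfixed (c : centerOfCentralizer j) (hc : ∀ i, τ i c = c) :
      (c : A) ∈ Subalgebra.center k A := by
    have hce (i : I) : (c : A) * e i = e i * c := by rw [hτ, hc]
    have hle : Algebra.adjoin k (Set.range j ∪ S) ≤ Subalgebra.centralizer k {(c : A)} := by
      refine Algebra.adjoin_le (Set.union_subset ?_ fun x hx ↦ ?_)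
      · rintro _ ⟨s, rfl⟩
        rw [SetLike.mem_coe, Subalgebra.mem_centralizer_iff]
        rintro _ rfl
        simpa using ((mem_centerOfCentralizer_iff.mp c.2).1 s).symm
      · rw [SetLike.mem_coe, Subalgebra.mem_centralizer_iff]
        rintro _ rfl
        obtain ⟨β, hβ, hx⟩ := hSw x hx
        have hcomm := commute_of_mem_closure γ e f he hf hel her hfl hfr c.2 hce hβ
        exact hx.elim (hcomm.1 x) (hcomm.2 x)
    rw [hS] at hle
    refine Subalgebra.mem_center_iff.mpr fun a ↦ ?_
    exact ((Subalgebra.mem_centralizer_iff k).mp (hle (Algebra.mem_top (x := a))) _ rfl).symm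
  have hUle : U ≤ centerOfCentralizer j := by
    rw [hU]
    refine Algebra.adjoin_le ?_
    rintro _ ⟨s, rfl⟩
    exact apply_mem_centerOfCentralizer hj s
  have hUt : U = Algebra.adjoin k (Set.range fun i ↦ j (t i)) := by
    rw [hU]
    refine le_antisymm (Algebra.adjoin_le ?_) (Algebra.adjoin_mono ?_)
    · rintro _ ⟨s, rfl⟩
      have hs : j s ∈ (Submodule.span k (Set.range t)).map j :=
        Submodule.mem_map_of_mem (hspan ▸ Submodule.mem_top)
      rw [Submodule.map_span, ← Set.range_comp] at hs
      exact Algebra.span_le_adjoin k _ hs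
    · rintro _ ⟨i, rfl⟩
      exact ⟨t i, rfl⟩
  have hadjoin : centerOfCentralizer j =
      Algebra.adjoin k ((Subalgebra.center k A : Set A) ∪ Set.range j) := by
    refine le_antisymm (fun c hc ↦ ?_) (Algebra.adjoin_le (Set.union_subset
      center_le_centerOfCentralizer ?_))
    · have h1 := mem_adjoin_fixed_of_shift τ h (shift_comm γ e f he hf hel her hfr τ hτ) hτh
        (fun i ↦ iterate_shift_sub e i τ hτ (hel i) (hnil i)) ⟨c, hc⟩
      have h2 := (Subalgebra.mem_map (f := (centerOfCentralizer j).val)).mpr ⟨_, h1, rfl⟩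
      rw [AlgHom.map_adjoin] at h2
      refine Algebra.adjoin_mono ?_ h2
      rintro _ ⟨x, hx | ⟨i, rfl⟩, rfl⟩
      · exact Or.inl (hfixed x hx)
      · exact Or.inr ⟨t i, rfl⟩
    · rintro _ ⟨s, rfl⟩
      exact apply_mem_centerOfCentralizer hj s
  let φ := Subalgebra.inclusion (center_le_centerOfCentralizer (j := j))
  let ψ := Subalgebra.inclusion hUle
  have hinj := productMap_injective_of_shift τ h φ ψ (Subalgebra.inclusion_injective _)
    (Subalgebra.inclusion_injective _) (fun i z ↦ Subtype.ext (hel i ?_)) ?_ hτh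
  · let F := (centerOfCentralizer j).val.comp
      (Algebra.TensorProduct.lift φ ψ fun _ _ ↦ Commute.all _ _)
    have hF (z : Subalgebra.center k A) (u : U) : F (z ⊗ₜ[k] u) = (z : A) * u := by
      simp [F, φ, ψ]
    refine ⟨hadjoin, F, hF, Subtype.val_injective.comp hinj, le_antisymm ?_ ?_⟩
    · rintro _ ⟨x, rfl⟩
      exact Subtype.property _
    · rw [hadjoin]
      refine Algebra.adjoin_le (Set.union_subset (fun z hz ↦ ?_) ?_)
      · exact ⟨(⟨z, hz⟩ : Subalgebra.center k A) ⊗ₜ 1, by simpa using hF ⟨z, hz⟩ 1⟩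
      · rintro _ ⟨s, rfl⟩
        have hs : j s ∈ U := hU ▸ Algebra.subset_adjoin ⟨s, rfl⟩
        exact ⟨1 ⊗ₜ (⟨j s, hs⟩ : U), by simpa using hF 1 ⟨j s, hs⟩⟩
  · change e i * (τ i (φ z) : A) = e i * z
    rw [← hτ]
    exact (Subalgebra.mem_center_iff.mp z.2 (e i)).symm
  · refine Subalgebra.map_injective (f := (centerOfCentralizer j).val) Subtype.val_injective ?_
    rw [AlgHom.map_adjoin, ← AlgHom.range_comp, ← Set.range_comp]
    refine Eq.trans ?_ hUt
    exact (congrArg AlgHom.range (AlgHom.ext fun _ ↦ rfl)).trans U.range_val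

end WeightVectors

section LocallyNilpotent

variable {k A : Type*} [CommRing k] [Ring A] [Algebra k A]

theorem iterate_leibniz_eq_zero (D : A →ₗ[k] A) (hD : ∀ a b, D (a * b) = D a * b + a * D b)
    {m n : ℕ} {a b : A} (ha : D^[m] a = 0) (hb : D^[n] b = 0) : D^[m + n] (a * b) = 0 := by
  induction m generalizing n a b with
  | zero =>
    rw [show a = 0 from ha, zero_mul, iterate_map_zero]
  | succ m ihm =>
    induction n generalizing a b with
    | zero => rw [show b = 0 from hb, mul_zero, iterate_map_zero]
    | succ n ihn =>
      rw [← add_assoc, Function.iterate_succ_apply, hD, iterate_map_add,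
        ihn ha (by rwa [Function.iterate_succ_apply] at hb), add_zero,
        show m + 1 + n = m + (n + 1) by ring,
        ihm (by rwa [Function.iterate_succ_apply] at ha) hb]

theorem exists_iterate_commutator_eq_zero {s : Set A} (hs : Algebra.adjoin k s = ⊤) (e : A)
    (h : ∀ x ∈ s, ∃ n, (fun a ↦ a * e - e * a)^[n] x = 0) (a : A) :
    ∃ n, (fun a ↦ a * e - e * a)^[n] a = 0 := by
  let D : A →ₗ[k] A := LinearMap.mulRight k e - LinearMap.mulLeft k e
  have hD (a b : A) : D (a * b) = D a * b + a * D b := by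
    simp only [D, LinearMap.sub_apply, LinearMap.mulRight_apply, LinearMap.mulLeft_apply, sub_mul,
      mul_sub, mul_assoc]
    abel
  have hD1 : D 1 = 0 := by simp [D]
  change ∃ n, D^[n] a = 0
  induction (hs ▸ Algebra.mem_top : a ∈ Algebra.adjoin k s) using Algebra.adjoin_induction with
  | mem x hx => exact h x hx
  | algebraMap r => exact ⟨1, by simp [Algebra.algebraMap_eq_smul_one, hD1]⟩
  | add x y _ _ hx hy =>
    obtain ⟨m, hm⟩ := hx
    obtain ⟨n, hn⟩ := hy
    refine ⟨m + n, ?_⟩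
    rw [iterate_map_add, Function.iterate_add_apply D m n y, hn, iterate_map_zero, add_comm m,
      Function.iterate_add_apply, hm, iterate_map_zero, add_zero]
  | mul x y _ _ hx hy =>
    obtain ⟨m, hm⟩ := hx
    obtain ⟨n, hn⟩ := hy
    exact ⟨m + n, iterate_leibniz_eq_zero D hD hm hn⟩

end LocallyNilpotent

section RootVectors

attribute [local instance] LieRing.ofAssociativeRing

variable {k L : Type*} [Field k] [LieRing L] [LieAlgebra k L]

theorem IsSl2Triple.linearIndependent [CharZero k] {h e f : L} (H : IsSl2Triple h e f) :
    LinearIndependent k ![e, f] := by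
  have he : e ≠ 0 := fun he ↦ H.h_ne_zero (by rw [← H.lie_e_f, he, zero_lie])
  have hf : f ≠ 0 := fun hf ↦ H.h_ne_zero (by rw [← H.lie_e_f, hf, lie_zero])
  rw [LinearIndependent.pair_iff]
  intro s t hst
  have h1 : s • ⁅h, e⁆ + t • ⁅h, f⁆ = 0 := by
    rw [← lie_smul, ← lie_smul, ← lie_add, hst, lie_zero]
  rw [H.lie_h_e_nsmul, H.lie_h_f_nsmul] at h1
  have h2 : (4 * s) • e = (2 : k) • (s • e + t • f) + (s • (2 • e) + t • -(2 • f)) := by module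
  have h3 : (4 * t) • f = (2 : k) • (s • e + t • f) - (s • (2 • e) + t • -(2 • f)) := by module
  rw [hst, h1] at h2 h3
  simpa [he, hf] using And.intro h2 h3

theorem exists_iterate_commutator_ι_eq_zero {e : L} (he : IsNilpotent (LieAlgebra.ad k L e))
    (a : UniversalEnvelopingAlgebra k L) :
    ∃ n, (fun a ↦ a * ι k e - ι k e * a)^[n] a = 0 := by
  refine exists_iterate_commutator_eq_zero (adjoin_range_ι k L) _ ?_ a
  rintro _ ⟨x, rfl⟩
  obtain ⟨n, hn⟩ := he
  have key (n : ℕ) (x : L) : (fun a ↦ a * ι k e - ι k e * a)^[n] (ι k x) =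
      (-1) ^ n * ι k ((LieAlgebra.ad k L e ^ n) x) := by
    induction n generalizing x with
    | zero => simp
    | succ n ih =>
      have h1 : ι k x * ι k e - ι k e * ι k x = ι k (-⁅e, x⁆) := by
        rw [lie_skew, LieHom.map_lie, LieRing.of_associative_ring_bracket]
      rw [Function.iterate_succ_apply, h1, ih, pow_succ (LieAlgebra.ad k L e), Module.End.mul_apply,
        LieAlgebra.ad_apply, map_neg, map_neg, pow_succ, mul_neg, mul_neg_one, neg_mul]
  exact ⟨n, by rw [key, hn]; simp⟩

end RootVectors

section CartanSubalgebra

attribute [local instance] LieRing.ofAssociativeRing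

open LieAlgebra.IsKilling LieModule

variable {k L : Type*} [Field k] [LieRing L] [LieAlgebra k L] (H : LieSubalgebra k L)

/-- The inclusion of a Lie subalgebra in the enveloping algebra. -/
def cartanInclusion : H →ₗ[k] UniversalEnvelopingAlgebra k L :=
  (ι k : L →ₗ⁅k⁆ UniversalEnvelopingAlgebra k L).toLinearMap ∘ₗ H.toSubmodule.subtype

theorem range_cartanInclusion :
    Set.range (cartanInclusion H) = ι k '' (H : Set L) := by
  change Set.range (ι k ∘ ((↑) : H → L)) = _
  rw [Set.range_comp, Subtype.range_coe]

variable [FiniteDimensional k L] [H.IsCartanSubalgebra] [LieModule.IsTriangularizable k H L]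

theorem adjoin_cartan_union_rootSpaces :
    Algebra.adjoin k (Set.range (cartanInclusion H) ∪
      {a | ∃ α : H.root, ∃ x ∈ rootSpace H α.1, ι k x = a}) = ⊤ := by
  rw [eq_top_iff, ← adjoin_range_ι]
  refine Algebra.adjoin_le ?_
  rintro _ ⟨x, rfl⟩
  have hx : x ∈ ⨆ α : Weight k H L, rootSpace H α := by
    simp [iSup_genWeightSpace_eq_top' k H L]
  rw [SetLike.mem_coe]
  induction hx using LieSubmodule.iSup_induction' with
  | mem α x hx =>
    refine Algebra.subset_adjoin ?_
    by_cases hα : α.IsZero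
    · rw [hα, LieAlgebra.rootSpace_zero_eq] at hx
      exact Or.inl (range_cartanInclusion H ▸ ⟨x, hx, rfl⟩)
    · exact Or.inr ⟨⟨α, by simpa using hα⟩, x, hx, rfl⟩
  | zero => simp
  | add x y _ _ hx hy => simpa using add_mem hx hy

variable {H} [CharZero k] [LieAlgebra.IsKilling k L]

theorem isCommutatorWeightVector_of_mem_rootSpace {α : Module.Dual k H} {x : L}
    (hx : x ∈ rootSpace H α) : IsCommutatorWeightVector (cartanInclusion H) α (ι k x) := fun t ↦ by
  have h := congrArg (ι k) (lie_eq_smul_of_mem_rootSpace hx t)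
  rw [LieSubalgebra.coe_bracket_of_module, LieHom.map_lie, LieRing.of_associative_ring_bracket,
    map_smul, sub_eq_iff_eq_add'] at h
  exact h

variable (H)

theorem center_of_cartan_centralizer_of_isKilling
    (U : Subalgebra k (UniversalEnvelopingAlgebra k L))
    (hU : U = Algebra.adjoin k (Set.range (cartanInclusion H))) :
    centerOfCentralizer (cartanInclusion H) = Algebra.adjoin k
        ((Subalgebra.center k (UniversalEnvelopingAlgebra k L) :
          Set (UniversalEnvelopingAlgebra k L)) ∪ Set.range (cartanInclusion H)) ∧
      ∃ F : (Subalgebra.center k (UniversalEnvelopingAlgebra k L)) ⊗[k] U →ₐ[k]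
          UniversalEnvelopingAlgebra k L,
        (∀ (z : Subalgebra.center k (UniversalEnvelopingAlgebra k L)) (u : U),
          F (z ⊗ₜ[k] u) = (z : UniversalEnvelopingAlgebra k L) * u) ∧
        Function.Injective F ∧ F.range = centerOfCentralizer (cartanInclusion H) := by
  have had : Function.Injective (LieAlgebra.ad k L) := by
    rw [← LieHom.ker_eq_bot, LieAlgebra.ad_ker_eq_self_module_ker]
    exact (LieAlgebra.self_module_ker_eq_center k L).trans (LieAlgebra.center_eq_bot k L)
  classical
  obtain ⟨b⟩ := (rootSystem H).nonempty_base
  have hnz (α : H.root) : α.1.IsNonZero :=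
    (Finset.mem_filter.mp α.2).2
  have hsl (i : b.support) := exists_isSl2Triple_of_weight_isNonZero
    (α := i.1.1) (hnz i.1)
  choose h e f hsl2 he hf using hsl
  have hne (i : b.support) : ((i.1.1 : Weight k H L) : H → k) ≠ 0 :=
    hnz i.1
  have hwe (i : b.support) : e i ∈ rootSpace H ((rootSystem H).root i) := he i
  have hwf (i : b.support) : f i ∈ rootSpace H (-(rootSystem H).root i : Module.Dual k H) := hf i
  have hli (i : b.support) : LinearIndependent k ![e i, f i] := (hsl2 i).linearIndependent
  have hli' (i : b.support) : LinearIndependent k ![f i, e i] := (hsl2 i).symm.linearIndependent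
  let B := (b.toWeightBasis.dualBasis).map (Module.evalEquiv k H).symm
  refine center_of_centralizer_of_weights (fun i : b.support ↦ (rootSystem H).root i)
    (fun i ↦ ι k (e i)) (fun i ↦ ι k (f i)) ?_
    (fun i ↦ isCommutatorWeightVector_of_mem_rootSpace (hwe i))
    (fun i ↦ isCommutatorWeightVector_of_mem_rootSpace (hwf i))
    (fun i ↦ (pbw_pair had (hli i)).1) (fun i ↦ (pbw_pair had (hli' i)).2.1)
    (fun i ↦ (pbw_pair had (hli' i)).1) (fun i ↦ (pbw_pair had (hli i)).2.1)
    (fun i ↦ (pbw_pair had (hli i)).2.2)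
    (fun i ↦ exists_iterate_commutator_ι_eq_zero
      (LieAlgebra.isNilpotent_ad_of_mem_rootSpace H (hne i) (he i)))
    B ?_ B.span_eq _ (adjoin_cartan_union_rootSpaces H) ?_ U hU
  · intro s t
    have h1 : ⁅(s : L), (t : L)⁆ = 0 := congrArg Subtype.val (trivial_lie_zero H H s t)
    have h2 := congrArg (ι k) h1
    rw [LieHom.map_lie, LieRing.of_associative_ring_bracket, map_zero, sub_eq_zero] at h2
    exact h2
  · intro i i' _
    have h1 : b.toWeightBasis.repr ((rootSystem H).root i) i' = if i = i' then 1 else 0 := by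
      rw [RootPairing.Base.toWeightBasis_repr_root, Finsupp.single_apply]
    simpa [B] using h1
  · rintro _ ⟨α, x, hx, rfl⟩
    have hx' : x ∈ rootSpace H ((rootSystem H).root α) := hx
    have hw := isCommutatorWeightVector_of_mem_rootSpace hx'
    have hrange : Set.range (fun i : b.support ↦ (rootSystem H).root i) =
        (rootSystem H).root '' b.support := by
      ext
      simp
    rw [hrange]
    rcases b.root_mem_or_neg_mem α with hα | hα
    · exact ⟨_, hα, Or.inl hw⟩
    · exact ⟨_, hα, Or.inr (by rwa [neg_neg])⟩

end CartanSubalgebra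

/-- Knop: for `g` semisimple, the centre of the centraliser `U(g)^h` is the
subalgebra generated by `Z(U(g))` and `h`; moreover the multiplication map
`Z(U(g)) ⊗ U(h) → U(g)` is an injective algebra homomorphism whose image is this centre, so
that the centre of `U(g)^h` is isomorphic to `Z(U(g)) ⊗ U(h)`. -/
theorem center_of_cartan_centralizer
    {L : Type} [LieRing L] [LieAlgebra ℂ L] [FiniteDimensional ℂ L]
    [LieAlgebra.IsSemisimple ℂ L]
    (H : LieSubalgebra ℂ L) [H.IsCartanSubalgebra]
    -- `U(g)^h`, the centraliser of `h` in `U(g)`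
    (Uh : Subalgebra ℂ (UniversalEnvelopingAlgebra ℂ L))
    (hUh : Uh = Subalgebra.centralizer ℂ (ι ℂ '' (H : Set L)))
    -- `U(h)`, the subalgebra of `U(g)` generated by `h`
    (UH : Subalgebra ℂ (UniversalEnvelopingAlgebra ℂ L))
    (hUH : UH = Algebra.adjoin ℂ (ι ℂ '' (H : Set L)))
    -- the centre of `U(g)^h`, as a subalgebra of `U(g)`
    (C : Subalgebra ℂ (UniversalEnvelopingAlgebra ℂ L))
    (hC : C = Uh ⊓ Subalgebra.centralizer ℂ
      (Uh : Set (UniversalEnvelopingAlgebra ℂ L))) :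
    C = Algebra.adjoin ℂ
        ((Subalgebra.center ℂ (UniversalEnvelopingAlgebra ℂ L) :
            Set (UniversalEnvelopingAlgebra ℂ L)) ∪ (ι ℂ '' (H : Set L))) ∧
      ∃ F : (Subalgebra.center ℂ (UniversalEnvelopingAlgebra ℂ L)) ⊗[ℂ] UH
          →ₐ[ℂ] UniversalEnvelopingAlgebra ℂ L,
        (∀ (z : Subalgebra.center ℂ (UniversalEnvelopingAlgebra ℂ L)) (u : UH),
          F (z ⊗ₜ[ℂ] u) = (z : UniversalEnvelopingAlgebra ℂ L) * u) ∧
        Function.Injective F ∧ F.range = C := by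
  subst hUh hC
  rw [← range_cartanInclusion] at hUH ⊢
  exact center_of_cartan_centralizer_of_isKilling H UH hUH
end
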